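/- Let 0 < l ≤ 2π and λ₊, λ₋ ≥ 0 with λ₊ ≠ λ₋. There exists C > 0 depending only on l, λ₊, λ₋ such that the following holds. Let u be a minimizer of J(C_1, λ₊, λ₋) on the cone of length l with ∫_{C_1} |Du|² ≤ 1 and such that {u = 0} ∩ C_{1/2} ≠ ∅. Then for every point x₀ ∈ C_{1/4} with u(x₀) > 0: u(x₀) ≤ C · dist(x₀, ∂{u > 0} ∩ C_{1/2}), where dist and the topological boundary ∂ are taken with respect to the cone distance; and if moreover x₀ is not the vertex, then |Du(x₀)| ≤ C (u is smooth near such x₀, being harmonic on its positivity set away from the vertex). -/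

import Mathlib

open MeasureTheory Set

noncomputable section

/-- The cone distance on the cone of length `l`, in polar coordinates:
`d((r,θ),(s,φ)) = sqrt(r² + s² − 2 r s cos(min(δ, π)))` with
`δ = min_{k ∈ ℤ} |θ − φ + k l|`. -/
def coneDist (l : ℝ) (p q : ℝ × ℝ) : ℝ :=
  Real.sqrt (p.1 ^ 2 + q.1 ^ 2 -
    2 * p.1 * q.1 * Real.cos (min (⨅ k : ℤ, |p.2 - q.2 + (k : ℝ) * l|) Real.pi))

/-- A Lipschitz function on the cone ball `C_R` of the cone of length `l`, given in
polar coordinates: `l`-periodic in `θ` and Lipschitz for the cone distance (this forces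
a well-defined vertex value `u 0 _` and continuity at the vertex). -/
structure ConeLip (l R : ℝ) (u : ℝ → ℝ → ℝ) : Prop where
  periodic : ∀ r θ : ℝ, u r (θ + l) = u r θ
  lipschitz : ∃ K : ℝ, ∀ p q : ℝ × ℝ, p.1 ∈ Set.Icc 0 R → q.1 ∈ Set.Icc 0 R →
    |u p.1 p.2 - u q.1 q.2| ≤ K * coneDist l p q

/-- The squared cone gradient `|Du|² = (∂_r u)² + (∂_θ u)²/r²` at a polar point,
computed from Lean's a.e.-defined derivatives. -/
def gradSq (u : ℝ → ℝ → ℝ) (p : ℝ × ℝ) : ℝ :=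
  (deriv (fun s => u s p.2) p.1) ^ 2 + (deriv (fun φ => u p.1 φ) p.2) ^ 2 / p.1 ^ 2

/-- The two-phase functional
`J(u, C_R) = ∫_{C_R} |Du|² + λ₊ area({u > 0} ∩ C_R) + λ₋ area({u < 0} ∩ C_R)`,
computed in polar coordinates with area measure `r dr dθ`, `θ` ranging over `(0, l)`. -/
def Jfun (l lp lm : ℝ) (u : ℝ → ℝ → ℝ) (R : ℝ) : ℝ :=
  ∫ p in Set.Ioo (0:ℝ) R ×ˢ Set.Ioo (0:ℝ) l,
    (gradSq u p + (if 0 < u p.1 p.2 then lp else 0)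
      + (if u p.1 p.2 < 0 then lm else 0)) * p.1

/-- The Dirichlet energy `∫_{C_R} |Du|²` with respect to the area measure `r dr dθ`. -/
def Dir (l : ℝ) (u : ℝ → ℝ → ℝ) (R : ℝ) : ℝ :=
  ∫ p in Set.Ioo (0:ℝ) R ×ˢ Set.Ioo (0:ℝ) l, gradSq u p * p.1

/-- `u` is a minimizer of `J(C_R, λ₊, λ₋)` on the cone of length `l`: a cone Lipschitz
function beating every cone Lipschitz competitor with the same boundary values on
`{r = R}`. -/
def IsMinimizerJ (l lp lm R : ℝ) (u : ℝ → ℝ → ℝ) : Prop :=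
  ConeLip l R u ∧ ∀ w : ℝ → ℝ → ℝ, ConeLip l R w → (∀ θ : ℝ, w R θ = u R θ) →
    Jfun l lp lm u R ≤ Jfun l lp lm w R

/-- A point of the cone ball `C_1` lies on the free boundary `∂{u > 0}` (with respect
to the cone distance) if arbitrarily close to it there are points of `C_1` where
`u > 0` and points where `u ≤ 0`. -/
def InFreeBoundaryPos (l : ℝ) (u : ℝ → ℝ → ℝ) (p : ℝ × ℝ) : Prop :=
  p.1 ∈ Set.Icc (0:ℝ) 1 ∧ ∀ δ > (0:ℝ),
    (∃ q : ℝ × ℝ, q.1 ∈ Set.Icc (0:ℝ) 1 ∧ coneDist l p q < δ ∧ 0 < u q.1 q.2) ∧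
    (∃ q : ℝ × ℝ, q.1 ∈ Set.Icc (0:ℝ) 1 ∧ coneDist l p q < δ ∧ u q.1 q.2 ≤ 0)

/-- Cone distance from `x` to the part of the free boundary `∂{u > 0}` lying in
`C_{1/2}`. -/
def distToFreeBoundary (l : ℝ) (u : ℝ → ℝ → ℝ) (x : ℝ × ℝ) : ℝ :=
  sInf {d : ℝ | ∃ q : ℝ × ℝ, InFreeBoundaryPos l u q ∧ q.1 ∈ Set.Icc (0:ℝ) (1/2) ∧
    d = coneDist l x q}

/-! ### Part 1 -/


/-- Reduction of an angle modulo `l` to `[-l/2, l/2]`. -/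
def wrap (l x : ℝ) : ℝ := x - round (x / l) * l

lemma abs_wrap_le {l : ℝ} (hl : 0 < l) (x : ℝ) : |wrap l x| ≤ l / 2 := by
  have h := abs_sub_round (x / l)
  have : wrap l x = (x / l - round (x / l)) * l := by
    unfold wrap; field_simp
  rw [this, abs_mul, abs_of_pos hl]
  nlinarith

lemma iInf_wrap {l : ℝ} (hl : 0 < l) (x : ℝ) : (⨅ k : ℤ, |x + (k : ℝ) * l|) = |wrap l x| := by
  apply le_antisymm
  · have hb : BddBelow (Set.range fun k : ℤ => |x + (k : ℝ) * l|) :=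
      ⟨0, by rintro _ ⟨k, rfl⟩; positivity⟩
    refine (ciInf_le hb (-round (x / l))).trans (le_of_eq ?_)
    unfold wrap; push_cast; ring_nf
  · refine le_ciInf fun k => ?_
    have h := round_le (x / l) (-k)
    have e1 : wrap l x = (x / l - round (x / l)) * l := by unfold wrap; field_simp
    have e2 : x + k * l = (x / l - ((-k : ℤ) : ℝ)) * l := by push_cast; field_simp; ring
    rw [e1, e2, abs_mul, abs_mul, abs_of_pos hl]
    exact mul_le_mul_of_nonneg_right h hl.le

lemma abs_wrap_le_abs {l : ℝ} (hl : 0 < l) (x : ℝ) : |wrap l x| ≤ |x| := by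
  rw [← iInf_wrap hl]
  have hb : BddBelow (Set.range fun k : ℤ => |x + (k : ℝ) * l|) :=
      ⟨0, by rintro _ ⟨k, rfl⟩; positivity⟩
  refine (ciInf_le hb 0).trans (le_of_eq (by simp))

lemma abs_wrap_eq {l x : ℝ} (hl : 0 < l) (hx : |x| ≤ l / 2) : |wrap l x| = |x| := by
  apply le_antisymm (abs_wrap_le_abs hl x)
  by_cases h0 : round (x / l) = 0
  · simp [wrap, h0]
  · unfold wrap
    have h1 : (1 : ℝ) ≤ |((round (x / l) : ℤ) : ℝ)| := by
      exact_mod_cast Int.one_le_abs h0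
    have h2 : |((round (x / l) : ℤ) : ℝ) * l| ≤ |x| + |x - round (x / l) * l| := by
      have := abs_sub (x) (x - round (x / l) * l)
      simpa using this
    rw [abs_mul, abs_of_pos hl] at h2
    nlinarith

lemma coneDist_wrap {l : ℝ} (hl : 0 < l) (hl2 : l ≤ 2 * Real.pi) (p q : ℝ × ℝ) :
    coneDist l p q = Real.sqrt (p.1 ^ 2 + q.1 ^ 2 -
      2 * p.1 * q.1 * Real.cos (wrap l (p.2 - q.2))) := by
  unfold coneDist
  rw [iInf_wrap hl, min_eq_left, Real.cos_abs]
  linarith [abs_wrap_le hl (p.2 - q.2)]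

/-- The point of the plane with polar coordinates `(r, θ)`. -/
def pol (r θ : ℝ) : ℂ := (r : ℂ) * Complex.exp (θ * Complex.I)

lemma norm_pol_sub (r θ s φ : ℝ) : ‖pol r θ - pol s φ‖ =
    Real.sqrt (r ^ 2 + s ^ 2 - 2 * r * s * Real.cos (θ - φ)) := by
  rw [Complex.norm_def]
  congr 1
  simp only [pol, Complex.normSq_apply, Complex.sub_re, Complex.sub_im, Complex.mul_re,
    Complex.mul_im, Complex.ofReal_re, Complex.ofReal_im, Complex.exp_ofReal_mul_I_re,
    Complex.exp_ofReal_mul_I_im, Real.cos_sub]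
  nlinarith [Real.sin_sq_add_cos_sq θ, Real.sin_sq_add_cos_sq φ]

lemma coneDist_near {l : ℝ} (hl : 0 < l) (hl2 : l ≤ 2 * Real.pi) {r θ s φ : ℝ}
    (h : |θ - φ| ≤ l / 2) : coneDist l (r, θ) (s, φ) = ‖pol r θ - pol s φ‖ := by
  rw [coneDist_wrap hl hl2, norm_pol_sub]
  simp only
  rw [← Real.cos_abs, abs_wrap_eq hl h, Real.cos_abs]

lemma coneDist_shift {l : ℝ} (hl : 0 < l) (hl2 : l ≤ 2 * Real.pi) (r θ s φ : ℝ) :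
    ∃ k : ℤ, |θ - (φ + k * l)| ≤ l / 2 ∧
      coneDist l (r, θ) (s, φ) = ‖pol r θ - pol s (φ + k * l)‖ := by
  refine ⟨round ((θ - φ) / l), ?_, ?_⟩
  · have := abs_wrap_le hl (θ - φ)
    unfold wrap at this
    convert this using 2; ring
  · rw [coneDist_wrap hl hl2, norm_pol_sub]
    simp only [wrap]
    congr 4; ring

lemma pol_add_two_pi (r θ : ℝ) (k : ℤ) : pol r (θ + k * (2 * Real.pi)) = pol r θ := by
  unfold pol
  congr 1
  push_cast
  rw [add_mul, Complex.exp_add]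
  have : Complex.exp ((k : ℂ) * (2 * Real.pi) * Complex.I) = 1 := by
    rw [Complex.exp_eq_one_iff]; exact ⟨k, by ring⟩
  rw [this, mul_one]

lemma coneDist_two_pi (r θ s φ : ℝ) :
    coneDist (2 * Real.pi) (r, θ) (s, φ) = ‖pol r θ - pol s φ‖ := by
  obtain ⟨k, -, hk⟩ := coneDist_shift (l := 2 * Real.pi) (by positivity) le_rfl r θ s φ
  rw [hk, pol_add_two_pi]

lemma abs_sub_le_norm_pol (r θ s φ : ℝ) (hr : 0 ≤ r) (hs : 0 ≤ s) :
    |r - s| ≤ ‖pol r θ - pol s φ‖ := by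
  rw [norm_pol_sub]
  apply Real.le_sqrt_of_sq_le
  rw [sq_abs]
  nlinarith [Real.cos_le_one (θ - φ), mul_nonneg hr hs]

lemma mul_abs_le_norm_pol (r θ s φ : ℝ) (hr : 0 ≤ r) (hs : r ≤ s) (h : |θ - φ| ≤ Real.pi) :
    r * |θ - φ| ≤ 2 * ‖pol r θ - pol s φ‖ := by
  rw [norm_pol_sub]
  have hc := Real.cos_le_one_sub_mul_cos_sq h
  have : r * |θ - φ| / 2 ≤ Real.sqrt (r ^ 2 + s ^ 2 - 2 * r * s * Real.cos (θ - φ)) := by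
    apply Real.le_sqrt_of_sq_le
    rw [div_pow, mul_pow, sq_abs]
    set x := θ - φ
    have hpi : 1 / 8 ≤ 2 / Real.pi ^ 2 := by
      rw [div_le_div_iff₀ (by norm_num) (by positivity)]
      nlinarith [Real.pi_gt_three, Real.pi_le_four]
    have h1 : x ^ 2 / 8 ≤ 1 - Real.cos x := by
      have := mul_le_mul_of_nonneg_right hpi (sq_nonneg x)
      linarith
    have hrs : r ^ 2 ≤ r * s := by nlinarith
    have h2 : r ^ 2 * (x ^ 2 / 8) ≤ r * s * (1 - Real.cos x) :=
      mul_le_mul hrs h1 (by positivity) (mul_nonneg hr (hr.trans hs))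
    nlinarith [sq_nonneg (r - s)]
  linarith

lemma norm_pol_sub_le (r θ s φ : ℝ) (hr : 0 ≤ r) :
    ‖pol r θ - pol s φ‖ ≤ |r - s| + r * |θ - φ| := by
  have h1 : ‖pol r θ - pol r φ‖ ≤ r * |θ - φ| := by
    rw [norm_pol_sub]
    apply Real.sqrt_le_iff.mpr ⟨by positivity, ?_⟩
    rw [mul_pow, sq_abs]
    have := Real.one_sub_sq_div_two_le_cos (x := θ - φ)
    nlinarith [sq_nonneg r]
  have h2 : ‖pol r φ - pol s φ‖ = |r - s| := by
    unfold pol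
    rw [← sub_mul, norm_mul, Complex.norm_exp_ofReal_mul_I, mul_one, ← Complex.ofReal_sub,
      Complex.norm_real, Real.norm_eq_abs]
  calc ‖pol r θ - pol s φ‖ ≤ ‖pol r θ - pol r φ‖ + ‖pol r φ - pol s φ‖ := norm_sub_le_norm_sub_add_norm_sub _ _ _
    _ ≤ _ := by rw [h2]; linarith

/-- Slice-wise Lipschitz functions. -/
structure Slice (l K : ℝ) (V : ℝ → ℝ → ℝ) : Prop where
  K0 : 0 ≤ K
  per : ∀ r θ, V r (θ + l) = V r θ
  lipr : ∀ r s θ, |V r θ - V s θ| ≤ K * |r - s|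
  lipt : ∀ r θ φ, |V r θ - V r φ| ≤ K * |r| * |θ - φ|

lemma per_int {l : ℝ} {f : ℝ → ℝ} (h : ∀ θ, f (θ + l) = f θ) (θ : ℝ) (k : ℤ) :
    f (θ + k * l) = f θ := by
  have : Function.Periodic f l := h
  have := this.int_mul k θ
  simpa using this

lemma Slice.coneLip {l K R : ℝ} {V : ℝ → ℝ → ℝ} (h : Slice l K V) (hl : 0 < l)
    (hl2 : l ≤ 2 * Real.pi) : ConeLip l R V := by
  refine ⟨h.per, 3 * K, ?_⟩
  rintro ⟨r, θ⟩ ⟨s, φ⟩ hr hs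
  obtain ⟨k, hk, hd⟩ := coneDist_shift hl hl2 r θ s φ
  rw [hd]
  simp only at *
  rw [← per_int (h.per s) φ k]
  set ψ := φ + k * l
  have hpi : |θ - ψ| ≤ Real.pi := by linarith
  have h1 := abs_sub_le_norm_pol r θ s ψ hr.1 hs.1
  have K0 := h.K0
  rcases le_total r s with hrs | hrs
  · have h2 := mul_abs_le_norm_pol r θ s ψ hr.1 hrs hpi
    have h3 := h.lipt r θ ψ
    have h4 := h.lipr r s ψ
    rw [abs_of_nonneg hr.1] at h3
    have : |V r θ - V s ψ| ≤ |V r θ - V r ψ| + |V r ψ - V s ψ| := abs_sub_le _ _ _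
    nlinarith
  · have h2 := mul_abs_le_norm_pol s ψ r θ hs.1 hrs (by rwa [abs_sub_comm])
    rw [norm_sub_rev, abs_sub_comm] at h2
    have h3 := h.lipt s θ ψ
    have h4 := h.lipr r s θ
    rw [abs_of_nonneg hs.1] at h3
    have : |V r θ - V s ψ| ≤ |V r θ - V s θ| + |V s θ - V s ψ| := abs_sub_le _ _ _
    nlinarith

/-- Clamping of the radius. -/
def clampFn (R : ℝ) (u : ℝ → ℝ → ℝ) : ℝ → ℝ → ℝ := fun r θ => u (max 0 (min r R)) θ

lemma clamp_mem {R : ℝ} (hR : 0 ≤ R) (r : ℝ) : max 0 (min r R) ∈ Icc 0 R :=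
  ⟨le_max_left _ _, max_le hR (min_le_right _ _)⟩

lemma clamp_eq {R r : ℝ} (hr : r ∈ Icc 0 R) : max 0 (min r R) = r := by
  rw [min_eq_left hr.2, max_eq_right hr.1]

lemma clampFn_eq {R r : ℝ} (hr : r ∈ Icc 0 R) (u : ℝ → ℝ → ℝ) (θ : ℝ) :
    clampFn R u r θ = u r θ := by unfold clampFn; rw [clamp_eq hr]

lemma ConeLip.slice {l R : ℝ} {u : ℝ → ℝ → ℝ} (h : ConeLip l R u) (hl : 0 < l)
    (hl2 : l ≤ 2 * Real.pi) (hR : 0 ≤ R) : ∃ K, Slice l K (clampFn R u) := by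
  obtain ⟨K, hK⟩ := h.lipschitz
  refine ⟨max K 0, le_max_right _ _, fun r θ => h.periodic _ _, fun r s θ => ?_, fun r θ φ => ?_⟩
  · have h1 := hK (max 0 (min r R), θ) (max 0 (min s R), θ) (clamp_mem hR r) (clamp_mem hR s)
    rw [coneDist_near hl hl2 (by simp; positivity)] at h1
    have h2 := norm_pol_sub_le (max 0 (min r R)) θ (max 0 (min s R)) θ (le_max_left _ _)
    have h3 : |max 0 (min r R) - max 0 (min s R)| ≤ |r - s| := by
      refine (abs_max_sub_max_le_max _ _ _ _).trans ?_
      simp only [sub_self, abs_zero]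
      refine max_le (abs_nonneg _) ((abs_min_sub_min_le_max _ _ _ _).trans ?_)
      simp
    simp only [sub_self, abs_zero, mul_zero, add_zero] at h2
    unfold clampFn
    refine h1.trans ?_
    exact mul_le_mul (le_max_left _ _) (h2.trans h3) (norm_nonneg _) (le_max_right _ _)
  · have h1 := hK (max 0 (min r R), θ) (max 0 (min r R), φ) (clamp_mem hR r) (clamp_mem hR r)
    obtain ⟨k, hk, hd⟩ := coneDist_shift hl hl2 (max 0 (min r R)) θ (max 0 (min r R)) φ
    have hle : coneDist l (max 0 (min r R), θ) (max 0 (min r R), φ) ≤ max 0 (min r R) * |θ - φ| := by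
      rw [coneDist_wrap hl hl2]
      have h5 := norm_pol_sub_le (max 0 (min r R)) (wrap l (θ - φ)) (max 0 (min r R)) 0
        (le_max_left _ _)
      rw [norm_pol_sub] at h5
      simp only [sub_zero, sub_self, abs_zero, zero_add] at h5
      refine h5.trans ?_
      exact mul_le_mul_of_nonneg_left (abs_wrap_le_abs hl _) (le_max_left _ _)
    have h3 : max 0 (min r R) ≤ |r| :=
      max_le (abs_nonneg _) ((min_le_left _ _).trans (le_abs_self _))
    unfold clampFn
    refine h1.trans ?_
    calc K * coneDist l (max 0 (min r R), θ) (max 0 (min r R), φ)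
        ≤ max K 0 * coneDist l (max 0 (min r R), θ) (max 0 (min r R), φ) := by
          apply mul_le_mul_of_nonneg_right (le_max_left _ _) (Real.sqrt_nonneg _)
      _ ≤ max K 0 * (max 0 (min r R) * |θ - φ|) :=
          mul_le_mul_of_nonneg_left hle (le_max_right _ _)
      _ ≤ max K 0 * |r| * |θ - φ| := by
          rw [mul_assoc]
          gcongr

/-! ### Part 2 -/


/-- Radial derivative. -/
def dR (V : ℝ → ℝ → ℝ) (p : ℝ × ℝ) : ℝ := deriv (fun s => V s p.2) p.1
/-- Angular derivative. -/
def dT (V : ℝ → ℝ → ℝ) (p : ℝ × ℝ) : ℝ := deriv (fun φ => V p.1 φ) p.2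

lemma gradSq_eq (V : ℝ → ℝ → ℝ) (p : ℝ × ℝ) :
    gradSq V p = dR V p ^ 2 + dT V p ^ 2 / p.1 ^ 2 := rfl

/-- Positive part. -/
def posP (V : ℝ → ℝ → ℝ) : ℝ → ℝ → ℝ := fun r θ => max (V r θ) 0

namespace Slice

variable {l K : ℝ} {V : ℝ → ℝ → ℝ}

lemma lipR (h : Slice l K V) (θ : ℝ) : LipschitzWith K.toNNReal (fun r => V r θ) := by
  refine LipschitzWith.of_dist_le_mul fun r s => ?_
  rw [Real.dist_eq, Real.dist_eq, Real.coe_toNNReal _ h.K0]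
  exact h.lipr r s θ

lemma lipT (h : Slice l K V) (r : ℝ) : LipschitzWith (K * |r|).toNNReal (fun θ => V r θ) := by
  have := h.K0
  refine LipschitzWith.of_dist_le_mul fun θ φ => ?_
  rw [Real.dist_eq, Real.dist_eq, Real.coe_toNNReal _ (by positivity)]
  exact h.lipt r θ φ

lemma cont (h : Slice l K V) : Continuous (fun p : ℝ × ℝ => V p.1 p.2) :=
  continuous_prod_of_continuous_lipschitzWith _ K.toNNReal
    (fun r => (h.lipT r).continuous) (fun θ => h.lipR θ)

lemma abs_dR (h : Slice l K V) (p : ℝ × ℝ) : |dR V p| ≤ K := by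
  have := norm_deriv_le_of_lipschitz (h.lipR p.2) (x₀ := p.1)
  rwa [Real.coe_toNNReal _ h.K0] at this

lemma abs_dT (h : Slice l K V) (p : ℝ × ℝ) : |dT V p| ≤ K * |p.1| := by
  have h0 := h.K0
  have := norm_deriv_le_of_lipschitz (h.lipT p.1) (x₀ := p.2)
  rwa [Real.coe_toNNReal _ (by positivity)] at this

lemma meas_dR (h : Slice l K V) : Measurable (dR V) := by
  have h1 : Continuous (Function.uncurry (fun θ r => V r θ)) := h.cont.comp continuous_swap
  exact (measurable_deriv_with_param h1).comp measurable_swap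

lemma meas_dT (h : Slice l K V) : Measurable (dT V) := by
  have h1 : Continuous (Function.uncurry V) := h.cont
  exact measurable_deriv_with_param h1

lemma meas_V (h : Slice l K V) : Measurable (fun p : ℝ × ℝ => V p.1 p.2) := h.cont.measurable

lemma meas_gradSq (h : Slice l K V) : Measurable (gradSq V) := by
  have h1 := h.meas_dR
  have h2 := h.meas_dT
  show Measurable fun p => dR V p ^ 2 + dT V p ^ 2 / p.1 ^ 2
  fun_prop

lemma gradSq_nonneg (V : ℝ → ℝ → ℝ) (p : ℝ × ℝ) : 0 ≤ gradSq V p := by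
  unfold gradSq; positivity

lemma dT_sq_le (h : Slice l K V) (p : ℝ × ℝ) : dT V p ^ 2 / p.1 ^ 2 ≤ K ^ 2 := by
  by_cases h0 : p.1 = 0
  · simp [h0]; positivity
  · have := h.abs_dT p
    rw [div_le_iff₀ (by positivity), ← mul_pow, ← sq_abs (dT V p), ← sq_abs (K * p.1), abs_mul,
      abs_of_nonneg h.K0]
    gcongr

lemma gradSq_le (h : Slice l K V) (p : ℝ × ℝ) : gradSq V p ≤ 2 * K ^ 2 := by
  have h1 : dR V p ^ 2 ≤ K ^ 2 := sq_le_sq' (by linarith [(abs_le.mp (h.abs_dR p)).1])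
    (abs_le.mp (h.abs_dR p)).2
  have := h.dT_sq_le p
  rw [gradSq_eq]; linarith

lemma ae_diffR (h : Slice l K V) : ∀ᵐ p : ℝ × ℝ, DifferentiableAt ℝ (fun s => V s p.2) p.1 := by
  have h1 : Continuous (Function.uncurry (fun θ r => V r θ)) := h.cont.comp continuous_swap
  have hm := measurableSet_of_differentiableAt_with_param ℝ h1
  have h2 : ∀ᵐ p : ℝ × ℝ, DifferentiableAt ℝ (fun r => V r p.1) p.2 := by
    rw [Measure.volume_eq_prod]
    rw [Measure.ae_prod_iff_ae_ae hm]
    exact Filter.Eventually.of_forall fun θ => (h.lipR θ).ae_differentiableAt_real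
  have h3 : MeasurePreserving (Prod.swap : ℝ × ℝ → ℝ × ℝ) volume volume :=
    Measure.measurePreserving_swap
  exact h3.quasiMeasurePreserving.ae h2

lemma ae_diffT (h : Slice l K V) : ∀ᵐ p : ℝ × ℝ, DifferentiableAt ℝ (fun φ => V p.1 φ) p.2 := by
  have h1 : Continuous (Function.uncurry V) := h.cont
  have hm := measurableSet_of_differentiableAt_with_param ℝ h1
  rw [Measure.volume_eq_prod, Measure.ae_prod_iff_ae_ae hm]
  exact Filter.Eventually.of_forall fun r => (h.lipT r).ae_differentiableAt_real

lemma add {K' : ℝ} {W : ℝ → ℝ → ℝ} (h : Slice l K V) (h' : Slice l K' W) :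
    Slice l (K + K') (fun r θ => V r θ + W r θ) := by
  refine ⟨add_nonneg h.K0 h'.K0, fun r θ => by simp only [h.per, h'.per], fun r s θ => ?_,
    fun r θ φ => ?_⟩
  · have h1 := h.lipr r s θ
    have h2 := h'.lipr r s θ
    have : |V r θ + W r θ - (V s θ + W s θ)| ≤ |V r θ - V s θ| + |W r θ - W s θ| := by
      rw [show V r θ + W r θ - (V s θ + W s θ) = (V r θ - V s θ) + (W r θ - W s θ) by ring]
      exact abs_add_le _ _
    linarith
  · have h1 := h.lipt r θ φ
    have h2 := h'.lipt r θ φ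
    have : |V r θ + W r θ - (V r φ + W r φ)| ≤ |V r θ - V r φ| + |W r θ - W r φ| := by
      rw [show V r θ + W r θ - (V r φ + W r φ) = (V r θ - V r φ) + (W r θ - W r φ) by ring]
      exact abs_add_le _ _
    linarith

lemma smul (h : Slice l K V) (c : ℝ) : Slice l (|c| * K) (fun r θ => c * V r θ) := by
  have := h.K0
  refine ⟨by positivity, fun r θ => by simp only [h.per], fun r s θ => ?_, fun r θ φ => ?_⟩
  · rw [← mul_sub, abs_mul, mul_assoc]
    exact mul_le_mul_of_nonneg_left (h.lipr r s θ) (abs_nonneg _)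
  · rw [← mul_sub, abs_mul, mul_assoc, mul_assoc, ← mul_assoc K]
    exact mul_le_mul_of_nonneg_left (h.lipt r θ φ) (abs_nonneg _)

lemma pos (h : Slice l K V) : Slice l K (posP V) := by
  refine ⟨h.K0, fun r θ => by simp only [posP, h.per], fun r s θ => ?_, fun r θ φ => ?_⟩
  · refine le_trans ?_ (h.lipr r s θ)
    exact abs_max_sub_max_le_abs _ _ _
  · refine le_trans ?_ (h.lipt r θ φ)
    exact abs_max_sub_max_le_abs _ _ _

lemma neg (h : Slice l K V) : Slice l K (fun r θ => - V r θ) := by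
  have := h.smul (-1)
  simpa using this

end Slice

lemma deriv_pos_part {f : ℝ → ℝ} (hf : Continuous f) (x : ℝ) :
    deriv (fun y => max (f y) 0) x = if 0 < f x then deriv f x else 0 := by
  split_ifs with h
  · apply Filter.EventuallyEq.deriv_eq
    filter_upwards [hf.continuousAt.eventually (lt_mem_nhds h)] with y hy
    exact max_eq_left hy.le
  · apply IsLocalMin.deriv_eq_zero
    filter_upwards with y
    rw [max_eq_right (not_lt.mp h)]
    exact le_max_right _ _

lemma Slice.dR_pos {l K : ℝ} {V : ℝ → ℝ → ℝ} (h : Slice l K V) (p : ℝ × ℝ) :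
    dR (posP V) p = if 0 < V p.1 p.2 then dR V p else 0 :=
  deriv_pos_part (h.lipR p.2).continuous p.1

lemma Slice.dT_pos {l K : ℝ} {V : ℝ → ℝ → ℝ} (h : Slice l K V) (p : ℝ × ℝ) :
    dT (posP V) p = if 0 < V p.1 p.2 then dT V p else 0 :=
  deriv_pos_part (h.lipT p.1).continuous p.2

lemma Slice.gradSq_pos {l K : ℝ} {V : ℝ → ℝ → ℝ} (h : Slice l K V) (p : ℝ × ℝ) :
    gradSq (posP V) p = if 0 < V p.1 p.2 then gradSq V p else 0 := by
  rw [gradSq_eq, gradSq_eq, h.dR_pos, h.dT_pos]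
  split_ifs <;> simp

/-- The polar domain. -/
abbrev Om (R l : ℝ) : Set (ℝ × ℝ) := Set.Ioo (0:ℝ) R ×ˢ Set.Ioo (0:ℝ) l

lemma meas_Om (R l : ℝ) : MeasurableSet (Om R l) := measurableSet_Ioo.prod measurableSet_Ioo

lemma vol_Om (R l : ℝ) : volume (Om R l) < ⊤ := by
  rw [Measure.volume_eq_prod, Measure.prod_prod]
  simp only [Real.volume_Ioo]
  exact ENNReal.mul_lt_top ENNReal.ofReal_lt_top ENNReal.ofReal_lt_top

lemma intOn_Om {R l C : ℝ} {F : ℝ × ℝ → ℝ} (hF : Measurable F) (hb : ∀ p ∈ Om R l, |F p| ≤ C) :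
    IntegrableOn F (Om R l) := by
  refine Measure.integrableOn_of_bounded (M := C) (vol_Om R l).ne hF.aestronglyMeasurable ?_
  exact (ae_restrict_iff' (meas_Om R l)).mpr (Filter.Eventually.of_forall hb)

lemma fub {R l C : ℝ} (hR : 0 ≤ R) (hl : 0 ≤ l) {F : ℝ × ℝ → ℝ} (hF : Measurable F)
    (hb : ∀ p ∈ Om R l, |F p| ≤ C) :
    ∫ p in Om R l, F p = ∫ r in (0:ℝ)..R, ∫ θ in (0:ℝ)..l, F (r, θ) := by
  have h := intOn_Om hF hb
  rw [Measure.volume_eq_prod] at h ⊢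
  rw [setIntegral_prod _ h, intervalIntegral.integral_of_le hR, integral_Ioc_eq_integral_Ioo]
  refine setIntegral_congr_fun measurableSet_Ioo fun r _ => ?_
  rw [intervalIntegral.integral_of_le hl, integral_Ioc_eq_integral_Ioo]

/-- Bilinear gradient form. -/
def gradB (V W : ℝ → ℝ → ℝ) (p : ℝ × ℝ) : ℝ := dR V p * dR W p + dT V p * dT W p / p.1 ^ 2

/-- Bilinear energy. -/
def Bil (l R : ℝ) (V W : ℝ → ℝ → ℝ) : ℝ := ∫ p in Om R l, gradB V W p * p.1

/-- The phase density. -/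
def ind (lp lm : ℝ) (V : ℝ → ℝ → ℝ) (p : ℝ × ℝ) : ℝ :=
  (if 0 < V p.1 p.2 then lp else 0) + (if V p.1 p.2 < 0 then lm else 0)

/-- The area term. -/
def Area (l lp lm : ℝ) (V : ℝ → ℝ → ℝ) (R : ℝ) : ℝ := ∫ p in Om R l, ind lp lm V p * p.1

lemma meas_ind (lp lm : ℝ) {V : ℝ → ℝ → ℝ} (hV : Measurable (fun p : ℝ × ℝ => V p.1 p.2)) :
    Measurable (ind lp lm V) := by
  unfold ind
  exact (Measurable.ite (measurableSet_lt measurable_const hV) measurable_const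
    measurable_const).add (Measurable.ite (measurableSet_lt hV measurable_const) measurable_const
    measurable_const)

lemma ind_nonneg {lp lm : ℝ} (hlp : 0 ≤ lp) (hlm : 0 ≤ lm) (V : ℝ → ℝ → ℝ) (p : ℝ × ℝ) :
    0 ≤ ind lp lm V p := by unfold ind; split_ifs <;> linarith

lemma ind_le {lp lm : ℝ} (hlp : 0 ≤ lp) (hlm : 0 ≤ lm) (V : ℝ → ℝ → ℝ) (p : ℝ × ℝ) :
    ind lp lm V p ≤ lp + lm := by unfold ind; split_ifs <;> linarith

lemma mem_Om_abs {R l : ℝ} {p : ℝ × ℝ} (hp : p ∈ Om R l) : 0 < p.1 ∧ p.1 < R :=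
  ⟨hp.1.1, hp.1.2⟩

lemma bd_mul_Om {R l C : ℝ} {F : ℝ × ℝ → ℝ} (hb : ∀ p, |F p| ≤ C) :
    ∀ p ∈ Om R l, |F p * p.1| ≤ C * R := by
  intro p hp
  have := mem_Om_abs hp
  rw [abs_mul, abs_of_pos this.1]
  have h2 := hb p
  exact mul_le_mul h2 this.2.le this.1.le ((abs_nonneg _).trans h2)

lemma int_gradSq {l K R l' : ℝ} {V : ℝ → ℝ → ℝ} (h : Slice l K V) :
    IntegrableOn (fun p => gradSq V p * p.1) (Om R l') :=
  intOn_Om (h.meas_gradSq.mul measurable_fst) (bd_mul_Om (C := 2 * K ^ 2) fun p => by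
    rw [abs_of_nonneg (Slice.gradSq_nonneg V p)]; exact h.gradSq_le p)

lemma int_ind {R l lp lm : ℝ} (hlp : 0 ≤ lp) (hlm : 0 ≤ lm) {V : ℝ → ℝ → ℝ}
    (hV : Measurable (fun p : ℝ × ℝ => V p.1 p.2)) :
    IntegrableOn (fun p => ind lp lm V p * p.1) (Om R l) :=
  intOn_Om ((meas_ind lp lm hV).mul measurable_fst) (bd_mul_Om (C := lp + lm) fun p => by
    rw [abs_of_nonneg (ind_nonneg hlp hlm V p)]; exact ind_le hlp hlm V p)

lemma abs_gradB_le {l K K' : ℝ} {V W : ℝ → ℝ → ℝ} (h : Slice l K V) (h' : Slice l K' W)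
    (p : ℝ × ℝ) : |gradB V W p| ≤ K ^ 2 + K' ^ 2 := by
  have h1 := h.gradSq_le p
  have h2 := h'.gradSq_le p
  rw [gradSq_eq] at h1 h2
  have e1 : |dR V p * dR W p| ≤ (dR V p ^ 2 + dR W p ^ 2) / 2 := by
    rw [abs_le]; constructor <;> nlinarith [sq_nonneg (dR V p + dR W p), sq_nonneg (dR V p - dR W p)]
  have e2 : |dT V p * dT W p / p.1 ^ 2| ≤ (dT V p ^ 2 / p.1 ^ 2 + dT W p ^ 2 / p.1 ^ 2) / 2 := by
    rw [abs_div, abs_of_nonneg (sq_nonneg p.1), ← add_div, div_right_comm]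
    apply div_le_div_of_nonneg_right _ (sq_nonneg _)
    rw [abs_le]; constructor <;> nlinarith [sq_nonneg (dT V p + dT W p), sq_nonneg (dT V p - dT W p)]
  have := abs_add_le (dR V p * dR W p) (dT V p * dT W p / p.1 ^ 2)
  unfold gradB
  linarith

lemma meas_gradB {l K K' : ℝ} {V W : ℝ → ℝ → ℝ} (h : Slice l K V) (h' : Slice l K' W) :
    Measurable (gradB V W) := by
  have h1 := h.meas_dR
  have h2 := h.meas_dT
  have h3 := h'.meas_dR
  have h4 := h'.meas_dT
  unfold gradB
  fun_prop

lemma int_gradB {l l' K K' R : ℝ} {V W : ℝ → ℝ → ℝ} (h : Slice l K V) (h' : Slice l K' W) :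
    IntegrableOn (fun p => gradB V W p * p.1) (Om R l') :=
  intOn_Om ((meas_gradB h h').mul measurable_fst) (bd_mul_Om fun p => abs_gradB_le h h' p)

lemma Jfun_eq {l K R lp lm : ℝ} (hlp : 0 ≤ lp) (hlm : 0 ≤ lm) {V : ℝ → ℝ → ℝ} (h : Slice l K V) :
    Jfun l lp lm V R = Dir l V R + Area l lp lm V R := by
  unfold Jfun Dir Area
  rw [← integral_add (int_gradSq h) (int_ind hlp hlm h.meas_V)]
  congr 1; ext p; unfold ind; ring

lemma Dir_expand {l K K' R : ℝ} {V W : ℝ → ℝ → ℝ} (h : Slice l K V) (h' : Slice l K' W) (ε : ℝ) :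
    Dir l (fun r θ => V r θ + ε * W r θ) R =
      Dir l V R + 2 * ε * Bil l R V W + ε ^ 2 * Dir l W R := by
  unfold Dir Bil
  rw [← integral_const_mul, ← integral_const_mul,
    ← integral_add (int_gradSq h) ((int_gradB h h').const_mul _),
    ← integral_add _ ((int_gradSq h').const_mul _)]
  · apply integral_congr_ae
    have := (h.ae_diffR.and h.ae_diffT).and (h'.ae_diffR.and h'.ae_diffT)
    filter_upwards [ae_restrict_of_ae this] with p hp
    obtain ⟨⟨a1, a2⟩, b1, b2⟩ := hp
    have e1 : dR (fun r θ => V r θ + ε * W r θ) p = dR V p + ε * dR W p := by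
      unfold dR
      rw [deriv_fun_add a1 (b1.const_mul ε), deriv_const_mul _ b1]
    have e2 : dT (fun r θ => V r θ + ε * W r θ) p = dT V p + ε * dT W p := by
      unfold dT
      rw [deriv_fun_add a2 (b2.const_mul ε), deriv_const_mul _ b2]
    rw [gradSq_eq, gradSq_eq, gradSq_eq, e1, e2, gradB]
    ring
  · exact (int_gradSq h).add ((int_gradB h h').const_mul _)

/-- Minimality among slice-wise Lipschitz functions. -/
structure Mini (l R lp lm : ℝ) (V : ℝ → ℝ → ℝ) : Prop where
  l0 : 0 < l
  l2 : l ≤ 2 * Real.pi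
  R0 : 0 < R
  lp0 : 0 ≤ lp
  lm0 : 0 ≤ lm
  slice : ∃ K, Slice l K V
  bd : ∃ B, ∀ r θ, |V r θ| ≤ B
  min : ∀ K W, Slice l K W → (∀ θ, W R θ = V R θ) → Jfun l lp lm V R ≤ Jfun l lp lm W R

lemma Jfun_congr {l R lp lm : ℝ} {V W : ℝ → ℝ → ℝ} (h : ∀ r ∈ Icc (0:ℝ) R, ∀ θ, V r θ = W r θ) :
    Jfun l lp lm V R = Jfun l lp lm W R := by
  unfold Jfun
  refine setIntegral_congr_fun (meas_Om R l) fun p hp => ?_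
  have h1 : ∀ᶠ s in nhds p.1, V s p.2 = W s p.2 := by
    filter_upwards [Ioo_mem_nhds hp.1.1 hp.1.2] with s hs using h s ⟨hs.1.le, hs.2.le⟩ _
  have h0 := h p.1 ⟨hp.1.1.le, hp.1.2.le⟩
  have h2 : (fun φ => V p.1 φ) = fun φ => W p.1 φ := funext h0
  simp only [gradSq, h0, Filter.EventuallyEq.deriv_eq h1]

lemma Dir_congr {l R : ℝ} {V W : ℝ → ℝ → ℝ} (h : ∀ r ∈ Icc (0:ℝ) R, ∀ θ, V r θ = W r θ) :
    Dir l V R = Dir l W R := by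
  have := Jfun_congr (l := l) (lp := 0) (lm := 0) h
  simpa [Jfun, Dir] using this

lemma Slice.zero_eq {l K : ℝ} {V : ℝ → ℝ → ℝ} (h : Slice l K V) (θ φ : ℝ) : V 0 θ = V 0 φ := by
  have := h.lipt 0 θ φ
  simp only [abs_zero, mul_zero, zero_mul, abs_nonpos_iff] at this
  linarith

lemma clampFn_bd {l R K : ℝ} {u : ℝ → ℝ → ℝ} (hR : 0 ≤ R) (h : Slice l K (clampFn R u)) :
    ∃ B, ∀ r θ, |clampFn R u r θ| ≤ B := by
  refine ⟨|clampFn R u 0 0| + K * R, fun r θ => ?_⟩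
  have h1 := clamp_mem hR r
  have e : clampFn R u r θ = clampFn R u (max 0 (min r R)) θ := by
    rw [clampFn_eq h1]; rfl
  have h2 := h.lipr (max 0 (min r R)) 0 θ
  rw [h.zero_eq θ 0, sub_zero, abs_of_nonneg h1.1] at h2
  have h3 := mul_le_mul_of_nonneg_left h1.2 h.K0
  rw [e]
  have := abs_sub_abs_le_abs_sub (clampFn R u (max 0 (min r R)) θ) (clampFn R u 0 0)
  linarith

lemma IsMinimizerJ.mini {l R lp lm : ℝ} {u : ℝ → ℝ → ℝ} (h : IsMinimizerJ l lp lm R u)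
    (hl : 0 < l) (hl2 : l ≤ 2 * Real.pi) (hR : 0 < R) (hlp : 0 ≤ lp) (hlm : 0 ≤ lm) :
    Mini l R lp lm (clampFn R u) := by
  refine ⟨hl, hl2, hR, hlp, hlm, h.1.slice hl hl2 hR.le, ?_, fun K W hW hb => ?_⟩
  · obtain ⟨K, hK⟩ := h.1.slice hl hl2 hR.le
    exact clampFn_bd hR.le hK
  rw [Jfun_congr (W := u) fun r hr θ => clampFn_eq hr u θ]
  refine h.2 W (hW.coneLip hl hl2) fun θ => ?_
  rw [hb θ, clampFn_eq ⟨hR.le, le_rfl⟩]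

lemma lin_zero {B D ε₀ : ℝ} (h0 : 0 < ε₀) (h : ∀ ε, |ε| ≤ ε₀ → 0 ≤ 2 * ε * B + ε ^ 2 * D) :
    B = 0 := by
  by_contra hB
  set t : ℝ := min ε₀ (|B| / (|D| + 1)) with ht
  have hBpos : 0 < |B| := abs_pos.mpr hB
  have ht0 : 0 < t := lt_min h0 (by positivity)
  have ht1 : t * |D| < |B| := by
    have : t ≤ |B| / (|D| + 1) := min_le_right _ _
    rw [le_div_iff₀ (by positivity)] at this
    nlinarith
  have hD := le_abs_self D
  rcases lt_or_gt_of_ne hB with hb | hb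
  · have := h t (by rw [abs_of_pos ht0]; exact min_le_left _ _)
    rw [abs_of_neg hb] at ht1
    nlinarith
  · have := h (-t) (by rw [abs_neg, abs_of_pos ht0]; exact min_le_left _ _)
    rw [abs_of_pos hb] at ht1
    nlinarith

/-- First variation through sign preserving perturbations. -/
lemma Mini.fv1 {l R lp lm K' ε₀ : ℝ} {V W : ℝ → ℝ → ℝ} (h : Mini l R lp lm V) (h' : Slice l K' W)
    (hW : ∀ θ, W R θ = 0) (h0 : 0 < ε₀)
    (hs : ∀ ε, |ε| ≤ ε₀ → ∀ p ∈ Om R l, (0 < V p.1 p.2 + ε * W p.1 p.2 ↔ 0 < V p.1 p.2) ∧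
      (V p.1 p.2 + ε * W p.1 p.2 < 0 ↔ V p.1 p.2 < 0)) : Bil l R V W = 0 := by
  obtain ⟨K, hV⟩ := h.slice
  apply lin_zero (D := Dir l W R) h0
  intro ε hε
  have hS := hV.add (h'.smul ε)
  have h1 := h.min _ _ hS (fun θ => by simp [hW])
  rw [Jfun_eq h.lp0 h.lm0 hV, Jfun_eq h.lp0 h.lm0 hS, Dir_expand hV h'] at h1
  have h2 : Area l lp lm (fun r θ => V r θ + ε * W r θ) R = Area l lp lm V R := by
    unfold Area
    refine setIntegral_congr_fun (meas_Om R l) fun p hp => ?_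
    simp only [ind, (hs ε hε p hp).1, (hs ε hε p hp).2]
  rw [h2] at h1
  linarith

/-- First variation, perturbations supported in `C_t`. -/
lemma Mini.fv2 {l R lp lm K' t : ℝ} {V W : ℝ → ℝ → ℝ} (h : Mini l R lp lm V) (h' : Slice l K' W)
    (ht0 : 0 < t) (htR : t ≤ R) (hW : ∀ r, t ≤ r → ∀ θ, W r θ = 0) (ε : ℝ) :
    0 ≤ 2 * ε * Bil l R V W + ε ^ 2 * Dir l W R + (lp + lm) * (l * t ^ 2) := by
  obtain ⟨K, hV⟩ := h.slice
  have hS := hV.add (h'.smul ε)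
  have h1 := h.min _ _ hS (fun θ => by simp [hW R htR])
  rw [Jfun_eq h.lp0 h.lm0 hV, Jfun_eq h.lp0 h.lm0 hS, Dir_expand hV h'] at h1
  have h2 : Area l lp lm (fun r θ => V r θ + ε * W r θ) R ≤
      Area l lp lm V R + (lp + lm) * (l * t ^ 2) := by
    have hc : (lp + lm) * (l * t ^ 2) = ∫ p in Om R l, (Om t l).indicator (fun _ => (lp + lm) * t) p := by
      rw [setIntegral_indicator (meas_Om t l)]
      have : Om R l ∩ Om t l = Om t l := by
        apply inter_eq_right.mpr
        exact prod_mono (Ioo_subset_Ioo_right htR) le_rfl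
      rw [this, setIntegral_const, Measure.real, Measure.volume_eq_prod, Measure.prod_prod]
      simp [ENNReal.toReal_mul, ht0.le, h.l0.le]
      ring
    have hi : IntegrableOn ((Om t l).indicator (fun _ => (lp + lm) * t)) (Om R l) := by
      apply Integrable.indicator _ (meas_Om t l)
      exact integrableOn_const (vol_Om R l).ne
    unfold Area
    rw [hc, ← integral_add (int_ind h.lp0 h.lm0 hV.meas_V) hi]
    refine setIntegral_mono_on (int_ind h.lp0 h.lm0 hS.meas_V)
      ((int_ind h.lp0 h.lm0 hV.meas_V).add hi) (meas_Om R l) fun p hp => ?_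
    by_cases hpt : p.1 < t
    · have : p ∈ Om t l := ⟨⟨hp.1.1, hpt⟩, hp.2⟩
      simp only [indicator_of_mem this]
      have a1 := ind_le h.lp0 h.lm0 (fun r θ => V r θ + ε * W r θ) p
      have a2 := ind_nonneg h.lp0 h.lm0 V p
      have a3 := ind_nonneg h.lp0 h.lm0 (fun r θ => V r θ + ε * W r θ) p
      have a4 : 0 < p.1 := hp.1.1
      have := h.lp0
      have := h.lm0
      nlinarith [mul_nonneg a2 a4.le, mul_le_mul a1 hpt.le a4.le (by positivity)]
    · have : p ∉ Om t l := fun hh => hpt hh.1.2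
      simp only [indicator_of_notMem this, ind, hW p.1 (not_lt.mp hpt)]
      simp
  linarith

/-! ### Part 3 -/


lemma Slice.mul {l K K' B B' : ℝ} {V W : ℝ → ℝ → ℝ} (h : Slice l K V) (h' : Slice l K' W)
    (hB : ∀ r θ, |V r θ| ≤ B) (hB' : ∀ r θ, |W r θ| ≤ B') :
    Slice l (B * K' + B' * K) (fun r θ => V r θ * W r θ) := by
  have b0 : 0 ≤ B := (abs_nonneg _).trans (hB 0 0)
  have b0' : 0 ≤ B' := (abs_nonneg _).trans (hB' 0 0)
  have k0 := h.K0
  have k0' := h'.K0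
  have key : ∀ x y z w : ℝ, |x| ≤ B → |w| ≤ B' →
      |x * y - z * w| ≤ B * |y - w| + B' * |x - z| := by
    intro x y z w hx hw
    have : x * y - z * w = x * (y - w) + w * (x - z) := by ring
    rw [this]
    refine (abs_add_le _ _).trans ?_
    rw [abs_mul, abs_mul]
    gcongr
  refine ⟨by positivity, fun r θ => by simp only [h.per, h'.per], fun r s θ => ?_, fun r θ φ => ?_⟩
  · refine (key _ _ _ _ (hB _ _) (hB' _ _)).trans ?_
    have h1 := mul_le_mul_of_nonneg_left (h.lipr r s θ) b0'
    have h2 := mul_le_mul_of_nonneg_left (h'.lipr r s θ) b0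
    linarith
  · refine (key _ _ _ _ (hB _ _) (hB' _ _)).trans ?_
    have h1 := mul_le_mul_of_nonneg_left (h.lipt r θ φ) b0'
    have h2 := mul_le_mul_of_nonneg_left (h'.lipt r θ φ) b0
    linarith

lemma Slice.const (l c : ℝ) : Slice l 0 (fun _ _ => c) :=
  ⟨le_rfl, fun _ _ => rfl, by simp, by simp⟩

/-- inner integrals are measurable -/
lemma meas_inner {F : ℝ × ℝ → ℝ} (hF : Measurable F) (c d : ℝ) :
    Measurable (fun r => ∫ θ in c..d, F (r, θ)) := by
  unfold intervalIntegral
  have h1 : ∀ s : Set ℝ, Measurable (fun r => ∫ θ in s, F (r, θ)) := fun s =>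
    (StronglyMeasurable.integral_prod_right (ν := volume.restrict s)
      (f := fun r θ => F (r, θ)) hF.stronglyMeasurable).measurable
  exact (h1 _).sub (h1 _)

lemma ii_bdd {f : ℝ → ℝ} {a b C : ℝ} (hf : Measurable f) (hb : ∀ r ∈ uIcc a b, |f r| ≤ C) :
    IntervalIntegrable f volume a b := by
  rw [intervalIntegrable_iff]
  refine Measure.integrableOn_of_bounded (M := C) (by simp) hf.aestronglyMeasurable ?_
  exact (ae_restrict_iff' measurableSet_uIoc).mpr
    (Filter.Eventually.of_forall fun r hr => hb r (uIoc_subset_uIcc hr))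

lemma abs_inner_le {F : ℝ × ℝ → ℝ} {c d C r : ℝ} (hb : ∀ θ, |F (r, θ)| ≤ C) :
    |∫ θ in c..d, F (r, θ)| ≤ C * |d - c| := by
  rw [← Real.norm_eq_abs (∫ θ in c..d, F (r, θ))]
  exact intervalIntegral.norm_integral_le_of_norm_le_const fun θ _ => hb θ

lemma ii_inner {F : ℝ × ℝ → ℝ} (hF : Measurable F) {a b c d C : ℝ}
    (hb : ∀ r ∈ uIcc a b, ∀ θ, |F (r, θ)| ≤ C) :
    IntervalIntegrable (fun r => ∫ θ in c..d, F (r, θ)) volume a b :=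
  ii_bdd (meas_inner hF c d) fun r hr => abs_inner_le (hb r hr)

lemma ii_fiber {F : ℝ × ℝ → ℝ} (hF : Measurable F) {r c d C : ℝ}
    (hb : ∀ θ, |F (r, θ)| ≤ C) : IntervalIntegrable (fun θ => F (r, θ)) volume c d :=
  ii_bdd (hF.comp measurable_prodMk_left) fun θ _ => hb θ

lemma swapI {F : ℝ × ℝ → ℝ} (hF : Measurable F) {a b c d C : ℝ} (hab : a ≤ b) (hcd : c ≤ d)
    (hb : ∀ r ∈ Icc a b, ∀ θ, |F (r, θ)| ≤ C) :
    ∫ r in a..b, ∫ θ in c..d, F (r, θ) = ∫ θ in c..d, ∫ r in a..b, F (r, θ) := by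
  simp only [intervalIntegral.integral_of_le hab, intervalIntegral.integral_of_le hcd]
  apply integral_integral_swap
  rw [Measure.prod_restrict, ← Measure.volume_eq_prod]
  refine Measure.integrableOn_of_bounded (M := C) ?_ hF.aestronglyMeasurable ?_
  · rw [Measure.volume_eq_prod, Measure.prod_prod]
    exact (ENNReal.mul_lt_top (by simp) (by simp)).ne
  · refine (ae_restrict_iff' (measurableSet_Ioc.prod measurableSet_Ioc)).mpr
      (Filter.Eventually.of_forall fun p hp => hb p.1 (Ioc_subset_Icc_self hp.1) p.2)

lemma lip_ac {f : ℝ → ℝ} {K : NNReal} (hf : LipschitzWith K f) (a b : ℝ) :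
    AbsolutelyContinuousOnInterval f a b :=
  (hf.lipschitzOnWith (s := uIcc a b)).absolutelyContinuousOnInterval

/-- circle integral -/
def Mc (l : ℝ) (V : ℝ → ℝ → ℝ) (r : ℝ) : ℝ := ∫ θ in (0:ℝ)..l, V r θ

lemma Slice.ftc {l K : ℝ} {V : ℝ → ℝ → ℝ} (h : Slice l K V) (hl : 0 ≤ l) {a b : ℝ} (hab : a ≤ b) :
    ∫ r in a..b, ∫ θ in (0:ℝ)..l, dR V (r, θ) = Mc l V b - Mc l V a := by
  rw [swapI h.meas_dR hab hl (C := K) (fun r _ θ => h.abs_dR _)]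
  unfold Mc
  have hc : ∀ r, IntervalIntegrable (fun θ => V r θ) volume 0 l := fun r =>
    (h.lipT r).continuous.intervalIntegrable _ _
  rw [← intervalIntegral.integral_sub (hc b) (hc a)]
  apply intervalIntegral.integral_congr
  intro θ _
  exact (lip_ac (h.lipR θ) a b).integral_deriv_eq_sub

lemma Slice.lipMc {l K : ℝ} {V : ℝ → ℝ → ℝ} (h : Slice l K V) (hl : 0 ≤ l) (a b : ℝ) :
    |Mc l V a - Mc l V b| ≤ K * l * |a - b| := by
  unfold Mc
  have hc : ∀ r, IntervalIntegrable (fun θ => V r θ) volume 0 l := fun r =>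
    (h.lipT r).continuous.intervalIntegrable _ _
  rw [← intervalIntegral.integral_sub (hc a) (hc b)]
  have := intervalIntegral.norm_integral_le_of_norm_le_const (a := 0) (b := l)
    (f := fun θ => V a θ - V b θ) (C := K * |a - b|) fun θ _ => h.lipr a b θ
  rw [sub_zero, abs_of_nonneg hl] at this
  simpa [mul_right_comm] using this

lemma Slice.derivMc {l K : ℝ} {V : ℝ → ℝ → ℝ} (h : Slice l K V) (hl : 0 ≤ l) :
    ∀ᵐ r, HasDerivAt (Mc l V) (∫ θ in (0:ℝ)..l, dR V (r, θ)) r := by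
  have h1 : LocallyIntegrable (fun r => ∫ θ in (0:ℝ)..l, dR V (r, θ)) volume := by
    refine (locallyIntegrable_const (K * |l - 0|)).mono
      (meas_inner h.meas_dR 0 l).aestronglyMeasurable (Filter.Eventually.of_forall fun r => ?_)
    rw [Real.norm_eq_abs, Real.norm_eq_abs]
    exact (abs_inner_le (F := dR V) (fun θ => h.abs_dR (r, θ))).trans (le_abs_self _)
  filter_upwards [_root_.LocallyIntegrable.ae_hasDerivAt_integral h1] with r hr
  have h2 := (hr (r - 1)).const_add (Mc l V (r - 1))
  refine h2.congr_of_eventuallyEq ?_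
  filter_upwards [lt_mem_nhds (show r - 1 < r by linarith)] with s hs
  rw [h.ftc hl hs.le]; ring

/-- energy on circles -/
def eC (l : ℝ) (Z : ℝ → ℝ → ℝ) (r : ℝ) : ℝ := (∫ θ in (0:ℝ)..l, gradSq Z (r, θ)) * r

lemma Bil_fub {l K K' R : ℝ} {V W : ℝ → ℝ → ℝ} (h : Slice l K V) (h' : Slice l K' W)
    (hl : 0 ≤ l) (hR : 0 ≤ R) :
    Bil l R V W = ∫ r in (0:ℝ)..R, (∫ θ in (0:ℝ)..l, gradB V W (r, θ)) * r := by
  unfold Bil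
  rw [fub (F := fun p => gradB V W p * p.1) hR hl ((meas_gradB h h').mul measurable_fst) (bd_mul_Om fun p => abs_gradB_le h h' p)]
  simp only [intervalIntegral.integral_mul_const]

lemma gradB_self (V : ℝ → ℝ → ℝ) (p : ℝ × ℝ) : gradB V V p = gradSq V p := by
  rw [gradSq_eq, gradB]; ring

lemma Bil_self (l R : ℝ) (V : ℝ → ℝ → ℝ) : Bil l R V V = Dir l V R := by
  unfold Bil Dir; simp only [gradB_self]

lemma Dir_fub {l K R : ℝ} {V : ℝ → ℝ → ℝ} (h : Slice l K V) (hl : 0 ≤ l) (hR : 0 ≤ R) :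
    Dir l V R = ∫ r in (0:ℝ)..R, eC l V r := by
  rw [← Bil_self, Bil_fub h h hl hR]; simp only [gradB_self, eC]

/-- clamp to `[a,b]` -/
def clp (a b r : ℝ) : ℝ := max a (min r b)

/-- logarithmic cutoff -/
def lcut (a b r : ℝ) : ℝ := Real.log b - Real.log (clp a b r)

lemma clp_mem {a b : ℝ} (hab : a ≤ b) (r : ℝ) : clp a b r ∈ Icc a b :=
  ⟨le_max_left _ _, max_le hab (min_le_right _ _)⟩

lemma clp_lip (a b r s : ℝ) : |clp a b r - clp a b s| ≤ |r - s| := by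
  unfold clp
  rw [max_comm a, max_comm a]
  refine (abs_max_sub_max_le_abs _ _ _).trans ?_
  refine (abs_min_sub_min_le_max _ _ _ _).trans ?_
  simp

lemma log_lip {a x y : ℝ} (ha : 0 < a) (hx : a ≤ x) (hy : a ≤ y) :
    |Real.log x - Real.log y| ≤ a⁻¹ * |x - y| := by
  wlog h : y ≤ x generalizing x y
  · rw [abs_sub_comm, abs_sub_comm x]; exact this hy hx (le_of_not_ge h)
  have hy0 : 0 < y := ha.trans_le hy
  have hx0 : 0 < x := ha.trans_le hx
  rw [abs_of_nonneg (sub_nonneg.mpr (Real.log_le_log hy0 h)), abs_of_nonneg (sub_nonneg.mpr h),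
    ← Real.log_div hx0.ne' hy0.ne']
  refine (Real.log_le_sub_one_of_pos (by positivity)).trans ?_
  rw [show x / y - 1 = y⁻¹ * (x - y) by field_simp]
  apply mul_le_mul_of_nonneg_right _ (sub_nonneg.mpr h)
  gcongr

lemma lcut_lip {a b : ℝ} (ha : 0 < a) (hab : a ≤ b) (r s : ℝ) :
    |lcut a b r - lcut a b s| ≤ a⁻¹ * |r - s| := by
  unfold lcut
  rw [sub_sub_sub_cancel_left, abs_sub_comm]
  refine (log_lip ha (clp_mem hab r).1 (clp_mem hab s).1).trans ?_
  have : 0 ≤ a⁻¹ := by positivity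
  exact mul_le_mul_of_nonneg_left (clp_lip _ _ _ _) this

lemma lcut_bd {a b : ℝ} (ha : 0 < a) (hab : a ≤ b) (r : ℝ) :
    |lcut a b r| ≤ a⁻¹ * (b - a) := by
  have h := clp_mem hab r
  refine (log_lip ha hab h.1).trans ?_
  have : 0 ≤ a⁻¹ := by positivity
  gcongr
  rw [abs_of_nonneg (by linarith [h.2])]; linarith [h.1]

lemma lcut_nonneg {a b : ℝ} (ha : 0 < a) (hab : a ≤ b) (r : ℝ) : 0 ≤ lcut a b r := by
  have h := clp_mem hab r
  exact sub_nonneg.mpr (Real.log_le_log (ha.trans_le h.1) h.2)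

lemma lcut_ge {a b r : ℝ} (hab : a ≤ b) (hr : b ≤ r) : lcut a b r = 0 := by
  unfold lcut clp; rw [min_eq_right hr, max_eq_right hab, sub_self]

lemma lcut_slice {l a b : ℝ} (ha : 0 < a) (hab : a ≤ b) : Slice l a⁻¹ (fun r _ => lcut a b r) := by
  refine ⟨by positivity, fun _ _ => rfl, fun r s _ => lcut_lip ha hab r s, fun r θ φ => ?_⟩
  rw [sub_self, abs_zero]; positivity

lemma lcut_deriv {a b r : ℝ} (hab : a < b) (hra : r ≠ a) (hrb : r ≠ b) (ha : 0 < a) :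
    HasDerivAt (lcut a b) (if r ∈ Ioo a b then -r⁻¹ else 0) r := by
  split_ifs with h
  · have h1 : HasDerivAt (fun r => Real.log b - Real.log r) (-r⁻¹) r := by
      have := (Real.hasDerivAt_log (ha.trans h.1).ne').const_sub (Real.log b)
      exact this
    refine h1.congr_of_eventuallyEq ?_
    filter_upwards [Ioo_mem_nhds h.1 h.2] with s hs
    unfold lcut clp; rw [min_eq_left hs.2.le, max_eq_right hs.1.le]
  · rcases lt_or_gt_of_ne hra with h1 | h1
    · refine (hasDerivAt_const r (Real.log b - Real.log a)).congr_of_eventuallyEq ?_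
      filter_upwards [gt_mem_nhds h1] with s hs
      unfold lcut clp; rw [min_eq_left (hs.le.trans hab.le), max_eq_left hs.le]
    · have h2 : b < r := lt_of_le_of_ne (not_lt.mp fun h2 => h ⟨h1, h2⟩) hrb.symm
      refine (hasDerivAt_const r (0:ℝ)).congr_of_eventuallyEq ?_
      filter_upwards [lt_mem_nhds h2] with s hs
      exact lcut_ge hab.le hs.le

lemma bdd_gradB {l K K' : ℝ} {V W : ℝ → ℝ → ℝ} (h : Slice l K V) (h' : Slice l K' W) (r : ℝ) :
    |(∫ θ in (0:ℝ)..l, gradB V W (r, θ)) * r| ≤ (K ^ 2 + K' ^ 2) * |l| * |r| := by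
  rw [abs_mul]
  gcongr
  have := abs_inner_le (F := gradB V W) (c := 0) (d := l) (fun θ => abs_gradB_le h h' (r, θ))
  simpa using this

lemma Bil_ac {l K K' R : ℝ} {V W : ℝ → ℝ → ℝ} (h : Slice l K V) (h' : Slice l K' W) (hR : 0 ≤ R) :
    IntervalIntegrable (fun r => (∫ θ in (0:ℝ)..l, gradB V W (r, θ)) * r) volume 0 R :=
  ii_bdd (C := (K ^ 2 + K' ^ 2) * |l| * R) ((meas_inner (meas_gradB h h') 0 l).mul measurable_id)
    fun r hr => by
      rw [uIcc_of_le hR] at hr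
      refine (bdd_gradB h h' r).trans ?_
      rw [abs_of_nonneg hr.1]
      have := hr.2
      gcongr

/-- Key computation: testing with a logarithmic cutoff. -/
lemma Bil_cut {l K K' R a b B : ℝ} {V Z : ℝ → ℝ → ℝ} (h : Slice l K V) (h' : Slice l K' Z)
    (hB : ∀ r θ, |Z r θ| ≤ B) (hl : 0 ≤ l) (ha : 0 < a) (hab : a < b) (hbR : b ≤ R) :
    Bil l R V (fun r θ => lcut a b r * Z r θ) =
      ∫ r in a..b, (Bil l r V Z / r - ∫ θ in (0:ℝ)..l, dR V (r, θ) * Z r θ) := by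
  have hR : 0 ≤ R := by linarith
  have hη := lcut_slice (l := l) ha hab.le
  have hW := hη.mul h' (fun r _ => lcut_bd ha hab.le r) hB
  have hlc : LipschitzWith (a⁻¹).toNNReal (lcut a b) := hη.lipR 0
  set G : ℝ → ℝ := fun r => (∫ θ in (0:ℝ)..l, gradB V Z (r, θ)) * r with hG
  have hGi : IntervalIntegrable G volume 0 R := Bil_ac h h' hR
  set E : ℝ → ℝ := fun r => ∫ s in (0:ℝ)..r, G s with hE
  have hEac : AbsolutelyContinuousOnInterval E 0 R :=
    hGi.absolutelyContinuousOnInterval_intervalIntegral (by simp)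
  have hEd : ∀ᵐ r, r ∈ uIcc 0 R → deriv E r = G r := by
    filter_upwards [_root_.IntervalIntegrable.ae_hasDerivAt_integral hGi] with r hr h1
    exact (hr h1 0 (by simp)).deriv
  have hmV : Measurable (fun p : ℝ × ℝ => dR V p * Z p.1 p.2) := h.meas_dR.mul h'.meas_V
  have hbV : ∀ p : ℝ × ℝ, |dR V p * Z p.1 p.2| ≤ K * B := fun p => by
    rw [abs_mul]
    exact mul_le_mul (h.abs_dR p) (hB _ _) (abs_nonneg _) h.K0
  set f : ℝ → ℝ := fun r => ∫ θ in (0:ℝ)..l, dR V (r, θ) * Z r θ with hf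
  have hfi : ∀ x y, IntervalIntegrable f volume x y := fun x y =>
    ii_inner hmV (fun r _ θ => hbV (r, θ))
  -- derivative of the cutoff
  have hne : ∀ᵐ r : ℝ, r ≠ a ∧ r ≠ b := by
    have h₁ : ∀ᵐ x : ℝ, x ≠ a := by simp [ae_iff, measure_singleton]
    have h₂ : ∀ᵐ x : ℝ, x ≠ b := by simp [ae_iff, measure_singleton]
    exact h₁.and h₂
  have hd : ∀ᵐ p : ℝ × ℝ, DifferentiableAt ℝ (fun s => Z s p.2) p.1 ∧
      DifferentiableAt ℝ (fun φ => Z p.1 φ) p.2 := h'.ae_diffR.and h'.ae_diffT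
  rw [Measure.volume_eq_prod] at hd
  have hd' := Measure.ae_ae_of_ae_prod hd
  rw [Bil_fub h hW hl hR]
  have step1 : ∫ r in (0:ℝ)..R, (∫ θ in (0:ℝ)..l, gradB V (fun r θ => lcut a b r * Z r θ) (r, θ)) * r
      = ∫ r in (0:ℝ)..R, (lcut a b r * deriv E r + deriv (lcut a b) r * r * f r) := by
    apply intervalIntegral.integral_congr_ae
    filter_upwards [hd', hEd, hne] with r h1 h2 h3 hr
    rw [h2 (uIoc_subset_uIcc hr)]
    have e : ∫ θ in (0:ℝ)..l, gradB V (fun r θ => lcut a b r * Z r θ) (r, θ) =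
        ∫ θ in (0:ℝ)..l, (lcut a b r * gradB V Z (r, θ) +
          deriv (lcut a b) r * (dR V (r, θ) * Z r θ)) := by
      apply intervalIntegral.integral_congr_ae
      filter_upwards [h1] with θ hθ _
      have e1 : dR (fun r θ => lcut a b r * Z r θ) (r, θ) =
          deriv (lcut a b) r * Z r θ + lcut a b r * dR Z (r, θ) := by
        unfold dR
        have := (lcut_deriv hab h3.1 h3.2 ha).differentiableAt
        exact deriv_fun_mul this hθ.1
      have e2 : dT (fun r θ => lcut a b r * Z r θ) (r, θ) = lcut a b r * dT Z (r, θ) := by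
        unfold dT
        exact deriv_const_mul _ hθ.2
      unfold gradB
      rw [e1, e2]
      ring
    rw [e, intervalIntegral.integral_add, intervalIntegral.integral_const_mul,
      intervalIntegral.integral_const_mul]
    · simp only [hG, hf]; ring
    · exact (ii_fiber (meas_gradB h h') (fun θ => abs_gradB_le h h' _)).const_mul _
    · exact (ii_fiber hmV (fun θ => hbV (r, θ))).const_mul _
  rw [step1]
  have hm1 : Measurable (fun r => deriv (lcut a b) r * r * f r) :=
    ((measurable_deriv _).mul measurable_id).mul (meas_inner hmV 0 l)
  have i2 : IntervalIntegrable (fun r => deriv (lcut a b) r * r * f r) volume 0 R := by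
    refine ii_bdd (C := a⁻¹ * R * (K * B * |l - 0|)) hm1 fun r hr => ?_
    rw [uIcc_of_le hR] at hr
    rw [abs_mul, abs_mul, abs_of_nonneg hr.1]
    have := norm_deriv_le_of_lipschitz hlc (x₀ := r)
    rw [Real.coe_toNNReal _ (by positivity), Real.norm_eq_abs] at this
    have h2 := hr.2
    have h3 : |f r| ≤ K * B * |l - 0| :=
      abs_inner_le (F := fun p => dR V p * Z p.1 p.2) (fun θ => hbV (r, θ))
    have := hr.1
    gcongr
  have i1 : IntervalIntegrable (fun r => lcut a b r * deriv E r) volume 0 R :=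
    hEac.intervalIntegrable_deriv.continuousOn_mul hlc.continuous.continuousOn
  rw [intervalIntegral.integral_add i1 i2,
    (lip_ac hlc 0 R).integral_mul_deriv_eq_deriv_mul hEac, lcut_ge hab.le hbR]
  have hE0 : E 0 = 0 := by simp [hE]
  have i3 : IntervalIntegrable (fun r => deriv (lcut a b) r * E r) volume 0 R :=
    (lip_ac hlc 0 R).intervalIntegrable_deriv.mul_continuousOn hEac.continuousOn
  rw [hE0, zero_mul, mul_zero, sub_zero, zero_sub, neg_add_eq_sub,
    ← intervalIntegral.integral_sub i2 i3]
  have hsub : Ioc a b ⊆ Ioc 0 R := Ioc_subset_Ioc ha.le hbR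
  have e2 : ∫ r in (0:ℝ)..R, (deriv (lcut a b) r * r * f r - deriv (lcut a b) r * E r) =
      ∫ r in (0:ℝ)..R, (Ioc a b).indicator (fun r => E r / r - f r) r := by
    apply intervalIntegral.integral_congr_ae
    filter_upwards [hne] with r hr _
    rw [(lcut_deriv hab hr.1 hr.2 ha).deriv]
    by_cases h1 : r ∈ Ioo a b
    · have : r ≠ 0 := (ha.trans h1.1).ne'
      rw [if_pos h1, indicator_of_mem (Ioo_subset_Ioc_self h1)]
      field_simp
      ring
    · rw [if_neg h1, indicator_of_notMem]
      · ring
      · exact fun h2 => h1 ⟨h2.1, lt_of_le_of_ne h2.2 hr.2⟩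
  rw [e2, intervalIntegral.integral_of_le hR, setIntegral_indicator measurableSet_Ioc,
    inter_eq_right.mpr hsub, ← intervalIntegral.integral_of_le hab.le]
  apply intervalIntegral.integral_congr
  intro r hr
  rw [uIcc_of_le hab.le] at hr
  simp only
  rw [Bil_fub h h' hl (ha.le.trans hr.1)]

/-! ### Part 4 -/


/-- square of a function -/
def sqf (Z : ℝ → ℝ → ℝ) : ℝ → ℝ → ℝ := fun r θ => Z r θ * Z r θ

lemma dR_sqf {Z : ℝ → ℝ → ℝ} {p : ℝ × ℝ} (h : DifferentiableAt ℝ (fun s => Z s p.2) p.1) :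
    dR (sqf Z) p = 2 * (dR Z p * Z p.1 p.2) := by
  unfold dR sqf
  rw [deriv_fun_mul h h]; ring

lemma inner_sqf {l K : ℝ} {Z : ℝ → ℝ → ℝ} (h : Slice l K Z) :
    ∀ᵐ r, ∫ θ in (0:ℝ)..l, dR (sqf Z) (r, θ) = 2 * ∫ θ in (0:ℝ)..l, dR Z (r, θ) * Z r θ := by
  have hd := h.ae_diffR
  rw [Measure.volume_eq_prod] at hd
  filter_upwards [Measure.ae_ae_of_ae_prod hd] with r hr
  rw [← intervalIntegral.integral_const_mul]
  apply intervalIntegral.integral_congr_ae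
  filter_upwards [hr] with θ hθ _ using dR_sqf hθ

lemma derivMc_sq {l K B : ℝ} {Z : ℝ → ℝ → ℝ} (h : Slice l K Z) (hB : ∀ r θ, |Z r θ| ≤ B)
    (hl : 0 ≤ l) :
    ∀ᵐ r, HasDerivAt (Mc l (sqf Z)) (2 * ∫ θ in (0:ℝ)..l, dR Z (r, θ) * Z r θ) r := by
  filter_upwards [(h.mul h hB hB).derivMc hl, inner_sqf h] with r h1 h2
  rw [← h2]; exact h1

lemma ftc_sq {l K B a b : ℝ} {Z : ℝ → ℝ → ℝ} (h : Slice l K Z) (hB : ∀ r θ, |Z r θ| ≤ B)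
    (hl : 0 ≤ l) (hab : a ≤ b) :
    2 * ∫ r in a..b, ∫ θ in (0:ℝ)..l, dR Z (r, θ) * Z r θ = Mc l (sqf Z) b - Mc l (sqf Z) a := by
  have hS : Slice l (B * K + B * K) (sqf Z) := h.mul h hB hB
  rw [← hS.ftc hl hab, ← intervalIntegral.integral_const_mul]
  apply intervalIntegral.integral_congr_ae
  filter_upwards [inner_sqf h] with r h1 _ using h1.symm

lemma eC_nonneg {l r : ℝ} (hl : 0 ≤ l) (hr : 0 ≤ r) (Z : ℝ → ℝ → ℝ) : 0 ≤ eC l Z r :=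
  mul_nonneg (intervalIntegral.integral_nonneg hl fun θ _ => Slice.gradSq_nonneg Z _) hr

lemma meas_eC {l K : ℝ} {Z : ℝ → ℝ → ℝ} (h : Slice l K Z) : Measurable (eC l Z) :=
  (meas_inner h.meas_gradSq 0 l).mul measurable_id

lemma eC_bd {l K : ℝ} {Z : ℝ → ℝ → ℝ} (h : Slice l K Z) (r : ℝ) :
    |eC l Z r| ≤ 2 * K ^ 2 * |l| * |r| := by
  unfold eC
  rw [abs_mul]
  gcongr
  have := abs_inner_le (F := gradSq Z) (r := r) (c := 0) (d := l) (C := 2 * K ^ 2) (fun θ => by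
    rw [abs_of_nonneg (Slice.gradSq_nonneg Z _)]; exact h.gradSq_le _)
  simpa using this

lemma ii_eC {l K : ℝ} {Z : ℝ → ℝ → ℝ} (h : Slice l K Z) (a b : ℝ) :
    IntervalIntegrable (eC l Z) volume a b := by
  refine ii_bdd (C := 2 * K ^ 2 * |l| * max |a| |b|) (meas_eC h) fun r hr => ?_
  refine (eC_bd h r).trans ?_
  gcongr
  rw [mem_uIcc] at hr
  have := abs_le_max_abs_abs (a := a) (b := r) (c := b)
  rcases hr with hr | hr
  · exact abs_le_max_abs_abs hr.1 hr.2
  · rw [max_comm]; exact abs_le_max_abs_abs hr.1 hr.2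

/-- primitive of the circle energy -/
def DD (l : ℝ) (Z : ℝ → ℝ → ℝ) (r : ℝ) : ℝ := ∫ s in (0:ℝ)..r, eC l Z s

lemma DD_eq {l K R : ℝ} {V : ℝ → ℝ → ℝ} (h : Slice l K V) (hl : 0 ≤ l) (hR : 0 ≤ R) :
    Dir l V R = DD l V R := Dir_fub h hl hR

lemma DD_cont {l K : ℝ} {Z : ℝ → ℝ → ℝ} (h : Slice l K Z) : Continuous (DD l Z) :=
  intervalIntegral.continuous_primitive (ii_eC h) 0

lemma DD_nonneg {l r : ℝ} {Z : ℝ → ℝ → ℝ} (hl : 0 ≤ l) (hr : 0 ≤ r) : 0 ≤ DD l Z r :=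
  intervalIntegral.integral_nonneg hr fun s hs => eC_nonneg hl hs.1 Z

lemma DD_sub {l K : ℝ} {Z : ℝ → ℝ → ℝ} (h : Slice l K Z) (a b : ℝ) :
    DD l Z b - DD l Z a = ∫ s in a..b, eC l Z s :=
  intervalIntegral.integral_interval_sub_left (ii_eC h 0 b) (ii_eC h 0 a)

lemma DD_mono {l K a b : ℝ} {Z : ℝ → ℝ → ℝ} (h : Slice l K Z) (hl : 0 ≤ l) (ha : 0 ≤ a)
    (hab : a ≤ b) : DD l Z a ≤ DD l Z b := by
  have := DD_sub h a b
  have h2 : 0 ≤ ∫ s in a..b, eC l Z s :=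
    intervalIntegral.integral_nonneg hab fun s hs => eC_nonneg hl (ha.trans hs.1) Z
  linarith

lemma DD_deriv {l K : ℝ} {Z : ℝ → ℝ → ℝ} (h : Slice l K Z) :
    ∀ᵐ r, HasDerivAt (DD l Z) (eC l Z r) r := by
  have h1 : LocallyIntegrable (eC l Z) volume := by
    have hc : LocallyIntegrable (fun r : ℝ => 2 * K ^ 2 * |l| * |r|) volume := by
      apply Continuous.locallyIntegrable; fun_prop
    refine hc.mono (meas_eC h).aestronglyMeasurable (Filter.Eventually.of_forall fun r => ?_)
    rw [Real.norm_eq_abs, Real.norm_eq_abs]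
    exact (eC_bd h r).trans (le_abs_self _)
  filter_upwards [_root_.LocallyIntegrable.ae_hasDerivAt_integral h1] with r hr using hr 0

/-- The integrated energy identity on circles. -/
def SqId (l T : ℝ) (Z : ℝ → ℝ → ℝ) : Prop := ∀ a b, 0 < a → a < b → b ≤ T →
  Mc l (sqf Z) b - Mc l (sqf Z) a = 2 * ∫ r in a..b, DD l Z r / r

lemma SqId.hasDeriv {l K T r : ℝ} {Z : ℝ → ℝ → ℝ} (h : Slice l K Z) (hs : SqId l T Z)
    (hr : r ∈ Ioo 0 T) : HasDerivAt (Mc l (sqf Z)) (2 * (DD l Z r / r)) r := by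
  have hc : ContinuousOn (fun r => DD l Z r / r) (Ioi 0) :=
    (DD_cont h).continuousOn.div continuousOn_id fun x hx => (ne_of_gt hx)
  have hi : IntervalIntegrable (fun r => DD l Z r / r) volume (r/2) r := by
    apply ContinuousOn.intervalIntegrable
    apply hc.mono
    rw [uIcc_of_le (by linarith [hr.1])]
    intro x hx
    have := hr.1
    exact lt_of_lt_of_le (by linarith) hx.1
  have h1 := intervalIntegral.integral_hasDerivAt_right hi
    (hc.stronglyMeasurableAtFilter isOpen_Ioi r hr.1) (hc.continuousAt (Ioi_mem_nhds hr.1))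
  have h2 := (h1.const_mul 2).const_add (Mc l (sqf Z) (r/2))
  refine h2.congr_of_eventuallyEq ?_
  filter_upwards [Ioo_mem_nhds (show r/2 < r by linarith [hr.1]) hr.2] with s hs'
  have := hs (r/2) s (by linarith [hr.1]) hs'.1 hs'.2.le
  linarith

lemma SqId.ae {l K B T : ℝ} {Z : ℝ → ℝ → ℝ} (h : Slice l K Z) (hB : ∀ r θ, |Z r θ| ≤ B)
    (hl : 0 ≤ l) (hs : SqId l T Z) :
    ∀ᵐ r, r ∈ Ioo 0 T → DD l Z r = r * ∫ θ in (0:ℝ)..l, dR Z (r, θ) * Z r θ := by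
  filter_upwards [derivMc_sq h hB hl] with r h1 hr
  have := (hs.hasDeriv h hr).unique h1
  have h0 : r ≠ 0 := hr.1.ne'
  field_simp at this
  linarith

lemma sqId_of_bil {l K K' R T B : ℝ} {V Z : ℝ → ℝ → ℝ} (h : Slice l K V) (h' : Slice l K' Z)
    (hB : ∀ r θ, |Z r θ| ≤ B) (hl : 0 ≤ l) (hT : T ≤ R)
    (hb : ∀ a b, 0 < a → a < b → b ≤ T → Bil l R V (fun r θ => lcut a b r * Z r θ) = 0)
    (hg : ∀ p, gradB V Z p = gradSq Z p) (hd : ∀ p : ℝ × ℝ, dR V p * Z p.1 p.2 = dR Z p * Z p.1 p.2) :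
    SqId l T Z := by
  intro a b ha hab hbT
  have h1 := hb a b ha hab hbT
  rw [Bil_cut h h' hB hl ha hab (hbT.trans hT), intervalIntegral.integral_sub] at h1
  · rw [← ftc_sq h' hB hl hab.le]
    have e1 : ∫ r in a..b, Bil l r V Z / r = ∫ r in a..b, DD l Z r / r := by
      apply intervalIntegral.integral_congr
      intro r hr
      rw [uIcc_of_le hab.le] at hr
      simp only
      rw [← DD_eq h' hl (ha.le.trans hr.1)]
      unfold Bil Dir
      simp only [hg]
    have e2 : ∫ r in a..b, ∫ θ in (0:ℝ)..l, dR V (r, θ) * Z r θ =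
        ∫ r in a..b, ∫ θ in (0:ℝ)..l, dR Z (r, θ) * Z r θ := by
      congr 1; ext r; congr 1; ext θ; exact hd (r, θ)
    rw [e1, e2] at h1
    linarith
  · have hc : ContinuousOn (fun r => DD l Z r / r) (Ioi 0) :=
      (DD_cont h').continuousOn.div continuousOn_id fun x hx => (ne_of_gt hx)
    have : IntervalIntegrable (fun r => DD l Z r / r) volume a b := by
      apply ContinuousOn.intervalIntegrable
      apply hc.mono
      rw [uIcc_of_le hab.le]
      exact fun x hx => lt_of_lt_of_le ha hx.1
    refine this.congr ?_
    intro r hr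
    rw [uIoc_of_le hab.le] at hr
    simp only
    rw [← DD_eq h' hl (ha.le.trans hr.1.le)]
    unfold Bil Dir
    simp only [hg]
  · refine ii_inner (F := fun p => dR V p * Z p.1 p.2) (h.meas_dR.mul h'.meas_V) (C := K * B)
      fun r _ θ => ?_
    rw [abs_mul]
    exact mul_le_mul (h.abs_dR _) (hB _ _) (abs_nonneg _) h.K0

lemma Jfun_neg (l lp lm R : ℝ) (V : ℝ → ℝ → ℝ) :
    Jfun l lm lp (fun r θ => - V r θ) R = Jfun l lp lm V R := by
  unfold Jfun
  congr 1; ext p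
  have : gradSq (fun r θ => - V r θ) p = gradSq V p := by
    unfold gradSq
    rw [deriv.fun_neg, deriv.fun_neg]; ring
  rw [this]
  simp only [neg_pos, neg_lt_zero]
  ring

lemma Mini.neg {l R lp lm : ℝ} {V : ℝ → ℝ → ℝ} (h : Mini l R lp lm V) :
    Mini l R lm lp (fun r θ => - V r θ) := by
  obtain ⟨K, hK⟩ := h.slice
  obtain ⟨B, hB⟩ := h.bd
  refine ⟨h.l0, h.l2, h.R0, h.lm0, h.lp0, ⟨K, hK.neg⟩, ⟨B, fun r θ => by rw [abs_neg]; exact hB r θ⟩,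
    fun K' W hW hb => ?_⟩
  rw [Jfun_neg, ← Jfun_neg l lm lp R W]
  exact h.min _ _ hW.neg fun θ => by rw [hb θ, neg_neg]

lemma posP_bd {V : ℝ → ℝ → ℝ} {B : ℝ} (h : ∀ r θ, |V r θ| ≤ B) : ∀ r θ, |posP V r θ| ≤ B := by
  intro r θ
  unfold posP
  have h1 := h r θ
  rw [abs_of_nonneg (le_max_right _ _)]
  exact max_le ((le_abs_self _).trans h1) ((abs_nonneg _).trans h1)

lemma Mini.posId {l R lp lm : ℝ} {V : ℝ → ℝ → ℝ} (h : Mini l R lp lm V) : SqId l R (posP V) := by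
  obtain ⟨K, hK⟩ := h.slice
  obtain ⟨B, hB⟩ := h.bd
  refine sqId_of_bil hK hK.pos (posP_bd hB) h.l0.le le_rfl ?_ ?_ ?_
  · intro a b ha hab hbR
    have hη := lcut_slice (l := l) ha hab.le
    have hW := hη.mul hK.pos (fun r _ => lcut_bd ha hab.le r) (posP_bd hB)
    set c := a⁻¹ * (b - a) with hc
    have hc0 : 0 ≤ c := mul_nonneg (by positivity) (by linarith)
    refine h.fv1 hW (fun θ => by simp [lcut_ge hab.le hbR]) (ε₀ := 1 / (c + 1)) (by positivity) ?_
    intro ε hε p _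
    have h1 : |ε * lcut a b p.1| < 1 := by
      rw [abs_mul]
      have h2 := lcut_bd ha hab.le p.1
      calc |ε| * |lcut a b p.1| ≤ 1 / (c + 1) * c := by
            apply mul_le_mul hε h2 (abs_nonneg _) (by positivity)
        _ < 1 := by rw [div_mul_eq_mul_div, div_lt_one (by positivity)]; linarith
    rw [abs_lt] at h1
    unfold posP
    by_cases hp : 0 < V p.1 p.2
    · rw [max_eq_left hp.le]
      have : 0 < V p.1 p.2 + ε * (lcut a b p.1 * V p.1 p.2) := by nlinarith
      exact ⟨⟨fun _ => hp, fun _ => this⟩, ⟨fun hh => absurd hh this.not_gt, fun hh => absurd hh hp.not_gt⟩⟩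
    · rw [max_eq_right (not_lt.mp hp)]; simp
  · intro p
    unfold gradB
    rw [gradSq_eq, hK.dR_pos, hK.dT_pos]
    split_ifs <;> ring
  · intro p
    rw [hK.dR_pos]
    unfold posP
    split_ifs with hp
    · rfl
    · rw [max_eq_right (not_lt.mp hp)]; simp

lemma Slice.exists_min {l K T : ℝ} {V : ℝ → ℝ → ℝ} (h : Slice l K V) (hl : 0 < l) (hT : 0 ≤ T)
    (hp : ∀ r ∈ Icc 0 T, ∀ θ, 0 < V r θ) : ∃ m > 0, ∀ r ∈ Icc 0 T, ∀ θ ∈ Icc 0 l, m ≤ V r θ := by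
  have hc : IsCompact (Icc (0:ℝ) T ×ˢ Icc (0:ℝ) l) := isCompact_Icc.prod isCompact_Icc
  obtain ⟨p, hp', hm⟩ := hc.exists_isMinOn ⟨(0, 0), ⟨le_rfl, hT⟩, ⟨le_rfl, hl.le⟩⟩ h.cont.continuousOn
  exact ⟨V p.1 p.2, hp p.1 hp'.1 _, fun r hr θ hθ => hm (show (r, θ) ∈ _ from ⟨hr, hθ⟩)⟩

/-- Bounded test functions in the positive phase. -/
lemma Mini.bil_pos {l R lp lm T a b K' B' : ℝ} {V Z : ℝ → ℝ → ℝ} (h : Mini l R lp lm V)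
    (hT0 : 0 < T) (hT : T ≤ R) (hp : ∀ r ∈ Icc 0 T, ∀ θ, 0 < V r θ) (hZ : Slice l K' Z)
    (hB' : ∀ r θ, |Z r θ| ≤ B') (ha : 0 < a) (hab : a < b) (hbT : b ≤ T) :
    Bil l R V (fun r θ => lcut a b r * Z r θ) = 0 := by
  obtain ⟨K, hK⟩ := h.slice
  obtain ⟨m, hm0, hm⟩ := hK.exists_min h.l0 hT0.le hp
  have hη := lcut_slice (l := l) ha hab.le
  have hW := hη.mul hZ (fun r _ => lcut_bd ha hab.le r) hB'
  set c := a⁻¹ * (b - a) with hc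
  have hc0 : 0 ≤ c := mul_nonneg (by positivity) (by linarith)
  have hB0 : 0 ≤ B' := (abs_nonneg _).trans (hB' 0 0)
  refine h.fv1 hW (fun θ => by simp [lcut_ge hab.le (hbT.trans hT)]) (ε₀ := m / (c * B' + 1))
    (by positivity) ?_
  intro ε hε p hpO
  by_cases hpb : b ≤ p.1
  · rw [lcut_ge hab.le hpb]; simp
  have hV := hm p.1 ⟨hpO.1.1.le, by linarith⟩ p.2 ⟨hpO.2.1.le, hpO.2.2.le⟩
  have h1 : |ε * (lcut a b p.1 * Z p.1 p.2)| < m := by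
    rw [abs_mul, abs_mul]
    calc |ε| * (|lcut a b p.1| * |Z p.1 p.2|) ≤ m / (c * B' + 1) * (c * B') := by
          apply mul_le_mul hε _ (by positivity) (by positivity)
          exact mul_le_mul (lcut_bd ha hab.le p.1) (hB' _ _) (abs_nonneg _) hc0
      _ < m := by
          rw [div_mul_eq_mul_div, div_lt_iff₀ (by positivity)]; nlinarith
  rw [abs_lt] at h1
  have h2 : 0 < V p.1 p.2 := by linarith
  have h3 : 0 < V p.1 p.2 + ε * (lcut a b p.1 * Z p.1 p.2) := by linarith
  exact ⟨⟨fun _ => h2, fun _ => h3⟩, ⟨fun hh => absurd hh h3.not_gt, fun hh => absurd hh h2.not_gt⟩⟩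

lemma dR_const (c : ℝ) (p : ℝ × ℝ) : dR (fun _ _ => c) p = 0 := by unfold dR; simp
lemma dT_const (c : ℝ) (p : ℝ × ℝ) : dT (fun _ _ => c) p = 0 := by unfold dT; simp

lemma Bil_one {l K R a b : ℝ} {V : ℝ → ℝ → ℝ} (h : Slice l K V) (hl : 0 ≤ l)
    (ha : 0 < a) (hab : a < b) (hbR : b ≤ R) :
    Bil l R V (fun r _ => lcut a b r * 1) = Mc l V a - Mc l V b := by
  rw [Bil_cut (Z := fun _ _ => 1) h (Slice.const l 1) (B := 1) (by simp) hl ha hab hbR]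
  have e : ∀ r, Bil l r V (fun _ _ => 1) = 0 := fun r => by
    unfold Bil gradB; simp [dR_const, dT_const]
  simp only [e, zero_div, zero_sub, mul_one, intervalIntegral.integral_neg]
  rw [h.ftc hl hab.le]; ring

lemma Mc_zero {l K : ℝ} {V : ℝ → ℝ → ℝ} (h : Slice l K V) : Mc l V 0 = l * V 0 0 := by
  unfold Mc
  simp [h.zero_eq _ 0]

lemma Slice.contMc {l K : ℝ} {V : ℝ → ℝ → ℝ} (h : Slice l K V) (hl : 0 ≤ l) :
    Continuous (Mc l V) := by
  have : LipschitzWith (K * l).toNNReal (Mc l V) := LipschitzWith.of_dist_le_mul fun a b => by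
    rw [Real.dist_eq, Real.dist_eq, Real.coe_toNNReal _ (mul_nonneg h.K0 hl)]
    exact h.lipMc hl a b
  exact this.continuous

/-- Mean value property in the positive phase. -/
lemma Mini.mean {l R lp lm T r : ℝ} {V : ℝ → ℝ → ℝ} (h : Mini l R lp lm V)
    (hT0 : 0 < T) (hT : T ≤ R) (hp : ∀ r ∈ Icc 0 T, ∀ θ, 0 < V r θ) (hr : r ∈ Icc 0 T) :
    Mc l V r = l * V 0 0 := by
  obtain ⟨K, hK⟩ := h.slice
  have hc := hK.contMc h.l0.le
  have h1 : ∀ a ∈ Ioo 0 T, Mc l V a = Mc l V T := by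
    intro a ha
    have := h.bil_pos (Z := fun _ _ => 1) (B' := 1) hT0 hT hp (Slice.const l 1) (by simp) ha.1 ha.2 le_rfl
    rw [Bil_one hK h.l0.le ha.1 ha.2 hT] at this
    linarith
  have h2 : ∀ a ∈ Icc 0 T, Mc l V a = Mc l V T := by
    intro a ha
    rw [← closure_Ioo hT0.ne] at ha
    exact closure_minimal (s := Ioo 0 T) (t := {a | Mc l V a = Mc l V T}) h1
      (isClosed_eq hc continuous_const) ha
  rw [h2 r hr, ← h2 0 ⟨le_rfl, hT0.le⟩, Mc_zero hK]

lemma Slice.addc {l K : ℝ} {V : ℝ → ℝ → ℝ} (h : Slice l K V) (k : ℝ) :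
    Slice l K (fun r θ => V r θ - k) := by
  have := h.add (Slice.const l (-k))
  simpa [sub_eq_add_neg] using this

lemma dR_subc (V : ℝ → ℝ → ℝ) (k : ℝ) (p : ℝ × ℝ) : dR (fun r θ => V r θ - k) p = dR V p := by
  unfold dR; simp
lemma dT_subc (V : ℝ → ℝ → ℝ) (k : ℝ) (p : ℝ × ℝ) : dT (fun r θ => V r θ - k) p = dT V p := by
  unfold dT; simp

lemma Mini.subId {l R lp lm T : ℝ} {V : ℝ → ℝ → ℝ} (h : Mini l R lp lm V)
    (hT0 : 0 < T) (hT : T ≤ R) (hp : ∀ r ∈ Icc 0 T, ∀ θ, 0 < V r θ) (k : ℝ) :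
    SqId l T (fun r θ => V r θ - k) := by
  obtain ⟨K, hK⟩ := h.slice
  obtain ⟨B, hB⟩ := h.bd
  have hb : ∀ r θ, |V r θ - k| ≤ B + |k| := fun r θ =>
    (abs_sub _ _).trans (by linarith [hB r θ])
  refine sqId_of_bil hK (hK.addc k) hb h.l0.le hT ?_ ?_ ?_
  · intro a b ha hab hbT
    exact h.bil_pos hT0 hT hp (hK.addc k) hb ha hab hbT
  · intro p
    rw [gradSq_eq, dR_subc, dT_subc]; unfold gradB; rw [dR_subc, dT_subc]; ring
  · intro p
    rw [dR_subc]

/-- Almost mean value property across the free boundary. -/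
lemma Mini.mean_diff {l R lp lm s : ℝ} {V : ℝ → ℝ → ℝ} (h : Mini l R lp lm V)
    (hs : 0 < s) (hR : 2 * s ≤ R) :
    |Mc l V (2 * s) - Mc l V s| ≤ (l + 4 * (lp + lm) * l) * s := by
  obtain ⟨K, hK⟩ := h.slice
  have hab : s < 2 * s := by linarith
  have hη := lcut_slice (l := l) hs hab.le
  have hW : Slice l s⁻¹ (fun r _ => lcut s (2 * s) r * 1) := by simpa using hη
  have hB := Bil_one hK h.l0.le hs hab hR
  have hD : Dir l (fun r _ => lcut s (2 * s) r * 1) R ≤ l := by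
    have h0 := DD_eq hW h.l0.le h.R0.le
    rw [h0]
    have hle : DD l (fun r _ => lcut s (2 * s) r * 1) R ≤
        ∫ r in (0:ℝ)..R, (Ioc s (2*s)).indicator (fun _ => l / s) r := by
      unfold DD
      apply intervalIntegral.integral_mono_ae_restrict h.R0.le (ii_eC hW 0 R)
      · rw [intervalIntegrable_iff]
        apply Integrable.indicator _ measurableSet_Ioc
        exact integrableOn_const (by simp)
      · have h₁ : ∀ᵐ x : ℝ, x ≠ s := by simp [ae_iff, measure_singleton]
        have h₂ : ∀ᵐ x : ℝ, x ≠ 2 * s := by simp [ae_iff, measure_singleton]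
        filter_upwards [ae_restrict_of_ae h₁, ae_restrict_of_ae h₂] with r e1 e2
        have hd := lcut_deriv hab e1 e2 hs
        have hd2 : deriv (fun s_1 => lcut s (2 * s) s_1) r = _ := hd.deriv
        simp only [eC, gradSq, mul_one, deriv_const, hd2]
        split_ifs with hr
        · rw [indicator_of_mem (Ioo_subset_Ioc_self hr)]
          have hr0 : 0 < r := hs.trans hr.1
          have : s < r := hr.1
          simp only [neg_sq, inv_pow, ne_eq, OfNat.ofNat_ne_zero, not_false_eq_true, zero_pow,
            zero_div, add_zero, intervalIntegral.integral_const, sub_zero, smul_eq_mul]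
          rw [show l * (r ^ 2)⁻¹ * r = l / r by field_simp]
          have := h.l0
          gcongr
        · have hz : (∫ θ in (0:ℝ)..l, ((0:ℝ) ^ 2 + 0 ^ 2 / r ^ 2)) * r = 0 := by simp
          rw [hz]
          apply indicator_nonneg
          intro _ _
          have := h.l0
          positivity
    refine hle.trans ?_
    rw [intervalIntegral.integral_of_le h.R0.le, setIntegral_indicator measurableSet_Ioc,
      inter_eq_right.mpr (Ioc_subset_Ioc hs.le hR), setIntegral_const, Measure.real, Real.volume_Ioc]
    rw [ENNReal.toReal_ofReal (by linarith), smul_eq_mul]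
    apply le_of_eq; field_simp; ring
  have hf := fun ε => h.fv2 hW (t := 2 * s) (by linarith) hR
    (fun r hr θ => by simp [lcut_ge hab.le hr]) ε
  rw [hB] at hf
  have f1 := hf s
  have f2 := hf (-s)
  have hs2 : 0 < s ^ 2 := by positivity
  have hDs := mul_le_mul_of_nonneg_left hD hs2.le
  have := h.l0
  rw [abs_le]
  constructor <;> nlinarith

/-! ### Part 5 -/


lemma growth_mono (m : ℕ) {G g : ℝ → ℝ} {a b : ℝ} (ha : 0 < a) (hab : a ≤ b)
    (hG : AbsolutelyContinuousOnInterval G a b)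
    (hd : ∀ᵐ r, r ∈ Ioo a b → HasDerivAt G (g r) r ∧ m * G r ≤ r * g r) :
    G a * b ^ m ≤ G b * a ^ m := by
  have hpos : ∀ r ∈ Icc a b, 0 < r := fun r hr => ha.trans_le hr.1
  obtain ⟨K, hK⟩ : ∃ K, LipschitzOnWith K (fun r : ℝ => (r ^ m)⁻¹) (Icc a b) := by
    refine ContDiffOn.exists_lipschitzOnWith (n := 1) ?_ (by simp) (convex_Icc a b) isCompact_Icc
    refine ContDiffOn.inv (by fun_prop) fun r hr => ?_
    have := hpos r hr
    positivity
  have hac : AbsolutelyContinuousOnInterval (fun r : ℝ => (r ^ m)⁻¹) a b := by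
    apply LipschitzOnWith.absolutelyContinuousOnInterval (K := K)
    rwa [uIcc_of_le hab]
  have hF := hG.mul hac
  have h1 := hF.integral_deriv_eq_sub
  have h2 : 0 ≤ ∫ x in a..b, deriv (G * fun r : ℝ => (r ^ m)⁻¹) x := by
    apply intervalIntegral.integral_nonneg_of_ae_restrict hab
    rw [Measure.restrict_congr_set Ioo_ae_eq_Icc.symm]
    rw [Filter.EventuallyLE, ae_restrict_iff' measurableSet_Ioo]
    filter_upwards [hd] with r hr hr'
    obtain ⟨h3, h4⟩ := hr hr'
    have hr0 : 0 < r := ha.trans hr'.1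
    have h5 : HasDerivAt (fun r : ℝ => (r ^ m)⁻¹) (-(m * r ^ (m-1)) / (r ^ m) ^ 2) r :=
      (hasDerivAt_pow m r).inv (by positivity)
    rw [(h3.mul h5).deriv]
    have h6 : (m:ℝ) * r ^ (m-1) = m * r ^ m / r := by
      rcases m with _ | m
      · simp
      · field_simp; simp [pow_succ]
    rw [h6]
    have : g r * (r ^ m)⁻¹ + G r * (-(m * r ^ m / r) / (r ^ m) ^ 2) =
        (r * g r - m * G r) / (r * r ^ m) := by
      field_simp; ring
    simp only [Pi.zero_apply]
    rw [this]
    apply div_nonneg (by linarith) (by positivity)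
  rw [h1] at h2
  simp only [Pi.mul_apply] at h2
  have hb := hpos b ⟨hab, le_rfl⟩
  have : G a * (a^m)⁻¹ ≤ G b * (b^m)⁻¹ := by linarith
  rw [← div_eq_mul_inv, ← div_eq_mul_inv, div_le_div_iff₀ (by positivity) (by positivity)] at this
  exact this

/-- indicator of the non-vanishing set -/
def nz (f : ℝ → ℝ) (x : ℝ) : ℝ := if f x = 0 then 0 else 1

lemma nz_meas {f : ℝ → ℝ} (hf : Continuous f) : Measurable (nz f) :=
  Measurable.ite (measurableSet_eq_fun hf.measurable measurable_const) measurable_const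
    measurable_const

lemma nz_nonneg (f : ℝ → ℝ) (x : ℝ) : 0 ≤ nz f x := by unfold nz; split_ifs <;> norm_num
lemma nz_le (f : ℝ → ℝ) (x : ℝ) : nz f x ≤ 1 := by unfold nz; split_ifs <;> norm_num
lemma nz_abs (f : ℝ → ℝ) (x : ℝ) : |nz f x| ≤ 1 := by
  rw [abs_of_nonneg (nz_nonneg f x)]; exact nz_le f x

lemma nz_ii {f : ℝ → ℝ} (hf : Continuous f) (a b : ℝ) : IntervalIntegrable (nz f) volume a b :=
  ii_bdd (nz_meas hf) fun x _ => nz_abs f x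

lemma lip_deriv_ii {f : ℝ → ℝ} {K : NNReal} (hf : LipschitzWith K f) (a b : ℝ) :
    IntervalIntegrable (fun x => deriv f x ^ 2) volume a b := by
  refine ii_bdd (C := (K:ℝ)^2) ((measurable_deriv f).pow_const 2) fun x _ => ?_
  rw [abs_of_nonneg (sq_nonneg _), ← sq_abs]
  have := norm_deriv_le_of_lipschitz hf (x₀ := x)
  rw [Real.norm_eq_abs] at this
  gcongr

lemma wirt_core {f : ℝ → ℝ} {K : NNReal} (hf : LipschitzWith K f) {a b k : ℝ} (hab : a ≤ b)
    (fa : f a = 0) (fb : f b = 0) (hk : 0 ≤ k) (h : k * ∫ x in a..b, nz f x < Real.pi) :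
    k ^ 2 * ∫ x in a..b, f x ^ 2 ≤ ∫ x in a..b, deriv f x ^ 2 := by
  set α := ∫ x in a..b, nz f x with hα
  set ε := (Real.pi - k * α) / 2 with hε
  have hε0 : 0 < ε := by rw [hε]; linarith
  set τ : ℝ → ℝ := fun x => ∫ y in a..x, nz f y with hτ
  have hii := nz_ii hf.continuous
  have hτmono : ∀ x y, x ≤ y → τ x ≤ τ y := by
    intro x y hxy
    have h1 : τ y - τ x = ∫ z in x..y, nz f z :=
      intervalIntegral.integral_interval_sub_left (hii a y) (hii a x)
    have h2 : 0 ≤ ∫ z in x..y, nz f z :=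
      intervalIntegral.integral_nonneg hxy fun z _ => nz_nonneg f z
    linarith
  have hτlip : LipschitzWith 1 τ := by
    refine LipschitzWith.of_dist_le_mul fun x y => ?_
    rw [Real.dist_eq, Real.dist_eq]
    have h1 : τ x - τ y = ∫ z in y..x, nz f z :=
      intervalIntegral.integral_interval_sub_left (hii a x) (hii a y)
    rw [h1]
    have := intervalIntegral.norm_integral_le_of_norm_le_const (a := y) (b := x) (C := 1)
      (f := nz f) fun z _ => nz_abs f z
    simpa using this
  have hτa : τ a = 0 := by simp [hτ]
  set ψ : ℝ → ℝ := fun x => k * τ x + ε with hψ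
  have hψmem : ∀ x ∈ Icc a b, ψ x ∈ Icc ε (k * α + ε) := by
    intro x hx
    have h1 := hτmono a x hx.1
    have h2 := hτmono x b hx.2
    rw [hτa] at h1
    constructor
    · simp only [hψ]; nlinarith
    · simp only [hψ]
      have : k * τ x ≤ k * α := mul_le_mul_of_nonneg_left h2 hk
      linarith
  have hlt : k * α + ε < Real.pi := by rw [hε]; linarith
  have hsin : ∀ y ∈ Icc ε (k * α + ε), 0 < Real.sin y := fun y hy =>
    Real.sin_pos_of_pos_of_lt_pi (hε0.trans_le hy.1) (hy.2.trans_lt hlt)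
  set q : ℝ → ℝ := fun y => k * (Real.cos y / Real.sin y) with hq
  obtain ⟨L, hL⟩ : ∃ L, LipschitzOnWith L q (Icc ε (k * α + ε)) := by
    refine ContDiffOn.exists_lipschitzOnWith (n := 1) ?_ (by simp) (convex_Icc _ _) isCompact_Icc
    refine contDiffOn_const.mul (Real.contDiff_cos.contDiffOn.div Real.contDiff_sin.contDiffOn ?_)
    intro y hy; exact (hsin y hy).ne'
  have hψlip : LipschitzWith (k.toNNReal) ψ := by
    refine LipschitzWith.of_dist_le_mul fun x y => ?_
    have := hτlip.dist_le_mul x y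
    rw [Real.dist_eq, Real.dist_eq] at *
    rw [Real.coe_toNNReal _ hk]
    have e : ψ x - ψ y = k * (τ x - τ y) := by simp only [hψ]; ring
    rw [e, abs_mul, abs_of_nonneg hk]
    exact mul_le_mul_of_nonneg_left (by simpa using this) hk
  have hφ : AbsolutelyContinuousOnInterval (q ∘ ψ) a b := by
    apply LipschitzOnWith.absolutelyContinuousOnInterval (K := L * k.toNNReal)
    rw [uIcc_of_le hab]
    exact hL.comp hψlip.lipschitzOnWith hψmem
  have hfac := lip_ac hf a b
  have hF := hφ.mul (hfac.mul hfac)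
  have h1 := hF.integral_deriv_eq_sub
  simp only [Pi.mul_apply, fa, fb, mul_zero, sub_zero] at h1
  have hfi : IntervalIntegrable (fun x => f x ^ 2) volume a b :=
    (hf.continuous.pow 2).intervalIntegrable _ _
  have hdi := lip_deriv_ii hf a b
  have hFi := hF.intervalIntegrable_deriv
  have h2 : 0 ≤ ∫ x in a..b, (deriv f x ^ 2 - k ^ 2 * f x ^ 2 -
      deriv ((q ∘ ψ) * (f * f)) x) := by
    apply intervalIntegral.integral_nonneg_of_ae_restrict hab
    rw [Filter.EventuallyLE, ae_restrict_iff' measurableSet_Icc]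
    have hloc : LocallyIntegrable (nz f) volume := by
      refine (locallyIntegrable_const (1:ℝ)).mono (nz_meas hf.continuous).aestronglyMeasurable
        (Filter.Eventually.of_forall fun r => ?_)
      simpa using nz_abs f r
    filter_upwards [_root_.LocallyIntegrable.ae_hasDerivAt_integral hloc,
      hf.ae_differentiableAt] with x hx hfx hxI
    have hs := hsin _ (hψmem x hxI)
    have d1 : HasDerivAt ψ (k * nz f x) x := ((hx a).const_mul k).add_const ε
    have d2 : HasDerivAt q (k * ((- Real.sin (ψ x) * Real.sin (ψ x) -
        Real.cos (ψ x) * Real.cos (ψ x)) / Real.sin (ψ x) ^ 2)) (ψ x) :=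
      ((Real.hasDerivAt_cos _).div (Real.hasDerivAt_sin _) hs.ne').const_mul k
    have d3 := d2.comp x d1
    have d4 := hfx.hasDerivAt.mul hfx.hasDerivAt
    rw [(d3.mul d4).deriv]
    have e1 : nz f x * f x = f x := by unfold nz; split_ifs with h0 <;> simp [h0]
    have e2 : Real.sin (ψ x) ^ 2 + Real.cos (ψ x) ^ 2 = 1 := Real.sin_sq_add_cos_sq _
    have e3 : (- Real.sin (ψ x) * Real.sin (ψ x) - Real.cos (ψ x) * Real.cos (ψ x)) /
        Real.sin (ψ x) ^ 2 = - (1 + (Real.cos (ψ x) / Real.sin (ψ x)) ^ 2) := by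
      field_simp; ring
    rw [e3]
    simp only [Pi.mul_apply, Function.comp, Pi.zero_apply, hq]
    set c := Real.cos (ψ x) / Real.sin (ψ x)
    have : k * -(1 + c ^ 2) * (k * nz f x) * (f x * f x) = - (k^2 * (1 + c^2)) * (f x * f x) := by
      calc _ = - (k^2 * (1 + c^2)) * (nz f x * f x) * f x := by ring
        _ = _ := by rw [e1]; ring
    rw [this]
    nlinarith [sq_nonneg (deriv f x - k * c * f x)]
  rw [intervalIntegral.integral_sub (hdi.sub (hfi.const_mul _)) hFi,
    intervalIntegral.integral_sub hdi (hfi.const_mul _), h1,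
    intervalIntegral.integral_const_mul] at h2
  linarith

lemma wirt {f : ℝ → ℝ} {K : NNReal} (hf : LipschitzWith K f) {a b α : ℝ} (hab : a ≤ b)
    (fa : f a = 0) (fb : f b = 0) (h : ∫ x in a..b, nz f x ≤ α) :
    Real.pi ^ 2 * ∫ x in a..b, f x ^ 2 ≤ α ^ 2 * ∫ x in a..b, deriv f x ^ 2 := by
  have h0 : 0 ≤ ∫ x in a..b, nz f x :=
    intervalIntegral.integral_nonneg hab fun z _ => nz_nonneg f z
  have hlim : Filter.Tendsto (fun β : ℝ => β ^ 2 * ∫ x in a..b, deriv f x ^ 2)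
      (nhdsWithin α (Ioi α)) (nhds (α ^ 2 * ∫ x in a..b, deriv f x ^ 2)) := by
    apply Filter.Tendsto.mono_left _ nhdsWithin_le_nhds
    apply Continuous.tendsto (f := fun β : ℝ => β ^ 2 * ∫ x in a..b, deriv f x ^ 2)
    fun_prop
  refine ge_of_tendsto hlim ?_
  filter_upwards [self_mem_nhdsWithin] with β hβ
  have hβ' : α < β := hβ
  have hβ0 : 0 < β := by linarith
  have := wirt_core hf hab fa fb (k := Real.pi / β) (by positivity) (by
    rw [div_mul_eq_mul_div, div_lt_iff₀ hβ0]
    exact mul_lt_mul_of_pos_left (by linarith) Real.pi_pos)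
  rw [div_pow, div_mul_eq_mul_div, div_le_iff₀ (by positivity)] at this
  linarith

lemma per_deriv {f : ℝ → ℝ} {l : ℝ} (h : Function.Periodic f l) : Function.Periodic (deriv f) l := by
  intro x
  have : f = fun y => f (y + l) := by ext y; rw [h y]
  conv_rhs => rw [this]
  rw [deriv_comp_add_const]

lemma per_shift {g : ℝ → ℝ} {l : ℝ} (h : Function.Periodic g l) (c : ℝ) :
    ∫ x in (0:ℝ)..l, g x = ∫ x in c..(c + l), g x := by
  have := h.intervalIntegral_add_eq 0 c
  simpa using this

lemma wirt_per {f : ℝ → ℝ} {K : NNReal} (hf : LipschitzWith K f) {l α c : ℝ} (hl : 0 ≤ l)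
    (hp : Function.Periodic f l) (fc : f c = 0) (h : ∫ x in (0:ℝ)..l, nz f x ≤ α) :
    Real.pi ^ 2 * ∫ x in (0:ℝ)..l, f x ^ 2 ≤ α ^ 2 * ∫ x in (0:ℝ)..l, deriv f x ^ 2 := by
  have p1 : Function.Periodic (nz f) l := fun x => by unfold nz; rw [hp x]
  have p2 : Function.Periodic (fun x => f x ^ 2) l := fun x => by simp only [hp x]
  have p3 : Function.Periodic (fun x => deriv f x ^ 2) l := fun x => by
    simp only [per_deriv hp x]
  rw [per_shift p1 c] at h
  rw [per_shift p2 c, per_shift p3 c]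
  exact wirt hf (by linarith) fc (by rw [hp c, fc]) h

lemma wirt_half {f : ℝ → ℝ} {K : NNReal} (hf : LipschitzWith K f) {l : ℝ} (hl : 0 ≤ l)
    (hp : Function.Periodic f l) : ∃ k : ℝ,
    Real.pi ^ 2 * ∫ x in (0:ℝ)..l, (f x - k) ^ 2 ≤ (l / 2) ^ 2 * ∫ x in (0:ℝ)..l, deriv f x ^ 2 := by
  obtain ⟨c, hc⟩ : ∃ c, f (c + l / 2) - f c = 0 := by
    have hcont : Continuous (fun x => f (x + l / 2) - f x) := by
      have := hf.continuous; fun_prop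
    have e : f (l / 2 + l / 2) = f 0 := by have := hp 0; rw [zero_add] at this; rw [← this]; congr 1; ring
    have hm := mem_range_of_exists_le_of_exists_ge hcont (c := 0)
    rcases le_total (f (l/2)) (f 0) with h | h
    · exact hm ⟨0, by simpa using h⟩ ⟨l/2, by rw [e]; linarith⟩
    · exact hm ⟨l/2, by rw [e]; linarith⟩ ⟨0, by simpa using h⟩
  set g : ℝ → ℝ := fun x => f x - f c with hg
  have hgl : LipschitzWith K g := by
    refine LipschitzWith.of_dist_le_mul fun x y => ?_
    have := hf.dist_le_mul x y
    rw [Real.dist_eq] at *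
    simpa [hg] using this
  have hgd : deriv g = deriv f := by ext x; simp [hg]
  have key : ∀ a, g a = 0 → g (a + l/2) = 0 → Real.pi ^ 2 * ∫ x in a..(a + l/2), g x ^ 2 ≤
      (l/2)^2 * ∫ x in a..(a + l/2), deriv f x ^ 2 := by
    intro a h1 h2
    rw [← hgd]
    refine wirt hgl (by linarith) h1 h2 ?_
    have := intervalIntegral.integral_mono_on (μ := volume) (f := nz g) (g := fun _ => (1:ℝ))
      (show a ≤ a + l/2 by linarith) (nz_ii hgl.continuous _ _) (by simp) fun x _ => nz_le g x
    simpa using this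
  refine ⟨f c, ?_⟩
  have p2 : Function.Periodic (fun x => (f x - f c) ^ 2) l := fun x => by simp only [hp x]
  have p3 : Function.Periodic (fun x => deriv f x ^ 2) l := fun x => by
    simp only [per_deriv hp x]
  rw [per_shift p2 c, per_shift p3 c]
  have k1 := key c (by simp [hg]) (by simpa [hg] using hc)
  have k2 := key (c + l/2) (by simpa [hg] using hc) (by
    rw [show c + l/2 + l/2 = c + l by ring]; simp [hg, hp c])
  have i1 : ∀ a b, IntervalIntegrable (fun x => g x ^ 2) volume a b :=
    fun a b => (hgl.continuous.pow 2).intervalIntegrable _ _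
  have i2 := lip_deriv_ii hf
  rw [show c + l/2 + l/2 = c + l by ring] at k2
  have s1 := intervalIntegral.integral_add_adjacent_intervals (i1 c (c+l/2)) (i1 (c+l/2) (c+l))
  have s2 := intervalIntegral.integral_add_adjacent_intervals (i2 c (c+l/2)) (i2 (c+l/2) (c+l))
  rw [← s2]
  show Real.pi ^ 2 * ∫ x in c..(c+l), g x ^ 2 ≤ _
  rw [← s1]
  linarith

/-! ### Part 6 -/


lemma cs_int {f g : ℝ → ℝ} {a b : ℝ} (hab : a ≤ b)
    (hf : IntervalIntegrable (fun x => f x ^ 2) volume a b)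
    (hg : IntervalIntegrable (fun x => g x ^ 2) volume a b)
    (hfg : IntervalIntegrable (fun x => f x * g x) volume a b) :
    (∫ x in a..b, f x * g x) ^ 2 ≤ (∫ x in a..b, f x ^ 2) * ∫ x in a..b, g x ^ 2 := by
  have key : ∀ s : ℝ, 0 ≤ (∫ x in a..b, f x ^ 2) * (s * s) + (2 * ∫ x in a..b, f x * g x) * s +
      ∫ x in a..b, g x ^ 2 := by
    intro s
    have h0 : 0 ≤ ∫ x in a..b, ((s*s) * f x ^ 2 + (2*s) * (f x * g x) + g x ^ 2) :=
      intervalIntegral.integral_nonneg hab fun x _ => by nlinarith [sq_nonneg (s * f x + g x)]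
    rw [intervalIntegral.integral_add ((hf.const_mul _).add (hfg.const_mul _)) hg,
      intervalIntegral.integral_add (hf.const_mul _) (hfg.const_mul _),
      intervalIntegral.integral_const_mul, intervalIntegral.integral_const_mul] at h0
    linarith
  have := discrim_le_zero key
  unfold discrim at this
  nlinarith

section fibers
variable {l K : ℝ} {Z : ℝ → ℝ → ℝ}

lemma Slice.fi_dR (h : Slice l K Z) (r a b : ℝ) :
    IntervalIntegrable (fun θ => dR Z (r, θ)) volume a b :=
  ii_fiber h.meas_dR fun θ => h.abs_dR (r, θ)

lemma Slice.fi_dR2 (h : Slice l K Z) (r a b : ℝ) :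
    IntervalIntegrable (fun θ => dR Z (r, θ) ^ 2) volume a b :=
  ii_fiber (F := fun p => dR Z p ^ 2) (C := K ^ 2) (h.meas_dR.pow_const 2) fun θ => by
    have := h.abs_dR (r, θ)
    rw [abs_of_nonneg (sq_nonneg _), ← sq_abs]; gcongr

lemma Slice.fi_dT2 (h : Slice l K Z) (r a b : ℝ) :
    IntervalIntegrable (fun θ => dT Z (r, θ) ^ 2) volume a b :=
  ii_fiber (F := fun p => dT Z p ^ 2) (C := (K * |r|) ^ 2) (h.meas_dT.pow_const 2) fun θ => by
    have := h.abs_dT (r, θ)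
    rw [abs_of_nonneg (sq_nonneg _), ← sq_abs]; gcongr

lemma Slice.fi_Z (h : Slice l K Z) (r a b : ℝ) :
    IntervalIntegrable (fun θ => Z r θ) volume a b := (h.lipT r).continuous.intervalIntegrable _ _

lemma Slice.fi_Z2 (h : Slice l K Z) (r a b : ℝ) :
    IntervalIntegrable (fun θ => Z r θ ^ 2) volume a b :=
  ((h.lipT r).continuous.pow 2).intervalIntegrable _ _

lemma Slice.fi_dRZ (h : Slice l K Z) (r a b : ℝ) :
    IntervalIntegrable (fun θ => dR Z (r, θ) * Z r θ) volume a b :=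
  (h.fi_dR r a b).mul_continuousOn (h.lipT r).continuous.continuousOn

lemma Slice.eC_eq (h : Slice l K Z) {r : ℝ} (hr : r ≠ 0) :
    r * eC l Z r = r ^ 2 * (∫ θ in (0:ℝ)..l, dR Z (r, θ) ^ 2) + ∫ θ in (0:ℝ)..l, dT Z (r, θ) ^ 2 := by
  unfold eC
  simp only [gradSq_eq]
  rw [intervalIntegral.integral_add (h.fi_dR2 r 0 l) ((h.fi_dT2 r 0 l).div_const _),
    intervalIntegral.integral_div]
  field_simp

lemma Slice.perF (h : Slice l K Z) (r : ℝ) : Function.Periodic (fun θ => Z r θ) l := h.per r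

end fibers

lemma circ_real {A B T X α r : ℝ} (hA : 0 ≤ A) (hB : 0 ≤ B) (hT : 0 ≤ T) (hα : 0 ≤ α) (hr : 0 < r)
    (hX : X ^ 2 ≤ A * B) (h : Real.pi ^ 2 * B ≤ α ^ 2 * T) :
    2 * Real.pi * (r * X) ≤ α * (r ^ 2 * A + T) := by
  apply abs_le_of_sq_le_sq' _ (by positivity) |>.2
  have h1 : Real.pi ^ 2 * X ^ 2 ≤ A * (α ^ 2 * T) := by
    calc Real.pi ^ 2 * X ^ 2 ≤ Real.pi ^ 2 * (A * B) := by gcongr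
      _ = A * (Real.pi ^ 2 * B) := by ring
      _ ≤ _ := by gcongr
  have h2 : (2 * Real.pi * (r * X)) ^ 2 ≤ 4 * r ^ 2 * (A * (α ^ 2 * T)) := by
    calc (2 * Real.pi * (r * X)) ^ 2 = 4 * r ^ 2 * (Real.pi ^ 2 * X ^ 2) := by ring
      _ ≤ _ := by gcongr
  refine h2.trans ?_
  nlinarith [mul_nonneg (sq_nonneg α) (sq_nonneg (r ^ 2 * A - T))]

lemma Slice.circ {l K α r c : ℝ} {Z : ℝ → ℝ → ℝ} (h : Slice l K Z) (hl : 0 ≤ l) (hr : 0 < r)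
    (hc : Z r c = 0) (hα : ∫ θ in (0:ℝ)..l, nz (fun θ => Z r θ) θ ≤ α) :
    2 * Real.pi * (r * ∫ θ in (0:ℝ)..l, dR Z (r, θ) * Z r θ) ≤ α * (r * eC l Z r) := by
  have h0 : 0 ≤ ∫ θ in (0:ℝ)..l, nz (fun θ => Z r θ) θ :=
    intervalIntegral.integral_nonneg hl fun z _ => nz_nonneg _ z
  rw [h.eC_eq hr.ne']
  refine circ_real (B := ∫ θ in (0:ℝ)..l, Z r θ ^ 2)
    (intervalIntegral.integral_nonneg hl fun z _ => sq_nonneg _)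
    (intervalIntegral.integral_nonneg hl fun z _ => sq_nonneg _)
    (intervalIntegral.integral_nonneg hl fun z _ => sq_nonneg _) (h0.trans hα) hr ?_ ?_
  · exact cs_int hl (h.fi_dR2 r 0 l) (h.fi_Z2 r 0 l) (h.fi_dRZ r 0 l)
  · exact wirt_per (h.lipT r) hl (h.perF r) hc hα

lemma acf_real {x y p q α β : ℝ} (hx : 0 ≤ x) (hy : 0 ≤ y) (hp : 0 ≤ p) (hq : 0 ≤ q) (hα : 0 ≤ α)
    (hβ : 0 ≤ β) (hab : α + β ≤ 2 * Real.pi) (h1 : 2 * Real.pi * x ≤ α * p)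
    (h2 : 2 * Real.pi * y ≤ β * q) : 4 * (x * y) ≤ p * y + x * q := by
  have hpi := Real.pi_pos
  rcases hα.eq_or_lt with h | h
  · subst h
    have : x = 0 := by nlinarith
    subst this; simp; positivity
  rcases hβ.eq_or_lt with h' | h'
  · subst h'
    have : y = 0 := by nlinarith
    subst this; simp; positivity
  have e1 : 2 * Real.pi * x / α ≤ p := by rw [div_le_iff₀ h]; linarith
  have e2 : 2 * Real.pi * y / β ≤ q := by rw [div_le_iff₀ h']; linarith
  have e3 : 2 * Real.pi * x / α * y + x * (2 * Real.pi * y / β) ≤ p * y + x * q := by gcongr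
  refine le_trans ?_ e3
  have e4 : 2 * Real.pi * x / α * y + x * (2 * Real.pi * y / β) =
      (x * y) * (2 * Real.pi * (α + β) / (α * β)) := by field_simp; ring
  rw [e4, mul_comm]
  gcongr
  rw [le_div_iff₀ (by positivity)]
  nlinarith [sq_nonneg (α - β)]

lemma nz_pos_neg (f : ℝ → ℝ) (x : ℝ) :
    nz (fun x => max (f x) 0) x + nz (fun x => max (- f x) 0) x ≤ 1 := by
  unfold nz
  rcases le_total (f x) 0 with h | h
  · simp [h]; split_ifs <;> norm_num
  · simp [h]; split_ifs <;> norm_num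

lemma DD_ac {l K a b : ℝ} {Z : ℝ → ℝ → ℝ} (h : Slice l K Z) (ha : 0 ≤ a) (hab : a ≤ b) :
    AbsolutelyContinuousOnInterval (DD l Z) a b := by
  have hab' : a ≤ max a b := le_max_left _ _
  apply LipschitzOnWith.absolutelyContinuousOnInterval (K := (2 * K ^ 2 * |l| * b).toNNReal)
  rw [uIcc_of_le hab]
  refine LipschitzOnWith.of_dist_le_mul fun x hx y hy => ?_
  rw [Real.dist_eq, Real.dist_eq, DD_sub h,
    Real.coe_toNNReal _ (by have := ha.trans hab; positivity)]
  have := intervalIntegral.norm_integral_le_of_norm_le_const (a := y) (b := x)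
    (C := 2 * K ^ 2 * |l| * b) (f := eC l Z) fun z hz => by
      refine (eC_bd h z).trans ?_
      gcongr
      have hz' := uIoc_subset_uIcc hz
      have : z ∈ Icc a b := (uIcc_subset_Icc hy hx) hz'
      rw [abs_of_nonneg (ha.trans this.1)]
      exact this.2
  simpa using this

/-- ACF monotonicity on a cone of length at most `2π`. -/
lemma Mini.acf {l R lp lm a b : ℝ} {V : ℝ → ℝ → ℝ} (h : Mini l R lp lm V) (ha : 0 < a) (hab : a ≤ b)
    (hbR : b ≤ R) :
    DD l (posP V) a * DD l (posP fun r θ => - V r θ) a * b ^ 4 ≤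
    DD l (posP V) b * DD l (posP fun r θ => - V r θ) b * a ^ 4 := by
  obtain ⟨K, hK⟩ := h.slice
  obtain ⟨B, hB⟩ := h.bd
  have hl := h.l0.le
  set P := posP V with hP
  set N := posP (fun r θ => - V r θ) with hN
  have sP : Slice l K P := hK.pos
  have sN : Slice l K N := hK.neg.pos
  have hB' : ∀ r θ, |(fun r θ => - V r θ) r θ| ≤ B := fun r θ => by simpa using hB r θ
  have iP : ∀ᵐ r, r ∈ Ioo 0 R → DD l P r = r * ∫ θ in (0:ℝ)..l, dR P (r, θ) * P r θ :=
    SqId.ae sP (posP_bd hB) hl h.posId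
  have iN : ∀ᵐ r, r ∈ Ioo 0 R → DD l N r = r * ∫ θ in (0:ℝ)..l, dR N (r, θ) * N r θ :=
    SqId.ae sN (posP_bd hB') hl h.neg.posId
  have hac := (DD_ac sP ha.le hab).mul (DD_ac sN ha.le hab)
  refine growth_mono 4 (g := fun r => eC l P r * DD l N r + DD l P r * eC l N r) ha hab hac ?_
  filter_upwards [iP, iN, DD_deriv sP, DD_deriv sN] with r h1 h2 d1 d2 hr
  refine ⟨d1.mul d2, ?_⟩
  have hr0 : 0 < r := ha.trans hr.1
  have hrR : r ∈ Ioo 0 R := ⟨hr0, hr.2.trans_le hbR⟩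
  replace h1 := h1 hrR
  replace h2 := h2 hrR
  have nP := DD_nonneg (Z := P) hl hr0.le
  have nN := DD_nonneg (Z := N) hl hr0.le
  have eP := eC_nonneg hl hr0.le P
  have eN := eC_nonneg hl hr0.le N
  simp only [Pi.mul_apply]
  have goal' : 4 * (DD l P r * DD l N r) ≤ (r * eC l P r) * DD l N r + DD l P r * (r * eC l N r) := by
    by_cases hz : ∃ c, V r c = 0
    · obtain ⟨c, hc⟩ := hz
      have zP : P r c = 0 := by simp [hP, posP, hc]
      have zN : N r c = 0 := by simp [hN, posP, hc]
      have cP := sP.circ hl hr0 zP le_rfl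
      have cN := sN.circ hl hr0 zN le_rfl
      rw [← h1] at cP
      rw [← h2] at cN
      refine acf_real nP nN (mul_nonneg hr0.le eP) (mul_nonneg hr0.le eN)
        (intervalIntegral.integral_nonneg hl fun z _ => nz_nonneg _ z)
        (intervalIntegral.integral_nonneg hl fun z _ => nz_nonneg _ z) ?_ cP cN
      rw [← intervalIntegral.integral_add (nz_ii (sP.lipT r).continuous _ _)
        (nz_ii (sN.lipT r).continuous _ _)]
      refine le_trans (intervalIntegral.integral_mono_on (g := fun _ => (1:ℝ)) hl
        ((nz_ii (sP.lipT r).continuous _ _).add (nz_ii (sN.lipT r).continuous _ _)) (by simp)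
        fun x _ => nz_pos_neg (fun θ => V r θ) x) ?_
      simpa using h.l2
    · push Not at hz
      have hcont : Continuous (fun θ => V r θ) := (hK.lipT r).continuous
      have hs : (∀ θ, N r θ = 0) ∨ (∀ θ, P r θ = 0) := by
        by_contra hcon
        push Not at hcon
        obtain ⟨⟨θ1, h3⟩, θ2, h4⟩ := hcon
        have h5 : V r θ1 ≤ 0 := by
          by_contra h6; apply h3; simp [hN, posP]; linarith
        have h6 : 0 ≤ V r θ2 := by
          by_contra h6; apply h4; simp [hP, posP]; linarith
        obtain ⟨c, hc⟩ := mem_range_of_exists_le_of_exists_ge hcont ⟨θ1, h5⟩ ⟨θ2, h6⟩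
        exact hz c hc
      have key : DD l N r = 0 ∨ DD l P r = 0 := by
        rcases hs with hs | hs
        · left; rw [h2]; simp [hs]
        · right; rw [h1]; simp [hs]
      have t1 := mul_nonneg (mul_nonneg hr0.le eP) nN
      have t2 := mul_nonneg nP (mul_nonneg hr0.le eN)
      rcases key with key | key <;> rw [key] at * <;> simp at * <;> assumption
  push_cast
  linarith

/-! ### Part 7 -/


lemma eC_subc (l : ℝ) (V : ℝ → ℝ → ℝ) (k : ℝ) : eC l (fun r θ => V r θ - k) = eC l V := by
  ext r; unfold eC; simp only [gradSq_eq, dR_subc, dT_subc]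

lemma DD_subc (l : ℝ) (V : ℝ → ℝ → ℝ) (k : ℝ) : DD l (fun r θ => V r θ - k) = DD l V := by
  ext r; unfold DD; rw [eC_subc]

section pos
variable {l R lp lm T : ℝ} {V : ℝ → ℝ → ℝ}

lemma Mini.D2mono {a b : ℝ} (h : Mini l R lp lm V)
    (hT : T ≤ R) (hp : ∀ r ∈ Icc 0 T, ∀ θ, 0 < V r θ) (ha : 0 < a) (hab : a ≤ b) (hb : b ≤ T) :
    DD l V a * b ^ 2 ≤ DD l V b * a ^ 2 := by
  obtain ⟨K, hK⟩ := h.slice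
  obtain ⟨B, hB⟩ := h.bd
  have hl := h.l0.le
  have hT0 : 0 < T := by linarith
  have hB2 : ∀ r θ, |(fun r θ => V r θ - V 0 0) r θ| ≤ B + B := fun r θ =>
    (abs_sub _ _).trans (add_le_add (hB r θ) (hB 0 0))
  have hid := SqId.ae (hK.addc (V 0 0)) hB2 hl (h.subId hT0 hT hp (V 0 0))
  refine growth_mono 2 (g := eC l V) ha hab (DD_ac hK ha.le hab) ?_
  filter_upwards [hid, DD_deriv hK, hK.derivMc hl] with r h1 h2 h3 hr
  refine ⟨h2, ?_⟩
  have hr0 : 0 < r := ha.trans hr.1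
  have hrT : r ∈ Ioo 0 T := ⟨hr0, hr.2.trans_le hb⟩
  replace h1 := h1 hrT
  rw [DD_subc] at h1
  simp only [dR_subc] at h1
  have hz : ∫ θ in (0:ℝ)..l, dR V (r, θ) = 0 := by
    have hc : HasDerivAt (Mc l V) 0 r := by
      refine (hasDerivAt_const r (l * V 0 0)).congr_of_eventuallyEq ?_
      filter_upwards [Ioo_mem_nhds hrT.1 hrT.2] with s hs
      exact h.mean hT0 hT hp ⟨hs.1.le, hs.2.le⟩
    exact h3.unique hc
  have hk : ∀ k, ∫ θ in (0:ℝ)..l, dR V (r, θ) * (V r θ - k) = ∫ θ in (0:ℝ)..l, dR V (r, θ) * V r θ := by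
    intro k
    have : ∀ θ, dR V (r, θ) * (V r θ - k) = dR V (r, θ) * V r θ - k * dR V (r, θ) := fun θ => by ring
    simp only [this]
    rw [intervalIntegral.integral_sub (hK.fi_dRZ r 0 l) ((hK.fi_dR r 0 l).const_mul k),
      intervalIntegral.integral_const_mul, hz]
    simp
  obtain ⟨k, hw⟩ := wirt_half (hK.lipT r) hl (hK.perF r)
  rw [hk, ← hk k] at h1
  have hc := circ_real (A := ∫ θ in (0:ℝ)..l, dR V (r, θ) ^ 2) (T := ∫ θ in (0:ℝ)..l, dT V (r, θ) ^ 2)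
    (intervalIntegral.integral_nonneg hl fun z _ => sq_nonneg _)
    (intervalIntegral.integral_nonneg hl fun z _ => sq_nonneg _)
    (intervalIntegral.integral_nonneg hl fun z _ => sq_nonneg _) (show 0 ≤ l / 2 by linarith) hr0
    (cs_int (g := fun θ => V r θ - k) hl (hK.fi_dR2 r 0 l) ((hK.addc k).fi_Z2 r 0 l) (by
      have := (hK.addc k).fi_dRZ r 0 l
      simpa only [dR_subc] using this)) hw
  rw [← h1, ← hK.eC_eq hr0.ne'] at hc
  have e := eC_nonneg hl hr0.le V
  have e2 : l / 2 * (r * eC l V r) ≤ Real.pi * (r * eC l V r) := by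
    have := h.l2
    have := mul_nonneg hr0.le e
    gcongr; linarith
  have := hc.trans e2
  have hpi := Real.pi_pos
  push_cast
  by_contra hcon
  push Not at hcon
  nlinarith

lemma Mini.W2le {b : ℝ} (h : Mini l R lp lm V)
    (hT : T ≤ R) (hp : ∀ r ∈ Icc 0 T, ∀ θ, 0 < V r θ) (hb0 : 0 < b) (hb : b ≤ T) :
    Mc l (sqf fun r θ => V r θ - V 0 0) b ≤ DD l V b := by
  obtain ⟨K, hK⟩ := h.slice
  obtain ⟨B, hB⟩ := h.bd
  have hl := h.l0.le
  have hT0 : 0 < T := by linarith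
  have hB2 : ∀ r θ, |(fun r θ => V r θ - V 0 0) r θ| ≤ B + B := fun r θ =>
    (abs_sub _ _).trans (add_le_add (hB r θ) (hB 0 0))
  have hS := (hK.addc (V 0 0)).mul (hK.addc (V 0 0)) hB2 hB2
  have hid := h.subId hT0 hT hp (V 0 0)
  set W := Mc l (sqf fun r θ => V r θ - V 0 0) with hW
  have hcont : Continuous W := hS.contMc hl
  have hD := DD_nonneg (Z := V) hl hb0.le
  have key : ∀ a ∈ Ioo 0 b, W b - DD l V b ≤ W a := by
    intro a ha
    have h1 := hid a b ha.1 ha.2 hb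
    rw [DD_subc] at h1
    have hpos : ∀ r ∈ uIcc a b, 0 < r := fun r hr => by
      rw [uIcc_of_le ha.2.le] at hr; exact ha.1.trans_le hr.1
    have h2 : ∫ r in a..b, DD l V r / r ≤ ∫ r in a..b, DD l V b / b ^ 2 * r := by
      apply intervalIntegral.integral_mono_on ha.2.le
      · apply ContinuousOn.intervalIntegrable
        exact (DD_cont hK).continuousOn.div continuousOn_id fun r hr => (hpos r hr).ne'
      · apply Continuous.intervalIntegrable; fun_prop
      · intro r hr
        have hr0 : 0 < r := ha.1.trans_le hr.1
        have := h.D2mono hT hp hr0 hr.2 hb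
        rw [div_mul_eq_mul_div, div_le_div_iff₀ hr0 (by positivity)]
        nlinarith
    rw [intervalIntegral.integral_const_mul, integral_id] at h2
    have h3 : DD l V b / b ^ 2 * ((b ^ 2 - a ^ 2) / 2) ≤ DD l V b / 2 := by
      rw [div_mul_div_comm, div_le_div_iff₀ (by positivity) (by positivity)]
      nlinarith [mul_nonneg hD (sq_nonneg a)]
    linarith
  have hW0 : W 0 = 0 := by
    have := Mc_zero hS
    simp only [sub_self, mul_zero] at this
    exact this
  have hlim : Filter.Tendsto W (nhdsWithin 0 (Ioi 0)) (nhds (W 0)) :=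
    hcont.continuousAt.tendsto.mono_left nhdsWithin_le_nhds
  have := ge_of_tendsto hlim (Filter.eventually_of_mem (Ioo_mem_nhdsGT hb0) key)
  linarith

lemma Mini.W2mono {a b : ℝ} (h : Mini l R lp lm V)
    (hT : T ≤ R) (hp : ∀ r ∈ Icc 0 T, ∀ θ, 0 < V r θ) (ha : 0 < a) (hab : a ≤ b) (hb : b ≤ T) :
    Mc l (sqf fun r θ => V r θ - V 0 0) a * b ^ 2 ≤ Mc l (sqf fun r θ => V r θ - V 0 0) b * a ^ 2 := by
  obtain ⟨K, hK⟩ := h.slice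
  obtain ⟨B, hB⟩ := h.bd
  have hl := h.l0.le
  have hT0 : 0 < T := by linarith
  have hB2 : ∀ r θ, |(fun r θ => V r θ - V 0 0) r θ| ≤ B + B := fun r θ =>
    (abs_sub _ _).trans (add_le_add (hB r θ) (hB 0 0))
  have hS := (hK.addc (V 0 0)).mul (hK.addc (V 0 0)) hB2 hB2
  have hid := h.subId hT0 hT hp (V 0 0)
  refine growth_mono 2 (g := fun r => 2 * (DD l V r / r)) ha hab ?_ ?_
  · have hL : LipschitzWith (((B + B) * K + (B + B) * K) * l).toNNReal
        (Mc l (sqf fun r θ => V r θ - V 0 0)) := by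
      refine LipschitzWith.of_dist_le_mul fun x y => ?_
      rw [Real.dist_eq, Real.dist_eq, Real.coe_toNNReal _ (mul_nonneg hS.K0 hl)]
      exact hS.lipMc hl x y
    exact lip_ac hL a b
  · refine Filter.Eventually.of_forall fun r hr => ?_
    have hr0 : 0 < r := ha.trans hr.1
    have := hid.hasDeriv (hK.addc (V 0 0)) (r := r) ⟨hr0, hr.2.trans_le hb⟩
    rw [DD_subc] at this
    refine ⟨this, ?_⟩
    have h2 := h.W2le hT hp hr0 (hr.2.le.trans hb)
    push_cast
    have : r * (2 * (DD l V r / r)) = 2 * DD l V r := by field_simp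
    rw [this]
    linarith
end pos

lemma dyadic {F : ℝ → ℝ} {C R : ℝ} (hF : Continuous F) (hC : 0 ≤ C)
    (h : ∀ s, 0 < s → 2 * s ≤ R → |F (2 * s) - F s| ≤ C * s) {s : ℝ} (hs : 0 < s) (hsR : s ≤ R) :
    |F s - F 0| ≤ C * s := by
  have key : ∀ n : ℕ, |F s - F (s / 2 ^ n)| ≤ C * s * (1 - 1 / 2 ^ n) := by
    intro n
    induction n with
    | zero => simp
    | succ n ih =>
      have h1 := h (s / 2 ^ (n+1)) (by positivity) (by
        have : 2 * (s / 2 ^ (n+1)) = s / 2 ^ n := by rw [pow_succ]; field_simp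
        rw [this]
        exact (div_le_self hs.le (one_le_pow₀ (by norm_num))).trans hsR)
      have e : 2 * (s / 2 ^ (n+1)) = s / 2 ^ n := by rw [pow_succ]; field_simp
      rw [e] at h1
      have h2 := abs_sub_le (F s) (F (s / 2^n)) (F (s / 2 ^ (n+1)))
      have e2 : C * s * (1 - 1 / 2 ^ n) + C * (s / 2 ^ (n+1)) = C * s * (1 - 1 / 2 ^ (n+1)) := by
        rw [pow_succ]; field_simp; ring
      linarith
  have hlim : Filter.Tendsto (fun n : ℕ => |F s - F (s / 2 ^ n)|) Filter.atTop
      (nhds |F s - F 0|) := by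
    have h1 : Filter.Tendsto (fun n : ℕ => s / 2 ^ n) Filter.atTop (nhds 0) := by
      have := (tendsto_pow_atTop_nhds_zero_of_lt_one (r := (1/2:ℝ)) (by norm_num) (by norm_num)).const_mul s
      simp only [mul_zero] at this
      refine this.congr fun n => ?_
      rw [one_div, inv_pow]; rfl
    exact ((hF.tendsto 0).comp h1).const_sub (F s) |>.abs
  refine le_of_tendsto hlim (Filter.Eventually.of_forall fun n => (key n).trans ?_)
  have : (0:ℝ) ≤ 1 / 2 ^ n := by positivity
  nlinarith [mul_nonneg (mul_nonneg hC hs.le) this]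

lemma Slice.Mc_diff {l K κ s : ℝ} {Q : ℝ → ℝ → ℝ} (h : Slice l K Q) (hl : 0 ≤ l) (hs : 0 < s)
    (hD : DD l Q (2 * s) ≤ 4 * κ * s ^ 2) : |Mc l Q (2 * s) - Mc l Q s| ≤ (l + 2 * κ) * s := by
  rw [← h.ftc hl (by linarith : s ≤ 2 * s)]
  have hle : s ≤ 2 * s := by linarith
  have h1 : |∫ r in s..(2*s), ∫ θ in (0:ℝ)..l, dR Q (r, θ)| ≤
      ∫ r in s..(2*s), (l / 2 + eC l Q r / (2 * s)) := by
    rw [← Real.norm_eq_abs]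
    refine intervalIntegral.norm_integral_le_of_norm_le hle ?_
      ((intervalIntegrable_const).add ((ii_eC h _ _).div_const _))
    refine Filter.Eventually.of_forall fun r hr => ?_
    have hr0 : 0 < r := hs.trans hr.1
    have h2 : ‖∫ θ in (0:ℝ)..l, dR Q (r, θ)‖ ≤ ∫ θ in (0:ℝ)..l, (1/2 + gradSq Q (r, θ) / 2) := by
      refine intervalIntegral.norm_integral_le_of_norm_le hl
        (Filter.Eventually.of_forall fun θ _ => ?_) ?_
      · rw [Real.norm_eq_abs, gradSq_eq]
        have : 0 ≤ dT Q (r, θ) ^ 2 / (r, θ).1 ^ 2 := by positivity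
        rw [abs_le]; constructor <;>
        nlinarith [sq_nonneg (dR Q (r, θ) - 1), sq_nonneg (dR Q (r, θ) + 1)]
      · refine (intervalIntegrable_const).add (IntervalIntegrable.div_const ?_ _)
        exact ii_fiber h.meas_gradSq (C := 2 * K ^ 2) fun θ => by
          rw [abs_of_nonneg (Slice.gradSq_nonneg Q _)]; exact h.gradSq_le _
    refine h2.trans ?_
    rw [intervalIntegral.integral_add intervalIntegrable_const
      (IntervalIntegrable.div_const (ii_fiber h.meas_gradSq (C := 2 * K ^ 2) fun θ => by
          rw [abs_of_nonneg (Slice.gradSq_nonneg Q _)]; exact h.gradSq_le _) _),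
      intervalIntegral.integral_const, intervalIntegral.integral_div]
    have h3 : (∫ θ in (0:ℝ)..l, gradSq Q (r, θ)) / 2 ≤ eC l Q r / (2 * s) := by
      rw [div_le_div_iff₀ (by norm_num) (by positivity)]
      unfold eC
      have : 0 ≤ ∫ θ in (0:ℝ)..l, gradSq Q (r, θ) :=
        intervalIntegral.integral_nonneg hl fun θ _ => Slice.gradSq_nonneg Q _
      nlinarith [hr.1.le]
    simp only [sub_zero, smul_eq_mul]
    linarith
  refine h1.trans ?_
  rw [intervalIntegral.integral_add intervalIntegrable_const ((ii_eC h _ _).div_const _),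
    intervalIntegral.integral_const, intervalIntegral.integral_div, ← DD_sub h]
  have h4 := DD_nonneg (Z := Q) hl hs.le
  have h5 : (DD l Q (2*s) - DD l Q s) / (2 * s) ≤ 2 * κ * s := by
    rw [div_le_iff₀ (by positivity)]; nlinarith
  simp only [smul_eq_mul]
  nlinarith [mul_nonneg hl hs.le]

lemma posP_sub_neg (V : ℝ → ℝ → ℝ) (r θ : ℝ) :
    posP V r θ - posP (fun r θ => - V r θ) r θ = V r θ := by
  unfold posP
  rcases le_total (V r θ) 0 with h | h <;> simp [h]

lemma Mc_pos_neg {l K : ℝ} {V : ℝ → ℝ → ℝ} (h : Slice l K V) (r : ℝ) :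
    Mc l V r = Mc l (posP V) r - Mc l (posP fun r θ => - V r θ) r := by
  unfold Mc
  rw [← intervalIntegral.integral_sub (h.pos.fi_Z r 0 l) (h.neg.pos.fi_Z r 0 l)]
  simp only [posP_sub_neg]

/-- Linear growth of circle means of the positive part. -/
lemma Mini.G1 {l R lp lm κ s : ℝ} {V : ℝ → ℝ → ℝ} (h : Mini l R lp lm V) (hκ : 0 ≤ κ)
    (hD : DD l (posP V) R * DD l (posP fun r θ => - V r θ) R ≤ κ ^ 2 * R ^ 4) (hs : 0 < s)
    (hsR : s ≤ R) :
    |Mc l (posP V) s - l * posP V 0 0| ≤ (2 * l + 4 * (lp + lm) * l + 2 * κ) * s := by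
  obtain ⟨K, hK⟩ := h.slice
  have hl := h.l0.le
  have hlp := h.lp0
  have hlm := h.lm0
  rw [← Mc_zero hK.pos]
  have hC : 0 ≤ 2 * l + 4 * (lp + lm) * l + 2 * κ := by positivity
  refine dyadic (hK.pos.contMc hl) hC (fun t ht htR => ?_) hs hsR
  have h1 := h.acf (a := 2 * t) (b := R) (by linarith) htR le_rfl
  have hR := h.R0
  set x := DD l (posP V) (2 * t) with hx
  set y := DD l (posP fun r θ => - V r θ) (2 * t) with hy
  have x0 : 0 ≤ x := DD_nonneg hl (by linarith)
  have y0 : 0 ≤ y := DD_nonneg hl (by linarith)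
  have h2 : x * y ≤ (4 * κ * t ^ 2) ^ 2 := by
    have : x * y * R ^ 4 ≤ (4 * κ * t ^ 2) ^ 2 * R ^ 4 := by
      refine h1.trans ((mul_le_mul_of_nonneg_right hD (by positivity)).trans (le_of_eq ?_))
      ring
    exact le_of_mul_le_mul_right this (by positivity)
  have h3 : x ≤ 4 * κ * t ^ 2 ∨ y ≤ 4 * κ * t ^ 2 := by
    by_contra hcon
    push Not at hcon
    have : 0 ≤ 4 * κ * t ^ 2 := by positivity
    nlinarith [hcon.1, hcon.2]
  have e1 : (l + 2 * κ) * t + (l + 4 * (lp + lm) * l) * t =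
    (2 * l + 4 * (lp + lm) * l + 2 * κ) * t := by ring
  rcases h3 with h3 | h3
  · have := hK.pos.Mc_diff hl ht h3
    have e2 : 0 ≤ (l + 4 * (lp + lm) * l) * t := by positivity
    linarith
  · have a1 := hK.neg.pos.Mc_diff hl ht h3
    have a2 := h.mean_diff ht htR
    rw [Mc_pos_neg hK, Mc_pos_neg hK] at a2
    rw [abs_le] at *
    constructor <;> linarith [a1.1, a1.2, a2.1, a2.2]

/-! ### Part 8 -/


lemma pol_eq (r θ : ℝ) : pol r θ = (r:ℂ) * ((Real.cos θ : ℂ) + (Real.sin θ : ℂ) * Complex.I) := by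
  unfold pol
  rw [Complex.exp_mul_I]; push_cast; rfl

lemma meas_pol : Measurable (fun p : ℝ × ℝ => pol p.1 p.2) := by
  have : Continuous (fun p : ℝ × ℝ => pol p.1 p.2) := by unfold pol; fun_prop
  exact this.measurable

lemma polar_int {F : ℂ → ℝ} {z0 : ℂ} {A : Set ℂ} (hAm : MeasurableSet A) {R α β : ℝ}
    (hα : -Real.pi ≤ α) (hβ : β ≤ Real.pi)
    (hA : ∀ p ∈ polarCoord.target, (z0 + pol p.1 p.2 ∈ A ↔ p ∈ Ioo 0 R ×ˢ Ioo α β)) :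
    ∫ p in Ioo 0 R ×ˢ Ioo α β, F (z0 + pol p.1 p.2) * p.1 = ∫ z in A, F z := by
  rw [← integral_indicator hAm, ← integral_add_left_eq_self _ z0,
    ← Complex.integral_comp_polarCoord_symm]
  have hm : MeasurableSet (Ioo 0 R ×ˢ Ioo α β) := measurableSet_Ioo.prod measurableSet_Ioo
  have htm : MeasurableSet (polarCoord.target : Set (ℝ × ℝ)) := polarCoord.open_target.measurableSet
  have h1 : ∫ p in polarCoord.target, p.1 • A.indicator F (z0 + Complex.polarCoord.symm p) =
      ∫ p in polarCoord.target, (Ioo 0 R ×ˢ Ioo α β).indicator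
        (fun p => F (z0 + pol p.1 p.2) * p.1) p := by
    refine setIntegral_congr_fun htm fun p hp => ?_
    simp only [Complex.polarCoord_symm_apply, ← pol_eq, smul_eq_mul]
    by_cases h : z0 + pol p.1 p.2 ∈ A
    · rw [indicator_of_mem h, indicator_of_mem ((hA p hp).1 h), mul_comm]
    · rw [indicator_of_notMem h, indicator_of_notMem (fun h' => h ((hA p hp).2 h')), mul_zero]
  rw [h1, setIntegral_indicator hm]
  congr 2
  rw [inter_eq_right.mpr]
  rintro ⟨r, θ⟩ ⟨h1, h2⟩
  rw [polarCoord_target]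
  exact ⟨h1.1, hα.trans_lt h2.1, h2.2.trans_le hβ⟩

/-- pull back to polar coordinates around `z0` -/
def pb (U : ℂ → ℝ) (z0 : ℂ) : ℝ → ℝ → ℝ := fun r θ => U (z0 + pol r θ)

/-- squared gradient in the plane -/
def Gam (U : ℂ → ℝ) (z : ℂ) : ℝ := (fderiv ℝ U z 1) ^ 2 + (fderiv ℝ U z Complex.I) ^ 2

lemma Gam_nonneg (U : ℂ → ℝ) (z : ℂ) : 0 ≤ Gam U z := by unfold Gam; positivity

lemma meas_Gam (U : ℂ → ℝ) : Measurable (Gam U) :=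
  ((measurable_fderiv_apply_const ℝ U 1).pow_const 2).add
    ((measurable_fderiv_apply_const ℝ U Complex.I).pow_const 2)

lemma Gam_le {U : ℂ → ℝ} {L : NNReal} (h : LipschitzWith L U) (z : ℂ) : Gam U z ≤ 2 * (L:ℝ) ^ 2 := by
  have h0 := norm_fderiv_le_of_lipschitz ℝ h (x₀ := z)
  have h1 := (fderiv ℝ U z).le_of_opNorm_le h0 1
  have h2 := (fderiv ℝ U z).le_of_opNorm_le h0 Complex.I
  simp only [norm_one, Complex.norm_I, mul_one, Real.norm_eq_abs] at h1 h2
  unfold Gam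
  rw [← sq_abs, ← sq_abs (fderiv ℝ U z Complex.I)]
  have := pow_le_pow_left₀ (abs_nonneg _) h1 2
  have := pow_le_pow_left₀ (abs_nonneg _) h2 2
  linarith

lemma gradSq_pb {U : ℂ → ℝ} {z0 : ℂ} {p : ℝ × ℝ} (hp : p.1 ≠ 0)
    (h : DifferentiableAt ℝ U (z0 + pol p.1 p.2)) :
    gradSq (pb U z0) p = Gam U (z0 + pol p.1 p.2) := by
  obtain ⟨r, θ⟩ := p
  simp only at hp h ⊢
  set c := Real.cos θ
  set s := Real.sin θ
  have d1 : HasDerivAt (fun x : ℝ => z0 + pol x θ) ((c:ℂ) + s * Complex.I) r := by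
    have : HasDerivAt (fun x : ℝ => z0 + (x:ℂ) * ((c:ℂ) + s * Complex.I))
        (1 * ((c:ℂ) + s * Complex.I)) r :=
      (Complex.ofRealCLM.hasDerivAt.mul_const _).const_add z0
    simpa only [pol_eq, one_mul] using this
  have d2 : HasDerivAt (fun x : ℝ => z0 + pol r x) ((r:ℂ) * (-(s:ℂ) + c * Complex.I)) θ := by
    have e1 : HasDerivAt (fun x : ℝ => ((Real.cos x : ℝ) : ℂ)) ((-s : ℝ) : ℂ) θ :=
      (Real.hasDerivAt_cos θ).ofReal_comp
    have e2 : HasDerivAt (fun x : ℝ => ((Real.sin x : ℝ) : ℂ)) ((c : ℝ) : ℂ) θ :=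
      (Real.hasDerivAt_sin θ).ofReal_comp
    have := ((e1.add (e2.mul_const Complex.I)).const_mul (r:ℂ)).const_add z0
    simp only [pol_eq]
    have e3 : (r:ℂ) * (-(s:ℂ) + c * Complex.I) = (r:ℂ) * (((-s : ℝ) : ℂ) + c * Complex.I) := by
      push_cast; rfl
    rw [e3]
    exact this
  have D := h.hasFDerivAt
  have f1 := (D.comp_hasDerivAt r d1).deriv
  have f2 := (D.comp_hasDerivAt θ d2).deriv
  set L := fderiv ℝ U (z0 + pol r θ) with hL
  have l1 : L ((c:ℂ) + s * Complex.I) = c * L 1 + s * L Complex.I := by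
    have : ((c:ℂ) + s * Complex.I) = c • (1:ℂ) + s • Complex.I := by simp
    rw [this, map_add, map_smul, map_smul]; simp
  have l2 : L ((r:ℂ) * (-(s:ℂ) + c * Complex.I)) = r * (- s * L 1 + c * L Complex.I) := by
    have : ((r:ℂ) * (-(s:ℂ) + c * Complex.I)) = r • ((-s) • (1:ℂ) + c • Complex.I) := by simp; ring
    rw [this, map_smul, map_add, map_smul, map_smul]; simp
  have g1 : deriv (fun x => pb U z0 x θ) r = c * L 1 + s * L Complex.I := by rw [← l1]; exact f1
  have g2 : deriv (fun x => pb U z0 r x) θ = r * (- s * L 1 + c * L Complex.I) := by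
    rw [← l2]; exact f2
  unfold gradSq Gam
  simp only [g1, g2]
  have hcs : s ^ 2 + c ^ 2 = 1 := Real.sin_sq_add_cos_sq θ
  rw [← hL]
  field_simp
  linear_combination ((L 1)^2 + (L Complex.I)^2) * hcs

lemma gradSq_congr_open {v w : ℝ → ℝ → ℝ} {S : Set (ℝ × ℝ)} (hS : IsOpen S)
    (h : ∀ p ∈ S, v p.1 p.2 = w p.1 p.2) {p : ℝ × ℝ} (hp : p ∈ S) : gradSq v p = gradSq w p := by
  have h1 : (fun s => v s p.2) =ᶠ[nhds p.1] fun s => w s p.2 := by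
    have hc : Continuous (fun s : ℝ => (s, p.2)) := by fun_prop
    filter_upwards [hc.continuousAt.preimage_mem_nhds (hS.mem_nhds hp)] with s hs using h _ hs
  have h2 : (fun s => v p.1 s) =ᶠ[nhds p.2] fun s => w p.1 s := by
    have hc : Continuous (fun s : ℝ => (p.1, s)) := by fun_prop
    filter_upwards [hc.continuousAt.preimage_mem_nhds (hS.mem_nhds hp)] with s hs using h _ hs
  unfold gradSq
  rw [h1.deriv_eq, h2.deriv_eq]

section box
variable {z0 : ℂ} {A : Set ℂ} {R α β : ℝ} {U : ℂ → ℝ} {L : NNReal}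

lemma box_fin (R α β : ℝ) : volume (Ioo 0 R ×ˢ Ioo α β) ≠ ⊤ := by
  rw [Measure.volume_eq_prod, Measure.prod_prod]
  simp only [Real.volume_Ioo]
  exact ENNReal.mul_ne_top ENNReal.ofReal_ne_top ENNReal.ofReal_ne_top

lemma box_int {F : ℝ × ℝ → ℝ} {C : ℝ} (hF : Measurable F)
    (hb : ∀ p ∈ Ioo 0 R ×ˢ Ioo α β, |F p| ≤ C) : IntegrableOn F (Ioo 0 R ×ˢ Ioo α β) := by
  refine Measure.integrableOn_of_bounded (M := C) (box_fin R α β) hF.aestronglyMeasurable ?_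
  rw [ae_restrict_iff' (measurableSet_Ioo.prod measurableSet_Ioo)]
  exact Filter.Eventually.of_forall hb

lemma ae_grad (hU : LipschitzWith L U) (hAm : MeasurableSet A)
    (hα : -Real.pi ≤ α) (hβ : β ≤ Real.pi)
    (hA : ∀ p ∈ polarCoord.target, (z0 + pol p.1 p.2 ∈ A ↔ p ∈ Ioo 0 R ×ˢ Ioo α β)) :
    ∀ᵐ p ∂(volume.restrict (Ioo 0 R ×ˢ Ioo α β)),
      DifferentiableAt ℝ U (z0 + pol p.1 p.2) := by
  set N : Set ℂ := {z | DifferentiableAt ℝ U z}ᶜ with hN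
  have hNm : MeasurableSet N := (measurableSet_of_differentiableAt ℝ U).compl
  have hbm : MeasurableSet (Ioo 0 R ×ˢ Ioo α β) := measurableSet_Ioo.prod measurableSet_Ioo
  have h0 : volume N = 0 := hU.ae_differentiableAt
  have h1 := polar_int (F := N.indicator fun _ => (1:ℝ)) hAm hα hβ hA
  have h2 : ∫ z in A, N.indicator (fun _ => (1:ℝ)) z = 0 := by
    apply integral_eq_zero_of_ae
    have : ∀ᵐ z ∂volume, z ∉ N := measure_eq_zero_iff_ae_notMem.mp h0
    filter_upwards [ae_restrict_of_ae this] with z hz using indicator_of_notMem hz _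
  rw [h2] at h1
  have hmeas : Measurable (fun p : ℝ × ℝ => N.indicator (fun _ => (1:ℝ)) (z0 + pol p.1 p.2) * p.1) :=
    ((measurable_const.indicator hNm).comp (meas_pol.const_add z0)).mul measurable_fst
  have hnn : ∀ z, 0 ≤ N.indicator (fun _ => (1:ℝ)) z ∧ N.indicator (fun _ => (1:ℝ)) z ≤ 1 := by
    intro z; by_cases hz : z ∈ N <;> simp [hz]
  rw [setIntegral_eq_zero_iff_of_nonneg_ae] at h1
  · rw [Filter.EventuallyEq, ae_restrict_iff' hbm] at h1
    rw [ae_restrict_iff' hbm]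
    filter_upwards [h1] with p hp hpb
    have := hp hpb
    by_contra hcon
    have hz : z0 + pol p.1 p.2 ∈ N := hcon
    simp only [indicator_of_mem hz, one_mul, Pi.zero_apply] at this
    have := hpb.1.1
    linarith
  · rw [Filter.EventuallyLE, ae_restrict_iff' hbm]
    exact Filter.Eventually.of_forall fun p hp => mul_nonneg (hnn _).1 hp.1.1.le
  · refine box_int (C := R) hmeas fun p hp => ?_
    rw [abs_of_nonneg (mul_nonneg (hnn _).1 hp.1.1.le)]
    nlinarith [(hnn (z0 + pol p.1 p.2)).2, hp.1.1, hp.1.2]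

/-- planar density -/
def jU (lp lm : ℝ) (U : ℂ → ℝ) (z : ℂ) : ℝ :=
  Gam U z + (if 0 < U z then lp else 0) + (if U z < 0 then lm else 0)

/-- polar density -/
def jP (lp lm : ℝ) (v : ℝ → ℝ → ℝ) (p : ℝ × ℝ) : ℝ :=
  gradSq v p + (if 0 < v p.1 p.2 then lp else 0) + (if v p.1 p.2 < 0 then lm else 0)

lemma meas_jU (lp lm : ℝ) (hU : LipschitzWith L U) : Measurable (jU lp lm U) := by
  have hm := hU.continuous.measurable
  unfold jU
  exact ((meas_Gam U).add (Measurable.ite (measurableSet_lt measurable_const hm) measurable_const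
    measurable_const)).add (Measurable.ite (measurableSet_lt hm measurable_const) measurable_const
    measurable_const)

lemma jU_bd {lp lm : ℝ} (hlp : 0 ≤ lp) (hlm : 0 ≤ lm) (hU : LipschitzWith L U) (z : ℂ) :
    |jU lp lm U z| ≤ 2 * (L:ℝ)^2 + lp + lm := by
  have h1 := Gam_le hU z
  have h2 := Gam_nonneg U z
  unfold jU
  rw [abs_le]; split_ifs <;> constructor <;> linarith

lemma meas_jP {l K : ℝ} {v : ℝ → ℝ → ℝ} (lp lm : ℝ) (hv : Slice l K v) : Measurable (jP lp lm v) := by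
  have hm := hv.meas_V
  unfold jP
  exact (hv.meas_gradSq.add (Measurable.ite (measurableSet_lt measurable_const hm) measurable_const
    measurable_const)).add (Measurable.ite (measurableSet_lt hm measurable_const) measurable_const
    measurable_const)

lemma jP_bd {l K lp lm : ℝ} {v : ℝ → ℝ → ℝ} (hlp : 0 ≤ lp) (hlm : 0 ≤ lm) (hv : Slice l K v)
    (p : ℝ × ℝ) : |jP lp lm v p| ≤ 2 * K^2 + lp + lm := by
  have h1 := hv.gradSq_le p
  have h2 := Slice.gradSq_nonneg v p
  unfold jP
  rw [abs_le]; split_ifs <;> constructor <;> linarith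

lemma J_polar {v : ℝ → ℝ → ℝ} (lp lm : ℝ) (hU : LipschitzWith L U) (hAm : MeasurableSet A)
    (hα : -Real.pi ≤ α) (hβ : β ≤ Real.pi)
    (hA : ∀ p ∈ polarCoord.target, (z0 + pol p.1 p.2 ∈ A ↔ p ∈ Ioo 0 R ×ˢ Ioo α β))
    (hv : ∀ p ∈ Ioo 0 R ×ˢ Ioo α β, v p.1 p.2 = U (z0 + pol p.1 p.2)) :
    ∫ p in Ioo 0 R ×ˢ Ioo α β, jP lp lm v p * p.1 = ∫ z in A, jU lp lm U z := by
  rw [← polar_int (F := jU lp lm U) hAm hα hβ hA]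
  have hbm : MeasurableSet (Ioo 0 R ×ˢ Ioo α β) := measurableSet_Ioo.prod measurableSet_Ioo
  apply setIntegral_congr_ae hbm
  have := ae_grad hU hAm hα hβ hA
  rw [ae_restrict_iff' hbm] at this
  filter_upwards [this] with p hp hpb
  have h1 : gradSq v p = gradSq (pb U z0) p :=
    gradSq_congr_open (isOpen_Ioo.prod isOpen_Ioo) (fun p hp => hv p hp) hpb
  unfold jP jU
  rw [h1, gradSq_pb hpb.1.1.ne' (hp hpb), hv p hpb]

end box

/-- Periodic integrals over a period box. -/
lemma shift_box {l R C θ0 : ℝ} {F : ℝ × ℝ → ℝ} (hR : 0 ≤ R) (hl : 0 ≤ l) (hF : Measurable F)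
    (hb : ∀ r ∈ Icc 0 R, ∀ θ, |F (r, θ)| ≤ C) (hp : ∀ r θ, F (r, θ + l) = F (r, θ)) (c : ℝ) :
    ∫ p in Om R l, F p = ∫ p in Ioo 0 R ×ˢ Ioo c (c + l), F (p.1, θ0 + p.2) := by
  have hF2 : Measurable (fun p : ℝ × ℝ => F (p.1, θ0 + p.2)) :=
    hF.comp (measurable_fst.prodMk (measurable_snd.const_add θ0))
  have h1 : ∫ p in Ioo 0 R ×ˢ Ioo c (c + l), F (p.1, θ0 + p.2) =
      ∫ r in (0:ℝ)..R, ∫ θ in c..(c+l), F (r, θ0 + θ) := by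
    have hi : IntegrableOn (fun p : ℝ × ℝ => F (p.1, θ0 + p.2)) (Ioo 0 R ×ˢ Ioo c (c + l)) :=
      box_int (C := C) hF2 fun p hp => hb p.1 ⟨hp.1.1.le, hp.1.2.le⟩ _
    rw [Measure.volume_eq_prod] at hi ⊢
    rw [setIntegral_prod _ hi, intervalIntegral.integral_of_le hR, integral_Ioc_eq_integral_Ioo]
    refine setIntegral_congr_fun measurableSet_Ioo fun r _ => ?_
    simp only
    rw [intervalIntegral.integral_of_le (by linarith), integral_Ioc_eq_integral_Ioo]
  rw [h1, fub (C := C) hR hl hF fun p hp => hb p.1 ⟨hp.1.1.le, hp.1.2.le⟩ _]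
  congr 1; ext r
  have hper : Function.Periodic (fun θ => F (r, θ)) l := hp r
  rw [per_shift hper (θ0 + c), intervalIntegral.integral_comp_add_left (fun θ => F (r, θ)) θ0]
  congr 1; ring

/-! ### Part 9 -/


lemma wrap_add_int {l : ℝ} (hl : 0 < l) (t : ℝ) (k : ℤ) : wrap l (t + k * l) = wrap l t := by
  unfold wrap
  have : (t + k * l) / l = t / l + k := by field_simp
  rw [this, round_add_intCast]; push_cast; ring

lemma wrap_self {l x : ℝ} (hl : 0 < l) (hx : |x| < l / 2) : wrap l x = x := by
  unfold wrap
  have : round (x / l) = 0 := by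
    rw [round_eq_zero_iff]
    rw [abs_lt] at hx
    constructor
    · rw [le_div_iff₀ hl]; linarith
    · rw [div_lt_iff₀ hl]; linarith
  rw [this]; simp

lemma Slice.lipDist {l K : ℝ} {V : ℝ → ℝ → ℝ} (h : Slice l K V) (hl : 0 < l)
    (hl2 : l ≤ 2 * Real.pi) {r s : ℝ} (hr : 0 ≤ r) (hs : 0 ≤ s) (θ φ : ℝ) :
    |V r θ - V s φ| ≤ 3 * K * coneDist l (r, θ) (s, φ) := by
  obtain ⟨k, hk, hd⟩ := coneDist_shift hl hl2 r θ s φ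
  rw [hd, ← per_int (h.per s) φ k]
  set ψ := φ + k * l
  have hK := h.K0
  have h1 := abs_sub_le_norm_pol r θ s ψ hr hs
  rcases le_total r s with hrs | hrs
  · have h2 := mul_abs_le_norm_pol r θ s ψ hr hrs (by linarith)
    have h3 := h.lipt r θ ψ
    have h4 := h.lipr r s ψ
    rw [abs_of_nonneg hr] at h3
    have := abs_sub_le (V r θ) (V r ψ) (V s ψ)
    nlinarith
  · have h2 := mul_abs_le_norm_pol s ψ r θ hs hrs (by rw [abs_sub_comm]; linarith)
    rw [abs_sub_comm, norm_sub_rev] at h2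
    have h3 := h.lipt s θ ψ
    have h4 := h.lipr r s θ
    rw [abs_of_nonneg hs] at h3
    have := abs_sub_le (V r θ) (V s θ) (V s ψ)
    nlinarith

lemma norm_pol (r θ : ℝ) : ‖pol r θ‖ = |r| := by
  unfold pol
  rw [norm_mul, Complex.norm_exp_ofReal_mul_I, mul_one, Complex.norm_real, Real.norm_eq_abs]

lemma pol_arg (z : ℂ) : pol ‖z‖ (Complex.arg z) = z := Complex.norm_mul_exp_arg_mul_I z

lemma arg_pol {r θ : ℝ} (hr : 0 < r) (h1 : -Real.pi < θ) (h2 : θ ≤ Real.pi) :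
    Complex.arg (pol r θ) = θ := by
  rw [pol_eq, Complex.ofReal_cos, Complex.ofReal_sin]
  exact Complex.arg_mul_cos_add_sin_mul_I hr ⟨h1, h2⟩

lemma abs_arg_pol {r θ : ℝ} (hr : 0 < r) (h : |θ| ≤ Real.pi) :
    |Complex.arg (pol r θ)| = |θ| := by
  rw [abs_le] at h
  rcases h.1.lt_or_eq with h1 | h1
  · rw [arg_pol hr h1 h.2]
  · have : pol r θ = pol r Real.pi := by
      rw [← pol_add_two_pi r θ 1, ← h1]; congr 1; push_cast; ring
    rw [this, arg_pol hr (by linarith [Real.pi_pos]) le_rfl, ← h1, abs_neg]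

lemma pol_lipr (r s θ : ℝ) : ‖pol r θ - pol s θ‖ = |r - s| := by
  rw [← norm_pol (r - s) θ]; unfold pol; push_cast; ring_nf

lemma pol_lipt (r θ φ : ℝ) : ‖pol r θ - pol r φ‖ ≤ |r| * |θ - φ| := by
  have h := norm_pol_sub_le 1 θ 1 φ zero_le_one
  have : pol r θ - pol r φ = (r:ℂ) * (pol 1 θ - pol 1 φ) := by unfold pol; push_cast; ring
  rw [this, norm_mul, Complex.norm_real, Real.norm_eq_abs]
  simp only [sub_self, abs_zero, zero_add, one_mul] at h
  exact mul_le_mul_of_nonneg_left h (abs_nonneg _)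

lemma lipU {U : ℂ → ℝ} {L : NNReal} (hU : LipschitzWith L U) (z w : ℂ) :
    |U z - U w| ≤ L * ‖z - w‖ := by
  have := hU.dist_le_mul z w
  rwa [Real.dist_eq, Complex.dist_eq] at this

lemma pb_slice {U : ℂ → ℝ} {L : NNReal} (hU : LipschitzWith L U) (z0 : ℂ) :
    Slice (2 * Real.pi) L (pb U z0) := by
  refine ⟨L.2, fun r θ => ?_, fun r s θ => ?_, fun r θ φ => ?_⟩
  · have := pol_add_two_pi r θ 1
    simp only [Int.cast_one, one_mul] at this
    simp only [pb, this]
  · refine (lipU hU _ _).trans (le_of_eq ?_)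
    rw [add_sub_add_left_eq_sub, pol_lipr]
  · refine (lipU hU _ _).trans ?_
    rw [add_sub_add_left_eq_sub, mul_assoc]
    exact mul_le_mul_of_nonneg_left (pol_lipt r θ φ) L.2

lemma exists_plane {l K B : ℝ} {V : ℝ → ℝ → ℝ} (h : Slice l K V) (hl : 0 < l)
    (hl2 : l ≤ 2 * Real.pi) (hB : ∀ r θ, |V r θ| ≤ B) :
    ∃ (L : NNReal) (U : ℂ → ℝ), LipschitzWith L U ∧ (∀ z, |U z| ≤ B) ∧
      ∀ r θ, 0 ≤ r → |θ| ≤ l / 4 → U (pol r θ) = V r θ := by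
  have hlip : LipschitzOnWith (3 * K).toNNReal (fun z : ℂ => V ‖z‖ (Complex.arg z))
      {z | |Complex.arg z| ≤ l / 4} := by
    refine LipschitzOnWith.of_dist_le_mul fun z hz w hw => ?_
    have hK := h.K0
    rw [Real.dist_eq, Real.coe_toNNReal _ (by positivity), Complex.dist_eq]
    refine (h.lipDist hl hl2 (norm_nonneg z) (norm_nonneg w) _ _).trans (le_of_eq ?_)
    rw [coneDist_near hl hl2, pol_arg, pol_arg]
    have := abs_sub (Complex.arg z) (Complex.arg w)
    simp only [mem_setOf_eq] at hz hw
    linarith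
  obtain ⟨U, hU, hUe⟩ := hlip.extend_real
  have hB0 : 0 ≤ B := (abs_nonneg _).trans (hB 0 0)
  refine ⟨(3*K).toNNReal, fun z => max (-B) (min (U z) B), ?_, fun z => ?_, fun r θ hr hθ => ?_⟩
  · exact (hU.min_const B).const_max (-B)
  · rw [abs_le]; exact ⟨le_max_left _ _, max_le (by linarith) (min_le_right _ _)⟩
  · have hpi : l / 4 < Real.pi := by linarith [Real.pi_pos]
    have key : U (pol r θ) = V r θ := by
      rcases hr.eq_or_lt with rfl | hr
      · have : pol 0 θ = 0 := by simp [pol]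
        rw [this, ← hUe (x := 0) (by simp; positivity)]
        simp only [norm_zero]
        exact h.zero_eq _ _
      · have ha := arg_pol (θ := θ) hr (by linarith [(abs_le.mp hθ).1]) (by linarith [(abs_le.mp hθ).2])
        rw [← hUe (x := pol r θ) (by simpa [ha] using hθ)]
        simp only [ha, norm_pol, abs_of_pos hr]
    have hb := abs_le.mp (hB r θ)
    simp only [key]
    rw [min_eq_left hb.2, max_eq_right hb.1]

lemma exists_lift {K : ℝ} {V : ℝ → ℝ → ℝ} (h : Slice (2 * Real.pi) K V) (z0 : ℂ) :
    ∃ (L : NNReal) (H : ℂ → ℝ), LipschitzWith L H ∧ ∀ r θ, 0 ≤ r → H (z0 + pol r θ) = V r θ := by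
  have hK := h.K0
  have h2 : (0:ℝ) < 2 * Real.pi := by positivity
  refine ⟨(3 * K).toNNReal, fun z => V ‖z - z0‖ (Complex.arg (z - z0)),
    LipschitzWith.of_dist_le_mul fun z w => ?_, fun r θ hr => ?_⟩
  · rw [Real.dist_eq, Real.coe_toNNReal _ (by positivity), Complex.dist_eq]
    refine (h.lipDist h2 le_rfl (norm_nonneg _) (norm_nonneg _) _ _).trans (le_of_eq ?_)
    rw [coneDist_two_pi, pol_arg, pol_arg]; congr 2; ring
  · simp only [add_sub_cancel_left]
    have := h.lipDist h2 le_rfl (norm_nonneg (pol r θ)) hr (Complex.arg (pol r θ)) θ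
    rw [coneDist_two_pi, pol_arg, sub_self, norm_zero, mul_zero] at this
    exact sub_eq_zero.mp (abs_nonpos_iff.mp this)

/-- Rotation. -/
def rot (θ0 : ℝ) (V : ℝ → ℝ → ℝ) : ℝ → ℝ → ℝ := fun r θ => V r (θ0 + θ)

lemma Slice.rot {l K : ℝ} {V : ℝ → ℝ → ℝ} (h : Slice l K V) (θ0 : ℝ) : Slice l K (rot θ0 V) := by
  refine ⟨h.K0, fun r θ => ?_, fun r s θ => h.lipr _ _ _, fun r θ φ => ?_⟩
  · unfold _root_.rot; rw [← add_assoc, h.per]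
  · have := h.lipt r (θ0 + θ) (θ0 + φ)
    rwa [add_sub_add_left_eq_sub] at this

lemma gradSq_rot (θ0 : ℝ) (V : ℝ → ℝ → ℝ) (p : ℝ × ℝ) :
    gradSq (rot θ0 V) p = gradSq V (p.1, θ0 + p.2) := by
  unfold gradSq rot
  simp only
  rw [deriv_comp_const_add (fun φ => V p.1 φ)]

lemma jP_rot (lp lm θ0 : ℝ) (V : ℝ → ℝ → ℝ) (p : ℝ × ℝ) :
    jP lp lm (rot θ0 V) p = jP lp lm V (p.1, θ0 + p.2) := by
  unfold jP; rw [gradSq_rot]; rfl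

lemma jP_per {l K : ℝ} {V : ℝ → ℝ → ℝ} (h : Slice l K V) (lp lm r θ : ℝ) :
    jP lp lm V (r, θ + l) = jP lp lm V (r, θ) := by
  have : rot l V = V := by ext r θ; unfold rot; rw [add_comm, h.per]
  rw [add_comm]
  conv_rhs => rw [← this, jP_rot]

lemma J_box {l K R lp lm : ℝ} {V : ℝ → ℝ → ℝ} (h : Slice l K V) (hR : 0 ≤ R) (hl : 0 ≤ l)
    (hlp : 0 ≤ lp) (hlm : 0 ≤ lm) (c θ0 : ℝ) :
    Jfun l lp lm V R = ∫ p in Ioo 0 R ×ˢ Ioo c (c + l), jP lp lm (rot θ0 V) p * p.1 := by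
  have := shift_box (l := l) (R := R) (C := (2 * K^2 + lp + lm) * R) (θ0 := θ0)
    (F := fun p => jP lp lm V p * p.1) hR hl
    ((meas_jP lp lm h).mul measurable_fst) (fun r hr θ => ?_) (fun r θ => ?_) c
  · simp only [jP_rot]; exact this
  · rw [abs_mul, abs_of_nonneg hr.1]
    have := jP_bd hlp hlm h (r, θ)
    have := h.K0
    exact mul_le_mul (by assumption) hr.2 hr.1 (by positivity)
  · simp only [jP_per h]

lemma rot_rot (a b : ℝ) (V : ℝ → ℝ → ℝ) : rot a (rot b V) = rot (b + a) V := by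
  ext r θ; unfold rot; rw [add_assoc]

lemma rot_zero (V : ℝ → ℝ → ℝ) : rot 0 V = V := by ext r θ; unfold rot; rw [zero_add]

lemma J_rot {l K R lp lm : ℝ} {V : ℝ → ℝ → ℝ} (h : Slice l K V) (hR : 0 ≤ R) (hl : 0 ≤ l)
    (hlp : 0 ≤ lp) (hlm : 0 ≤ lm) (θ0 : ℝ) :
    Jfun l lp lm (rot θ0 V) R = Jfun l lp lm V R := by
  rw [J_box h hR hl hlp hlm 0 θ0, J_box (h.rot θ0) hR hl hlp hlm 0 0, rot_zero]

lemma Mini.rot {l R lp lm : ℝ} {V : ℝ → ℝ → ℝ} (h : Mini l R lp lm V) (θ0 : ℝ) :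
    Mini l R lp lm (rot θ0 V) := by
  obtain ⟨K, hK⟩ := h.slice
  obtain ⟨B, hB⟩ := h.bd
  refine ⟨h.l0, h.l2, h.R0, h.lp0, h.lm0, ⟨K, hK.rot θ0⟩, ⟨B, fun r θ => hB _ _⟩,
    fun K' W hW hb => ?_⟩
  rw [J_rot hK h.R0.le h.l0.le h.lp0 h.lm0, ← J_rot hW h.R0.le h.l0.le h.lp0 h.lm0 (-θ0)]
  refine h.min K' _ (hW.rot _) fun θ => ?_
  unfold _root_.rot
  rw [hb]; unfold _root_.rot; ring_nf

/-! ### Part 10 -/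


/-- Open sector. -/
def Sec (l R : ℝ) : Set ℂ := {z | (0 < ‖z‖ ∧ ‖z‖ < R) ∧ |Complex.arg z| < l / 4}

lemma meas_Sec (l R : ℝ) : MeasurableSet (Sec l R) := by
  unfold Sec
  refine ((measurableSet_lt measurable_const measurable_norm).inter
    (measurableSet_lt measurable_norm measurable_const)).inter ?_
  exact measurableSet_lt (continuous_abs.measurable.comp Complex.measurable_arg) measurable_const

lemma sec_iff {l R : ℝ} (hl2 : l ≤ 2 * Real.pi) (p : ℝ × ℝ) (hp : p ∈ polarCoord.target) :
    (0:ℂ) + pol p.1 p.2 ∈ Sec l R ↔ p ∈ Ioo 0 R ×ˢ Ioo (-(l/4)) (l/4) := by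
  rw [polarCoord_target] at hp
  obtain ⟨h1, h2⟩ := hp
  have h1 : 0 < p.1 := h1
  simp only [zero_add, Sec, mem_setOf_eq, norm_pol, arg_pol h1 h2.1 h2.2.le, abs_of_pos h1, abs_lt,
    mem_prod, mem_Ioo]

lemma ball_iff {s0 : ℝ} (z0 : ℂ) (p : ℝ × ℝ) (hp : p ∈ polarCoord.target) :
    z0 + pol p.1 p.2 ∈ Metric.ball z0 s0 ↔ p ∈ Ioo 0 s0 ×ˢ Ioo (-Real.pi) Real.pi := by
  rw [polarCoord_target] at hp
  obtain ⟨h1, h2⟩ := hp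
  have h1 : 0 < p.1 := h1
  simp only [Metric.mem_ball, Complex.dist_eq, add_sub_cancel_left, norm_pol, abs_of_pos h1,
    mem_prod, mem_Ioo]
  exact ⟨fun h => ⟨⟨h1, h⟩, h2⟩, fun h => h.1.2⟩

lemma Sec_box {l R lp lm : ℝ} {v : ℝ → ℝ → ℝ} {U : ℂ → ℝ} {L : NNReal} (hl0 : 0 < l)
    (hl2 : l ≤ 2 * Real.pi)
    (hU : LipschitzWith L U) (hv : ∀ r θ, 0 ≤ r → |θ| ≤ l / 4 → U (pol r θ) = v r θ) :
    ∫ p in Ioo 0 R ×ˢ Ioo (-(l/4)) (l/4), jP lp lm v p * p.1 = ∫ z in Sec l R, jU lp lm U z := by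
  refine J_polar (z0 := 0) lp lm hU (meas_Sec l R) (by linarith [Real.pi_pos])
    (by linarith [Real.pi_pos])
    (sec_iff hl2) fun p hp => ?_
  rw [zero_add, hv _ _ hp.1.1.le (abs_le.mpr ⟨hp.2.1.le, hp.2.2.le⟩)]

lemma ball_box {s0 lp lm : ℝ} {U : ℂ → ℝ} {L : NNReal} (hs : 0 ≤ s0) (hlp : 0 ≤ lp) (hlm : 0 ≤ lm)
    (hU : LipschitzWith L U) (z0 : ℂ) :
    Jfun (2 * Real.pi) lp lm (pb U z0) s0 = ∫ z in Metric.ball z0 s0, jU lp lm U z := by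
  rw [J_box (pb_slice hU z0) hs (by positivity) hlp hlm (-Real.pi) 0, rot_zero]
  have : -Real.pi + 2 * Real.pi = Real.pi := by ring
  rw [this]
  exact J_polar lp lm hU measurableSet_ball le_rfl le_rfl (ball_iff z0) fun p _ => rfl

/-- Good disc. -/
def GoodDisc (l R : ℝ) (z0 : ℂ) (s0 : ℝ) : Prop :=
  ∀ z : ℂ, ‖z - z0‖ ≤ s0 → (0 < ‖z‖ ∧ ‖z‖ < R) ∧ |Complex.arg z| < l / 8

/-- Cone perturbation from planar perturbation. -/
def lift0 (l : ℝ) (H : ℂ → ℝ) : ℝ → ℝ → ℝ := fun r θ => H (pol (max 0 r) (wrap l θ))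

lemma GoodDisc.zero {l R : ℝ} {z0 : ℂ} {s0 : ℝ} (hg : GoodDisc l R z0 s0)
    (hl0 : 0 < l) (hl2 : l ≤ 2 * Real.pi) {H : ℂ → ℝ} (h0 : ∀ z, s0 ≤ ‖z - z0‖ → H z = 0)
    {r x : ℝ} (hr : 0 ≤ r) (hx : |x| ≤ l / 2) (hx2 : l / 8 ≤ |x|) : H (pol r x) = 0 := by
  by_contra hne
  have h1 : ‖pol r x - z0‖ < s0 := by
    by_contra hc; exact hne (h0 _ (not_lt.mp hc))
  obtain ⟨⟨h2, -⟩, h3⟩ := hg _ h1.le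
  rw [norm_pol, abs_of_nonneg hr] at h2
  rw [abs_arg_pol h2 (by linarith)] at h3
  linarith

lemma lift0_slice {l R : ℝ} {z0 : ℂ} {s0 : ℝ} (hg : GoodDisc l R z0 s0)
    (hl0 : 0 < l) (hl2 : l ≤ 2 * Real.pi) {H : ℂ → ℝ} {L : NNReal} (hH : LipschitzWith L H)
    (h0 : ∀ z, s0 ≤ ‖z - z0‖ → H z = 0) : Slice l L (lift0 l H) := by
  refine ⟨L.2, fun r θ => ?_, fun r s θ => ?_, fun r θ φ => ?_⟩
  · have := wrap_add_int hl0 θ 1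
    simp only [Int.cast_one, one_mul] at this
    simp only [lift0, this]
  · refine (lipU hH _ _).trans (mul_le_mul_of_nonneg_left ?_ L.2)
    rw [pol_lipr]
    have := abs_max_sub_max_le_abs r s 0
    rwa [max_comm r, max_comm s] at this
  · unfold lift0
    set ρ := max 0 r
    have hρ0 : 0 ≤ ρ := le_max_left _ _
    have hρ : ρ ≤ |r| := max_le (abs_nonneg _) (le_abs_self _)
    have key : ∀ θ φ : ℝ, |wrap l θ| ≤ |wrap l φ| →
        |H (pol ρ (wrap l θ)) - H (pol ρ (wrap l φ))| ≤ L * (ρ * |θ - φ|) := by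
      intro θ φ hle
      have hx := abs_wrap_le hl0 θ
      have hy := abs_wrap_le hl0 φ
      have hg' : ∀ a b : ℝ, |H (pol ρ a) - H (pol ρ b)| ≤ L * (ρ * |a - b|) := fun a b => by
        refine (lipU hH _ _).trans (mul_le_mul_of_nonneg_left ?_ L.2)
        have := pol_lipt ρ a b
        rwa [abs_of_nonneg hρ0] at this
      have hw : wrap l (wrap l θ - wrap l φ) = wrap l (θ - φ) := by
        rw [← wrap_add_int hl0 (wrap l θ - wrap l φ) (round (θ/l) - round (φ / l))]
        congr 1; unfold wrap; push_cast; ring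
      by_cases hc : |wrap l φ| ≤ l / 4
      · refine (hg' _ _).trans (mul_le_mul_of_nonneg_left (mul_le_mul_of_nonneg_left ?_ hρ0) L.2)
        have h1 : |wrap l θ - wrap l φ| ≤ l / 2 := by
          have := abs_sub (wrap l θ) (wrap l φ); linarith
        rw [← abs_wrap_eq hl0 h1, hw]
        exact abs_wrap_le_abs hl0 _
      · push Not at hc
        rw [hg.zero hl0 hl2 h0 hρ0 hy (by linarith)]
        by_cases hd : l / 8 ≤ |wrap l θ|
        · rw [hg.zero hl0 hl2 h0 hρ0 hx hd]; simp; positivity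
        push Not at hd
        obtain ⟨a, ha, hax⟩ : ∃ a : ℝ, |a| = l / 8 ∧ |wrap l θ - a| = l / 8 - |wrap l θ| := by
          rcases le_total 0 (wrap l θ) with h | h
          · refine ⟨l / 8, abs_of_pos (by positivity), ?_⟩
            rw [abs_of_nonneg h] at hd ⊢
            rw [abs_of_nonpos (by linarith)]; ring
          · refine ⟨-(l / 8), by rw [abs_neg, abs_of_pos (by positivity)], ?_⟩
            rw [abs_of_nonpos h] at hd ⊢
            rw [abs_of_nonneg (by linarith)]; ring
        have h2 := hg' (wrap l θ) a
        rw [hg.zero hl0 hl2 h0 hρ0 (x := a) (by linarith) (by linarith), hax] at h2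
        refine h2.trans (mul_le_mul_of_nonneg_left (mul_le_mul_of_nonneg_left ?_ hρ0) L.2)
        have h3 : |wrap l φ| ≤ |φ - θ + wrap l θ| := by
          have e : φ - θ + wrap l θ = φ + ((-round (θ/l) : ℤ) : ℝ) * l := by
            unfold wrap; push_cast; ring
          have := abs_wrap_le_abs hl0 (φ - θ + wrap l θ)
          rw [e, wrap_add_int hl0] at this
          rwa [e]
        have h4 := abs_add_le (φ - θ) (wrap l θ)
        rw [abs_sub_comm φ θ] at h4
        linarith
    have hfin : |H (pol ρ (wrap l θ)) - H (pol ρ (wrap l φ))| ≤ L * (ρ * |θ - φ|) := by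
      rcases le_total (|wrap l θ|) (|wrap l φ|) with h | h
      · exact key _ _ h
      · rw [abs_sub_comm, abs_sub_comm θ]; exact key _ _ h
    refine hfin.trans ?_
    rw [mul_assoc]
    exact mul_le_mul_of_nonneg_left (mul_le_mul_of_nonneg_right hρ (abs_nonneg _)) L.2

lemma Gam_congr {U W : ℂ → ℝ} {z : ℂ} (h : U =ᶠ[nhds z] W) : Gam U z = Gam W z := by
  unfold Gam; rw [h.fderiv_eq]

lemma ball_sub_Sec {l R : ℝ} {z0 : ℂ} {s0 : ℝ} (hl0 : 0 < l) (hg : GoodDisc l R z0 s0) :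
    Metric.ball z0 s0 ⊆ Sec l R := by
  intro z hz
  rw [Metric.mem_ball, Complex.dist_eq] at hz
  obtain ⟨h1, h2⟩ := hg z hz.le
  exact ⟨h1, by linarith⟩

lemma Sec_fin (l R : ℝ) : volume (Sec l R) < ⊤ := by
  refine (measure_mono (t := Metric.ball 0 R) fun z hz => ?_).trans_lt measure_ball_lt_top
  rw [Metric.mem_ball, dist_zero_right]; exact hz.1.2

lemma energy_diff {l R lp lm K : ℝ} {z0 : ℂ} {s0 : ℝ} (hg : GoodDisc l R z0 s0)
    (hl0 : 0 < l) (hl2 : l ≤ 2 * Real.pi) (hR : 0 ≤ R) (hs : 0 ≤ s0) (hlp : 0 ≤ lp) (hlm : 0 ≤ lm)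
    {H U : ℂ → ℝ} {L L' : NNReal}
    (hH : LipschitzWith L H) (hU : LipschitzWith L' U)
    (h0 : ∀ z, s0 ≤ ‖z - z0‖ → H z = 0) {V : ℝ → ℝ → ℝ} (hV : Slice l K V)
    (hUV : ∀ r θ, 0 ≤ r → |θ| ≤ l / 4 → U (pol r θ) = V r θ) :
    Jfun l lp lm (fun r θ => V r θ + lift0 l H r θ) R - Jfun l lp lm V R =
      Jfun (2 * Real.pi) lp lm (pb (fun z => U z + H z) z0) s0 -
        Jfun (2 * Real.pi) lp lm (pb U z0) s0 := by
  have hU1 : LipschitzWith (L' + L) (fun z => U z + H z) := hU.add hH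
  have hV1 := hV.add (lift0_slice hg hl0 hl2 hH h0)
  set V1 := fun r θ => V r θ + lift0 l H r θ with hV1def
  set U1 := fun z => U z + H z with hU1def
  have hw : ∀ x, |x| ≤ l/4 → wrap l x = x := fun x hx => wrap_self hl0 (by linarith)
  have hUV1 : ∀ r θ, 0 ≤ r → |θ| ≤ l / 4 → U1 (pol r θ) = V1 r θ := fun r θ hr hθ => by
    simp only [hU1def, hV1def, hUV r θ hr hθ, lift0, hw θ hθ, max_eq_right hr]
  have hi : ∀ {v : ℝ → ℝ → ℝ} {k c d : ℝ}, Slice l k v →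
      IntegrableOn (fun p => jP lp lm v p * p.1) (Ioo 0 R ×ˢ Ioo c d) := by
    intro v k c d hv
    refine box_int (C := (2 * k^2 + lp + lm) * R) ((meas_jP lp lm hv).mul measurable_fst)
      fun p hp => ?_
    have := hv.K0
    rw [abs_mul, abs_of_pos hp.1.1]
    exact mul_le_mul (jP_bd hlp hlm hv p) hp.1.2.le hp.1.1.le (by positivity)
  have hiU : ∀ {v : ℂ → ℝ} {k : NNReal} {S : Set ℂ}, volume S < ⊤ → LipschitzWith k v →
      IntegrableOn (jU lp lm v) S := by
    intro v k S hS hv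
    exact Measure.integrableOn_of_bounded hS.ne (meas_jU lp lm hv).aestronglyMeasurable
      (Filter.Eventually.of_forall fun z => jU_bd hlp hlm hv z)
  rw [ball_box hs hlp hlm hU1, ball_box hs hlp hlm hU, J_box hV1 hR hl0.le hlp hlm (-(l/2)) 0,
    J_box hV hR hl0.le hlp hlm (-(l/2)) 0, rot_zero, rot_zero]
  rw [← integral_sub (hi hV1) (hi hV), ← integral_sub (hiU measure_ball_lt_top hU1)
    (hiU measure_ball_lt_top hU)]
  have hsub : Ioo 0 R ×ˢ Ioo (-(l/4)) (l/4) ⊆ Ioo 0 R ×ˢ Ioo (-(l/2)) (-(l/2) + l) :=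
    prod_mono le_rfl (Ioo_subset_Ioo (by linarith) (by linarith))
  rw [setIntegral_eq_of_subset_of_forall_diff_eq_zero
    (measurableSet_Ioo.prod measurableSet_Ioo) hsub, integral_sub (hi hV1) (hi hV),
    Sec_box hl0 hl2 hU1 hUV1, Sec_box hl0 hl2 hU hUV,
    ← integral_sub (hiU (Sec_fin l R) hU1) (hiU (Sec_fin l R) hU)]
  · refine setIntegral_eq_of_subset_of_ae_diff_eq_zero (meas_Sec l R).nullMeasurableSet
      (ball_sub_Sec hl0 hg) ?_
    have hsp : ∀ᵐ z : ℂ, z ∉ Metric.sphere z0 s0 :=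
      measure_eq_zero_iff_ae_notMem.mp (Measure.addHaar_sphere volume z0 s0)
    filter_upwards [hsp] with z hz hz2
    have hgt : s0 < ‖z - z0‖ := by
      have h1 := hz2.2
      rw [Metric.mem_ball, Complex.dist_eq, not_lt] at h1
      rw [Metric.mem_sphere, Complex.dist_eq] at hz
      exact lt_of_le_of_ne h1 (Ne.symm hz)
    have hev : U1 =ᶠ[nhds z] U := by
      have hc : Continuous (fun z : ℂ => ‖z - z0‖) := by fun_prop
      filter_upwards [hc.continuousAt.eventually (lt_mem_nhds hgt)] with w hw
      simp only [hU1def, h0 w hw.le, add_zero]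
    unfold jU
    rw [Gam_congr hev, hev.eq_of_nhds, sub_self]
  · rintro p ⟨⟨hp1, hp2⟩, hp3⟩
    have hp4 : l / 8 < |p.2| := by
      by_contra hc
      push Not at hc
      rw [abs_le] at hc
      exact hp3 ⟨hp1, by linarith [hc.1], by linarith [hc.2]⟩
    have hS : IsOpen {q : ℝ × ℝ | 0 < q.1 ∧ l / 8 < |q.2| ∧ |q.2| < l / 2} := by
      refine (isOpen_lt continuous_const continuous_fst).inter
        ((isOpen_lt continuous_const continuous_snd.abs).inter
          (isOpen_lt continuous_snd.abs continuous_const))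
    have hEq : ∀ q ∈ {q : ℝ × ℝ | 0 < q.1 ∧ l / 8 < |q.2| ∧ |q.2| < l / 2},
        V1 q.1 q.2 = V q.1 q.2 := by
      rintro q ⟨hq1, hq2, hq3⟩
      simp only [hV1def, lift0, max_eq_right hq1.le, wrap_self hl0 hq3]
      rw [hg.zero hl0 hl2 h0 hq1.le hq3.le hq2.le, add_zero]
    have hpS : p ∈ {q : ℝ × ℝ | 0 < q.1 ∧ l / 8 < |q.2| ∧ |q.2| < l / 2} :=
      ⟨hp1.1, hp4, by rw [abs_lt]; exact ⟨hp2.1, by linarith [hp2.2]⟩⟩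
    unfold jP
    rw [gradSq_congr_open hS hEq hpS, hEq p hpS, sub_self]

/-- Minimizers on the cone restrict to planar minimizers on discs. -/
lemma Mini.restrict {l R lp lm K B : ℝ} {V : ℝ → ℝ → ℝ} (h : Mini l R lp lm V) {z0 : ℂ} {s0 : ℝ}
    (hg : GoodDisc l R z0 s0) (hs : 0 < s0) {U : ℂ → ℝ} {L : NNReal}
    (hU : LipschitzWith L U) (hB : ∀ z, |U z| ≤ B)
    (hV : Slice l K V) (hUV : ∀ r θ, 0 ≤ r → |θ| ≤ l / 4 → U (pol r θ) = V r θ) :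
    Mini (2 * Real.pi) s0 lp lm (pb U z0) := by
  refine ⟨by positivity, le_rfl, hs, h.lp0, h.lm0, ⟨L, pb_slice hU z0⟩, ⟨B, fun r θ => hB _⟩,
    fun K' W hW hb => ?_⟩
  have hd := hW.add (pb_slice hU z0).neg
  obtain ⟨K2, hh⟩ := (hd.coneLip (R := s0) (by positivity) le_rfl).slice (by positivity) le_rfl hs.le
  obtain ⟨LH, H, hH, hHe⟩ := exists_lift hh z0
  have h0 : ∀ z, s0 ≤ ‖z - z0‖ → H z = 0 := by
    intro z hz
    have h1 := hHe ‖z - z0‖ (Complex.arg (z - z0)) (norm_nonneg _)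
    rw [pol_arg, add_sub_cancel] at h1
    rw [h1]
    unfold clampFn
    rw [min_eq_right hz, max_eq_right hs.le]
    simp only [hb]; ring
  have hE := energy_diff hg h.l0 h.l2 h.R0.le hs.le h.lp0 h.lm0 hH hU h0 hV hUV
  have hmin := h.min _ _ (hV.add (lift0_slice hg h.l0 h.l2 hH h0)) (fun θ => by
    have : lift0 l H R θ = 0 := by
      unfold lift0
      apply h0
      by_contra hc
      push Not at hc
      have := (hg _ hc.le).1.2
      rw [norm_pol, max_eq_right h.R0.le, abs_of_pos h.R0] at this
      exact lt_irrefl _ this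
    rw [this, add_zero])
  have hJ : Jfun (2 * Real.pi) lp lm (pb (fun z => U z + H z) z0) s0 =
      Jfun (2 * Real.pi) lp lm W s0 := by
    refine Jfun_congr fun r hr θ => ?_
    simp only [pb, hHe r θ hr.1, clampFn_eq hr]; ring
  linarith

/-! ### Part 11 -/


lemma ball_polar {F : ℂ → ℝ} {C s : ℝ} (hF : Continuous F) (hb : ∀ z, |F z| ≤ C) (hs : 0 ≤ s)
    (z0 : ℂ) :
    ∫ z in Metric.ball z0 s, F z =
      ∫ r in (0:ℝ)..s, (∫ θ in (0:ℝ)..(2 * Real.pi), F (z0 + pol r θ)) * r := by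
  have hC : 0 ≤ C := (abs_nonneg _).trans (hb 0)
  rw [← polar_int (F := F) measurableSet_ball le_rfl le_rfl (ball_iff z0)]
  have hm : Measurable (fun p : ℝ × ℝ => F (z0 + pol p.1 p.2) * p.1) :=
    (hF.measurable.comp (meas_pol.const_add z0)).mul measurable_fst
  have hbd : ∀ r ∈ Icc 0 s, ∀ θ, |F (z0 + pol r θ) * r| ≤ C * s := fun r hr θ => by
    rw [abs_mul, abs_of_nonneg hr.1]
    exact mul_le_mul (hb _) hr.2 hr.1 hC
  have := shift_box (l := 2 * Real.pi) (R := s) (C := C * s) (θ0 := 0) hs (by positivity) hm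
    hbd (fun r θ => by
      have := pol_add_two_pi r θ 1
      simp only [Int.cast_one, one_mul] at this
      simp only [this]) (-Real.pi)
  simp only [zero_add] at this
  have e : -Real.pi + 2 * Real.pi = Real.pi := by ring
  rw [e] at this
  rw [← this, fub (C := C * s) hs (by positivity) hm
    fun p hp => hbd p.1 ⟨hp.1.1.le, hp.1.2.le⟩ p.2]
  congr 1; ext r
  simp only
  rw [intervalIntegral.integral_mul_const]

/-- conical kernel -/
def ker (a : ℝ) (z w : ℂ) : ℝ := max 0 (a - ‖w - z‖)

lemma ker_cont (a : ℝ) (z : ℂ) : Continuous (ker a z) := by unfold ker; fun_prop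

lemma ker_nonneg (a : ℝ) (z w : ℂ) : 0 ≤ ker a z w := le_max_left _ _

lemma ker_le {a : ℝ} (ha : 0 ≤ a) (z w : ℂ) : ker a z w ≤ a :=
  max_le ha (by linarith [norm_nonneg (w - z)])

lemma ker_zero {a : ℝ} {z w : ℂ} (h : w ∉ Metric.ball z a) : ker a z w = 0 := by
  rw [Metric.mem_ball, Complex.dist_eq, not_lt] at h
  exact max_eq_left (by linarith)

lemma ker_lip (a : ℝ) (z z' w : ℂ) : |ker a z w - ker a z' w| ≤ ‖z - z'‖ := by
  unfold ker
  rw [max_comm 0, max_comm 0]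
  refine (abs_max_sub_max_le_abs _ _ _).trans ?_
  have := abs_norm_sub_norm_le (w - z') (w - z)
  have e : (w - z') - (w - z) = z - z' := by ring
  rw [e] at this
  have e2 : a - ‖w - z‖ - (a - ‖w - z'‖) = ‖w - z'‖ - ‖w - z‖ := by ring
  rwa [e2]

/-- Mean value property up to radius `a`. -/
def MV (U : ℂ → ℝ) (z : ℂ) (a : ℝ) : Prop :=
  ∀ r ∈ Icc 0 a, Mc (2 * Real.pi) (pb U z) r = 2 * Real.pi * U z

lemma ker_mean {U : ℂ → ℝ} {z : ℂ} {a B : ℝ} (hU : Continuous U) (hB : ∀ z, |U z| ≤ B) (ha : 0 < a)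
    (hm : MV U z a) (k : ℝ) :
    ∫ w in Metric.ball z a, (U w - k) * ker a z w = (U z - k) * (Real.pi * a ^ 3 / 3) := by
  have hB0 : 0 ≤ B := (abs_nonneg _).trans (hB 0)
  rw [ball_polar (F := fun w => (U w - k) * ker a z w) (C := (B + |k|) * a) ((hU.sub continuous_const).mul (ker_cont a z)) ?_ ha.le z]
  · have h1 : ∀ r ∈ uIcc 0 a, (∫ θ in (0:ℝ)..(2 * Real.pi),
        (U (z + pol r θ) - k) * ker a z (z + pol r θ)) * r =
        2 * Real.pi * (U z - k) * (a * r - r ^ 2) := by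
      intro r hr
      rw [uIcc_of_le ha.le] at hr
      have e : ∀ θ, ker a z (z + pol r θ) = a - r := fun θ => by
        unfold ker
        rw [add_sub_cancel_left, norm_pol, abs_of_nonneg hr.1, max_eq_right (by linarith [hr.2])]
      simp only [e]
      have hi : IntervalIntegrable (fun θ => U (z + pol r θ)) volume 0 (2 * Real.pi) := by
        refine Continuous.intervalIntegrable ?_ _ _
        unfold pol; fun_prop
      rw [intervalIntegral.integral_mul_const, intervalIntegral.integral_sub hi (by simp)]
      have := hm r hr
      unfold Mc pb at this
      rw [this]; simp; ring
    rw [intervalIntegral.integral_congr h1, intervalIntegral.integral_const_mul]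
    have h2 : ∫ r in (0:ℝ)..a, (a * r - r ^ 2) = a ^ 3 / 6 := by
      rw [intervalIntegral.integral_sub (by apply Continuous.intervalIntegrable; fun_prop)
        (by apply Continuous.intervalIntegrable; fun_prop), intervalIntegral.integral_const_mul,
        integral_id, integral_pow]
      norm_num; ring
    rw [h2]; ring
  · intro w
    rw [abs_mul, abs_of_nonneg (ker_nonneg _ _ _)]
    refine mul_le_mul ?_ (ker_le ha.le z w) (ker_nonneg _ _ _) (by positivity)
    have := abs_sub (U w) k
    linarith [hB w]

lemma intOn_cont {F : ℂ → ℝ} {C : ℝ} (hF : Continuous F) (hb : ∀ z, |F z| ≤ C) (z : ℂ) (s : ℝ) :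
    IntegrableOn F (Metric.ball z s) :=
  Measure.integrableOn_of_bounded (measure_ball_lt_top).ne hF.aestronglyMeasurable
    (Filter.Eventually.of_forall hb)

lemma ker_mean' {U : ℂ → ℝ} {z z0 : ℂ} {a b B : ℝ} (hU : Continuous U) (hB : ∀ z, |U z| ≤ B)
    (ha : 0 < a) (hm : MV U z a) (k : ℝ) (hsub : Metric.ball z a ⊆ Metric.ball z0 b) :
    ∫ w in Metric.ball z0 b, (U w - k) * ker a z w = (U z - k) * (Real.pi * a ^ 3 / 3) := by
  rw [← ker_mean hU hB ha hm k]
  refine setIntegral_eq_of_subset_of_forall_diff_eq_zero measurableSet_ball hsub fun w hw => ?_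
  rw [ker_zero hw.2, mul_zero]

/-- Interior Lipschitz estimate. -/
lemma lipG {U : ℂ → ℝ} {z z' z0 : ℂ} {a B k I : ℝ} (hU : Continuous U) (hB : ∀ z, |U z| ≤ B)
    (ha : 0 < a) (hm : MV U z a) (hm' : MV U z' a) (hz : ‖z - z0‖ ≤ a) (hz' : ‖z' - z0‖ ≤ a)
    (hI : ∫ w in Metric.ball z0 (2 * a), |U w - k| ≤ I) :
    |U z - U z'| ≤ I / a ^ 3 * ‖z - z'‖ := by
  have hsub : ∀ z, ‖z - z0‖ ≤ a → Metric.ball z a ⊆ Metric.ball z0 (2 * a) := fun z hz =>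
    Metric.ball_subset_ball' (by rw [Complex.dist_eq]; linarith)
  have hB0 : 0 ≤ B := (abs_nonneg _).trans (hB 0)
  have hbk : ∀ w, |U w - k| ≤ B + |k| := fun w => by
    have := abs_sub (U w) k; linarith [hB w]
  have e1 := ker_mean' hU hB ha hm k (hsub z hz)
  have e2 := ker_mean' hU hB ha hm' k (hsub z' hz')
  have hc : ∀ z, Continuous (fun w => (U w - k) * ker a z w) := fun z =>
    (hU.sub continuous_const).mul (ker_cont a z)
  have hi : ∀ z, IntegrableOn (fun w => (U w - k) * ker a z w) (Metric.ball z0 (2 * a)) := fun z =>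
    intOn_cont (C := (B + |k|) * a) (hc z) (fun w => by
      rw [abs_mul, abs_of_nonneg (ker_nonneg _ _ _)]
      exact mul_le_mul (hbk w) (ker_le ha.le z w) (ker_nonneg _ _ _) (by positivity)) _ _
  have e3 : (U z - U z') * (Real.pi * a ^ 3 / 3) =
      ∫ w in Metric.ball z0 (2 * a), ((U w - k) * ker a z w - (U w - k) * ker a z' w) := by
    rw [integral_sub (hi z) (hi z'), e1, e2]; ring
  have e4 : |(U z - U z') * (Real.pi * a ^ 3 / 3)| ≤ I * ‖z - z'‖ := by
    rw [e3]
    refine (abs_integral_le_integral_abs).trans ?_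
    refine le_trans ?_ (mul_le_mul_of_nonneg_right hI (norm_nonneg _))
    rw [← integral_mul_const]
    refine setIntegral_mono ((hi z).sub (hi z')).abs
      ((intOn_cont (hU.sub continuous_const).abs (C := B + |k|) (fun w => by
        rw [abs_abs]; exact hbk w) _ _).mul_const _) fun w => ?_
    simp only [← mul_sub, abs_mul]
    exact mul_le_mul_of_nonneg_left (ker_lip a z z' w) (abs_nonneg _)
  rw [abs_mul, abs_of_pos (show 0 < Real.pi * a ^ 3 / 3 by positivity)] at e4
  have hpi : 1 ≤ Real.pi / 3 := by linarith [Real.pi_gt_three]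
  have h5 : |U z - U z'| * a ^ 3 ≤ I * ‖z - z'‖ := by
    refine le_trans ?_ e4
    refine mul_le_mul_of_nonneg_left ?_ (abs_nonneg _)
    nlinarith [pow_pos ha 3]
  rw [div_mul_eq_mul_div, le_div_iff₀ (by positivity)]
  exact h5

/-- Harnack. -/
lemma harnack {U : ℂ → ℝ} {z z' : ℂ} {a B : ℝ} (hU : Continuous U) (hB : ∀ z, |U z| ≤ B)
    (ha : 0 < a) (hm : MV U z (2 * a)) (hm' : MV U z' a) (hz : ‖z' - z‖ ≤ a)
    (hp : ∀ w ∈ Metric.ball z (2 * a), 0 ≤ U w) : U z' ≤ 8 * U z := by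
  have hsub : Metric.ball z' a ⊆ Metric.ball z (2 * a) :=
    Metric.ball_subset_ball' (by rw [Complex.dist_eq]; linarith)
  have e1 := ker_mean' hU hB ha hm' 0 hsub
  have e2 := ker_mean hU hB (by positivity) hm 0
  have hB0 : 0 ≤ B := (abs_nonneg _).trans (hB 0)
  have hi : ∀ (z1 : ℂ) (b : ℝ), 0 < b →
      IntegrableOn (fun w => (U w - 0) * ker b z1 w) (Metric.ball z (2 * a)) := fun z1 b hb =>
    intOn_cont (F := fun w => (U w - 0) * ker b z1 w) (C := B * b) ((hU.sub continuous_const).mul (ker_cont b z1)) (fun w => by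
      rw [abs_mul, abs_of_nonneg (ker_nonneg _ _ _), sub_zero]
      exact mul_le_mul (hB w) (ker_le hb.le _ w) (ker_nonneg _ _ _) hB0) _ _
  have h3 := setIntegral_mono_on (hi z' a ha) (hi z (2 * a) (by positivity)) measurableSet_ball
    fun w hw => mul_le_mul_of_nonneg_left (show ker a z' w ≤ ker (2 * a) z w by
      unfold ker
      refine max_le_max le_rfl ?_
      have : ‖w - z‖ ≤ ‖w - z'‖ + ‖z' - z‖ := by
        have := norm_add_le (w - z') (z' - z)
        rwa [sub_add_sub_cancel] at this
      linarith) (by rw [sub_zero]; exact hp w hw)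
  rw [e1, e2] at h3
  have : 0 < Real.pi * a ^ 3 / 3 := by positivity
  have h4 : U z' * (Real.pi * a ^ 3 / 3) ≤ (8 * U z) * (Real.pi * a ^ 3 / 3) := by
    nlinarith
  exact le_of_mul_le_mul_right h4 this

/-- Pointwise bound from the integral. -/
lemma point_le {U : ℂ → ℝ} {z : ℂ} {a B I : ℝ} (hU : Continuous U) (hB : ∀ z, |U z| ≤ B)
    (ha : 0 < a) (hm : MV U z a)
    (hI : ∫ w in Metric.ball z a, max (U w) 0 ≤ I) : U z ≤ I / a ^ 2 := by
  have e1 := ker_mean hU hB ha hm 0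
  have hB0 : 0 ≤ B := (abs_nonneg _).trans (hB 0)
  have h2 : ∫ w in Metric.ball z a, (U w - 0) * ker a z w ≤
      ∫ w in Metric.ball z a, max (U w) 0 * a := by
    refine setIntegral_mono
      (intOn_cont (F := fun w => (U w - 0) * ker a z w) (C := B * a) ((hU.sub continuous_const).mul (ker_cont a z)) (fun w => by
      rw [abs_mul, abs_of_nonneg (ker_nonneg _ _ _), sub_zero]
      exact mul_le_mul (hB w) (ker_le ha.le _ w) (ker_nonneg _ _ _) hB0) _ _)
      ((intOn_cont (C := B) (hU.max continuous_const) (fun w => ?_) _ _).mul_const _) fun w => ?_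
    · rw [abs_of_nonneg (le_max_right _ _)]
      exact max_le ((le_abs_self _).trans (hB w)) hB0
    · rw [sub_zero]
      have h3 := ker_nonneg a z w
      have h4 := ker_le ha.le z w
      exact mul_le_mul (le_max_left _ _) h4 h3 (le_max_right _ _)
  rw [integral_mul_const, e1, sub_zero] at h2
  have hI0 : 0 ≤ ∫ w in Metric.ball z a, max (U w) 0 :=
    integral_nonneg fun w => le_max_right _ _
  rw [le_div_iff₀ (by positivity)]
  by_cases hU0 : U z ≤ 0
  · nlinarith [pow_pos ha 2]
  push Not at hU0
  have hpi : 1 ≤ Real.pi / 3 := by linarith [Real.pi_gt_three]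
  have h5 : U z * a ^ 2 * a ≤ I * a := by
    calc U z * a ^ 2 * a = U z * (1 * a ^ 3) := by ring
      _ ≤ U z * (Real.pi / 3 * a ^ 3) := by gcongr
      _ = U z * (Real.pi * a ^ 3 / 3) := by ring
      _ ≤ _ := h2
      _ ≤ I * a := by gcongr
  exact le_of_mul_le_mul_right h5 ha

/-! ### Part 12 -/


/-- A minimizer together with a planar representative on a sector. -/
structure PL (l lp lm : ℝ) (V : ℝ → ℝ → ℝ) (U : ℂ → ℝ) : Prop where
  mini : Mini l 1 lp lm V
  slice : ∃ K, Slice l K V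
  lip : ∃ L : NNReal, LipschitzWith L U
  bd : ∃ B, (∀ z, |U z| ≤ B) ∧ ∀ r θ, |V r θ| ≤ B
  eq : ∀ r θ, 0 ≤ r → |θ| ≤ l / 4 → U (pol r θ) = V r θ

lemma exists_PL {l lp lm : ℝ} {V : ℝ → ℝ → ℝ} (h : Mini l 1 lp lm V) (θ0 : ℝ) :
    ∃ U, PL l lp lm (rot θ0 V) U := by
  have h' := h.rot θ0
  obtain ⟨K, hK⟩ := h'.slice
  obtain ⟨B, hB⟩ := h'.bd
  obtain ⟨L, U, hU, hUB, hUe⟩ := exists_plane hK h.l0 h.l2 hB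
  exact ⟨U, h', ⟨K, hK⟩, ⟨L, hU⟩, ⟨B, hUB, hB⟩, hUe⟩

lemma PL.cont {l lp lm : ℝ} {V : ℝ → ℝ → ℝ} {U : ℂ → ℝ} (h : PL l lp lm V U) : Continuous U := by
  obtain ⟨L, hL⟩ := h.lip
  exact hL.continuous

lemma goodDisc_real {l R ρ s : ℝ} (hl0 : 0 < l) (hl2 : l ≤ 2 * Real.pi) (hρ : 0 < ρ)
    (hs : s ≤ l / 32 * ρ) (hR : ρ + s < R) : GoodDisc l R (ρ : ℂ) s := by
  intro z hz
  have hpi := Real.pi_lt_d2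
  have hc : l / 32 ≤ 1 / 5 := by linarith
  have h1 := abs_norm_sub_norm_le z (ρ : ℂ)
  rw [Complex.norm_real, Real.norm_eq_abs, abs_of_pos hρ, abs_le] at h1
  have hs0 : 0 ≤ s := (norm_nonneg _).trans hz
  have h5 : s ≤ ρ / 5 := by nlinarith
  have hz0 : 4 / 5 * ρ ≤ ‖z‖ := by linarith [h1.1]
  refine ⟨⟨by linarith, by linarith [h1.2]⟩, ?_⟩
  have hp : ‖pol ‖z‖ (Complex.arg z) - pol ρ 0‖ ≤ s := by
    rw [pol_arg]
    have : pol ρ 0 = (ρ : ℂ) := by simp [pol]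
    rwa [this]
  have hpi2 := Complex.abs_arg_le_pi z
  have h6 : 4 / 5 * ρ * |Complex.arg z| ≤ 2 * s := by
    rcases le_total ‖z‖ ρ with h | h
    · have := mul_abs_le_norm_pol ‖z‖ (Complex.arg z) ρ 0 (norm_nonneg _) h (by simpa using hpi2)
      rw [sub_zero] at this
      nlinarith [abs_nonneg (Complex.arg z)]
    · have := mul_abs_le_norm_pol ρ 0 ‖z‖ (Complex.arg z) hρ.le h (by simpa using hpi2)
      rw [norm_sub_rev, zero_sub, abs_neg] at this
      nlinarith [abs_nonneg (Complex.arg z), mul_nonneg hρ.le (abs_nonneg (Complex.arg z))]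
  have h7 : ρ * |Complex.arg z| ≤ ρ * (5 / 64 * l) := by nlinarith
  have := le_of_mul_le_mul_left h7 hρ
  linarith

lemma GoodDisc.sub {l R s0 s : ℝ} {z0 z : ℂ} (h : GoodDisc l R z0 s0) (hs : ‖z - z0‖ + s ≤ s0) :
    GoodDisc l R z s := by
  intro w hw
  refine h w ?_
  have := norm_add_le (w - z) (z - z0)
  rw [sub_add_sub_cancel] at this
  linarith

lemma pb_zero (U : ℂ → ℝ) (z : ℂ) : pb U z 0 0 = U z := by simp [pb, pol]

lemma PL.mv {l lp lm a : ℝ} {V : ℝ → ℝ → ℝ} {U : ℂ → ℝ} (h : PL l lp lm V U) {z : ℂ}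
    (hg : GoodDisc l 1 z a) (ha : 0 < a) (hp : ∀ w, ‖w - z‖ ≤ a → 0 < U w) : MV U z a := by
  obtain ⟨L, hL⟩ := h.lip
  obtain ⟨K, hK⟩ := h.slice
  obtain ⟨B, hB, -⟩ := h.bd
  have hm := h.mini.restrict hg ha hL hB hK h.eq
  intro r hr
  rw [hm.mean ha le_rfl (fun r hr θ => ?_) hr, pb_zero]
  refine hp _ ?_
  rw [add_sub_cancel_left, norm_pol, abs_of_nonneg hr.1]; exact hr.2

lemma ball_le_cone {l R C K s : ℝ} {F : ℂ → ℝ} {G : ℝ → ℝ → ℝ} {z0 : ℂ} (hl0 : 0 < l)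
    (hl2 : l ≤ 2 * Real.pi) (hR : 0 ≤ R) (hF : Continuous F)
    (hFb : ∀ z, |F z| ≤ C) (hF0 : ∀ z, 0 ≤ F z) (hG : Slice l K G) (hG0 : ∀ r θ, 0 ≤ G r θ)
    (hGb : ∀ r θ, |G r θ| ≤ C) (he : ∀ r θ, 0 ≤ r → |θ| ≤ l / 4 → F (pol r θ) = G r θ)
    (hsub : Metric.ball z0 s ⊆ Sec l R) :
    ∫ z in Metric.ball z0 s, F z ≤ ∫ r in (0:ℝ)..R, Mc l G r * r := by
  have hC : 0 ≤ C := (abs_nonneg _).trans (hFb 0)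
  have hiS : IntegrableOn F (Sec l R) :=
    Measure.integrableOn_of_bounded (Sec_fin l R).ne hF.aestronglyMeasurable
      (Filter.Eventually.of_forall hFb)
  have h1 : ∫ z in Metric.ball z0 s, F z ≤ ∫ z in Sec l R, F z :=
    setIntegral_mono_set hiS (Filter.Eventually.of_forall hF0) hsub.eventuallyLE
  refine h1.trans ?_
  have hm : Measurable (fun p : ℝ × ℝ => G p.1 p.2 * p.1) := hG.meas_V.mul measurable_fst
  have hbd : ∀ r ∈ Icc 0 R, ∀ θ, |G r θ * r| ≤ C * R := fun r hr θ => by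
    rw [abs_mul, abs_of_nonneg hr.1]
    exact mul_le_mul (hGb _ _) hr.2 hr.1 hC
  have h2 := shift_box (l := l) (R := R) (C := C * R) (θ0 := 0) hR hl0.le hm hbd
    (fun r θ => by simp only [hG.per]) (-(l/2))
  rw [fub (C := C * R) hR hl0.le hm fun p hp => hbd p.1 ⟨hp.1.1.le, hp.1.2.le⟩ p.2] at h2
  have h3 : ∫ r in (0:ℝ)..R, Mc l G r * r = ∫ r in (0:ℝ)..R, ∫ θ in (0:ℝ)..l, G r θ * r := by
    congr 1; ext r; rw [intervalIntegral.integral_mul_const]; rfl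
  rw [h3, h2]
  simp only [zero_add]
  rw [← polar_int (F := F) (z0 := 0) (meas_Sec l R) (α := -(l/4)) (β := l/4)
    (by linarith [Real.pi_pos]) (by linarith [Real.pi_pos]) (sec_iff hl2)]
  have e : ∫ p in Ioo 0 R ×ˢ Ioo (-(l/4)) (l/4), F (0 + pol p.1 p.2) * p.1 =
      ∫ p in Ioo 0 R ×ˢ Ioo (-(l/4)) (l/4), G p.1 p.2 * p.1 := by
    refine setIntegral_congr_fun (measurableSet_Ioo.prod measurableSet_Ioo) fun p hp => ?_
    simp only [zero_add]
    rw [he _ _ hp.1.1.le (abs_le.mpr ⟨hp.2.1.le, hp.2.2.le⟩)]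
  rw [e]
  refine setIntegral_mono_set (box_int hm fun p hp => hbd p.1 ⟨hp.1.1.le, hp.1.2.le⟩ p.2) ?_
    (HasSubset.Subset.eventuallyLE (prod_mono le_rfl (Ioo_subset_Ioo (by linarith) (by linarith))))
  rw [Filter.EventuallyLE, ae_restrict_iff' (measurableSet_Ioo.prod measurableSet_Ioo)]
  exact Filter.Eventually.of_forall fun p hp => mul_nonneg (hG0 _ _) hp.1.1.le

lemma jU_zero (U : ℂ → ℝ) (z : ℂ) : 0 ≤ jU 0 0 U z := by
  unfold jU; simp [Gam_nonneg]

lemma Dir_J (l R : ℝ) (V : ℝ → ℝ → ℝ) : Dir l V R = Jfun l 0 0 V R := by simp [Jfun, Dir]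

lemma dir_le {l R K s : ℝ} {U : ℂ → ℝ} {L : NNReal} {V : ℝ → ℝ → ℝ} {z0 : ℂ} (hl0 : 0 < l)
    (hl2 : l ≤ 2 * Real.pi) (hR : 0 ≤ R) (hs : 0 ≤ s) (hU : LipschitzWith L U) (hV : Slice l K V)
    (he : ∀ r θ, 0 ≤ r → |θ| ≤ l / 4 → U (pol r θ) = V r θ)
    (hsub : Metric.ball z0 s ⊆ Sec l R) :
    Dir (2 * Real.pi) (pb U z0) s ≤ Dir l V R := by
  rw [Dir_J, Dir_J, ball_box hs le_rfl le_rfl hU, J_box hV hR hl0.le le_rfl le_rfl (-(l/2)) 0,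
    rot_zero]
  have hiS : IntegrableOn (jU 0 0 U) (Sec l R) :=
    Measure.integrableOn_of_bounded (Sec_fin l R).ne (meas_jU 0 0 hU).aestronglyMeasurable
      (Filter.Eventually.of_forall fun z => jU_bd le_rfl le_rfl hU z)
  have h1 : ∫ z in Metric.ball z0 s, jU 0 0 U z ≤ ∫ z in Sec l R, jU 0 0 U z :=
    setIntegral_mono_set hiS (Filter.Eventually.of_forall (jU_zero U)) hsub.eventuallyLE
  refine h1.trans ?_
  rw [← Sec_box hl0 hl2 hU he]
  have hK := hV.K0
  refine setIntegral_mono_set (box_int (C := (2 * K ^ 2 + 0 + 0) * R)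
    ((meas_jP 0 0 hV).mul measurable_fst) fun p hp => ?_) ?_
    (HasSubset.Subset.eventuallyLE (prod_mono le_rfl (Ioo_subset_Ioo (by linarith) (by linarith))))
  · rw [abs_mul, abs_of_pos hp.1.1]
    exact mul_le_mul (jP_bd le_rfl le_rfl hV p) hp.1.2.le hp.1.1.le (by positivity)
  · rw [Filter.EventuallyLE, ae_restrict_iff' (measurableSet_Ioo.prod measurableSet_Ioo)]
    refine Filter.Eventually.of_forall fun p hp => mul_nonneg ?_ hp.1.1.le
    unfold jP; simp [Slice.gradSq_nonneg]

lemma Dir_neg (l R : ℝ) (V : ℝ → ℝ → ℝ) : Dir l (fun r θ => - V r θ) R = Dir l V R := by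
  unfold Dir gradSq
  simp only [deriv.fun_neg, neg_sq]

lemma Dir_pos_le {l R K : ℝ} {V : ℝ → ℝ → ℝ} (hV : Slice l K V) : Dir l (posP V) R ≤ Dir l V R := by
  unfold Dir
  have hK := hV.K0
  have hi : ∀ {W : ℝ → ℝ → ℝ}, Slice l K W → IntegrableOn (fun p => gradSq W p * p.1)
      (Ioo 0 R ×ˢ Ioo 0 l) := fun {W} hW => by
    refine box_int (C := 2 * K ^ 2 * R) (hW.meas_gradSq.mul measurable_fst) fun p hp => ?_
    rw [abs_mul, abs_of_pos hp.1.1, abs_of_nonneg (Slice.gradSq_nonneg _ _)]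
    exact mul_le_mul (hW.gradSq_le p) hp.1.2.le hp.1.1.le (by positivity)
  refine setIntegral_mono_on (hi hV.pos) (hi hV) (measurableSet_Ioo.prod measurableSet_Ioo)
    fun p hp => ?_
  refine mul_le_mul_of_nonneg_right ?_ hp.1.1.le
  rw [hV.gradSq_pos]
  split_ifs
  · exact le_rfl
  · exact Slice.gradSq_nonneg _ _

/-- `ACF` at the vertex. -/
lemma acf_vertex {l lp lm a : ℝ} {V : ℝ → ℝ → ℝ} (h : Mini l 1 lp lm V) (hD : Dir l V 1 ≤ 1)
    (ha : 0 < a) (ha1 : a ≤ 1) :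
    DD l (posP V) a * DD l (posP fun r θ => - V r θ) a ≤ a ^ 4 := by
  obtain ⟨K, hK⟩ := h.slice
  have h1 := h.acf ha ha1 le_rfl
  have h2 : DD l (posP V) 1 ≤ 1 := by
    rw [← DD_eq hK.pos h.l0.le zero_le_one]; exact (Dir_pos_le hK).trans hD
  have h3 : DD l (posP fun r θ => - V r θ) 1 ≤ 1 := by
    rw [← DD_eq hK.neg.pos h.l0.le zero_le_one]
    refine (Dir_pos_le hK.neg).trans ?_
    rwa [Dir_neg]
  have h4 : 0 ≤ DD l (posP V) 1 := DD_nonneg h.l0.le zero_le_one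
  have h5 : 0 ≤ DD l (posP fun r θ => - V r θ) 1 := DD_nonneg h.l0.le zero_le_one
  have h6 : DD l (posP V) 1 * DD l (posP fun r θ => - V r θ) 1 ≤ 1 := by nlinarith
  have h7 : 0 ≤ a ^ 4 := by positivity
  nlinarith

/-- growth constant -/
def cM (l lp lm : ℝ) : ℝ :=
  2 * (2 * Real.pi) + 4 * (lp + lm) * (2 * Real.pi) + 2 * (4 / (l / 64) ^ 2)

lemma zero_growth {l lp lm ρ s : ℝ} {V : ℝ → ℝ → ℝ} {U : ℂ → ℝ} (h : PL l lp lm V U)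
    (hD : Dir l V 1 ≤ 1) (hρ : 0 < ρ) (hρ2 : ρ ≤ 1 / 2) {y : ℂ} (hy : ‖y - ρ‖ ≤ l / 64 * ρ)
    (hUy : U y ≤ 0) (hs : 0 < s) (hs2 : s ≤ l / 64 * ρ) :
    ∫ w in Metric.ball y s, max (U w) 0 ≤ cM l lp lm * s ^ 3 := by
  obtain ⟨L, hL⟩ := h.lip
  obtain ⟨K, hK⟩ := h.slice
  obtain ⟨B, hB, -⟩ := h.bd
  have hl0 := h.mini.l0
  have hl2 := h.mini.l2
  have hpi := Real.pi_lt_d2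
  set S := l / 64 * ρ with hS
  have hS0 : 0 < S := by positivity
  have hS1 : S ≤ ρ / 10 := by rw [hS]; nlinarith
  have hSS : l / 32 * ρ = 2 * S := by rw [hS]; ring
  have hg1 : GoodDisc l 1 y S := (goodDisc_real (s := l / 32 * ρ) hl0 hl2 hρ le_rfl
    (by nlinarith)).sub (by linarith)
  have hg2 : GoodDisc l (2 * ρ) y S := (goodDisc_real (s := l / 32 * ρ) hl0 hl2 hρ le_rfl
    (by nlinarith)).sub (by linarith)
  have hsub := ball_sub_Sec hl0 hg2
  have hm := h.mini.restrict hg1 hS0 hL hB hK h.eq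
  have hLp : LipschitzWith L (fun z => max (U z) 0) := hL.max_const 0
  have hLn : LipschitzWith L (fun z => max (- U z) 0) := hL.neg.max_const 0
  have hp1 : Dir (2 * Real.pi) (pb (fun z => max (U z) 0) y) S ≤ Dir l (posP V) (2 * ρ) :=
    dir_le hl0 hl2 (by positivity) hS0.le hLp hK.pos
      (fun r θ hr hθ => by simp only [h.eq r θ hr hθ, posP]) hsub
  have hp2 : Dir (2 * Real.pi) (pb (fun z => max (- U z) 0) y) S ≤
      Dir l (posP fun r θ => - V r θ) (2 * ρ) :=
    dir_le hl0 hl2 (by positivity) hS0.le hLn hK.neg.pos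
      (fun r θ hr hθ => by simp only [h.eq r θ hr hθ, posP]) hsub
  rw [DD_eq (pb_slice hLp y) (by positivity) hS0.le, DD_eq hK.pos hl0.le (by positivity)] at hp1
  rw [DD_eq (pb_slice hLn y) (by positivity) hS0.le, DD_eq hK.neg.pos hl0.le (by positivity)] at hp2
  have hacf := acf_vertex h.mini hD (a := 2 * ρ) (by positivity) (by linarith)
  have hprod : DD (2 * Real.pi) (posP (pb U y)) S * DD (2 * Real.pi) (posP fun r θ => - pb U y r θ) S
      ≤ (4 / (l / 64) ^ 2) ^ 2 * S ^ 4 := by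
    have e : (4 / (l / 64) ^ 2) ^ 2 * S ^ 4 = (2 * ρ) ^ 4 := by
      rw [hS]; field_simp; norm_num
    rw [e]
    refine le_trans ?_ hacf
    exact mul_le_mul hp1 hp2 (DD_nonneg (by positivity) hS0.le) (DD_nonneg hl0.le (by positivity))
  have hG : ∀ r ∈ Ioc 0 s, Mc (2 * Real.pi) (pb (fun z => max (U z) 0) y) r ≤ cM l lp lm * r := by
    intro r hr
    have := hm.G1 (κ := 4 / (l / 64) ^ 2) (by positivity) hprod hr.1 (hr.2.trans hs2)
    have e : posP (pb U y) 0 0 = 0 := by unfold posP; rw [pb_zero]; exact max_eq_right hUy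
    rw [e, mul_zero, sub_zero] at this
    exact (le_abs_self _).trans this
  have hM0 : 0 ≤ cM l lp lm := by
    have := h.mini.lp0; have := h.mini.lm0
    unfold cM; positivity
  have hc : Continuous (Mc (2 * Real.pi) (pb (fun z => max (U z) 0) y)) :=
    (pb_slice hLp y).contMc (by positivity)
  rw [ball_polar (C := B) (hLp.continuous) (fun z => ?_) hs.le]
  · have h3 : ∫ r in (0:ℝ)..s, Mc (2 * Real.pi) (pb (fun z => max (U z) 0) y) r * r ≤
        ∫ r in (0:ℝ)..s, cM l lp lm * r ^ 2 := by
      refine intervalIntegral.integral_mono_on_of_le_Ioo hs.le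
        ((hc.mul continuous_id).intervalIntegrable _ _)
        ((by fun_prop : Continuous fun r : ℝ => cM l lp lm * r ^ 2).intervalIntegrable _ _)
        fun r hr => ?_
      have := hG r ⟨hr.1, hr.2.le⟩
      nlinarith [hr.1]
    refine h3.trans ?_
    rw [intervalIntegral.integral_const_mul, integral_pow]
    have : 0 ≤ cM l lp lm * s ^ 3 := by positivity
    norm_num
    linarith
  · rw [abs_of_nonneg (le_max_right _ _)]
    exact max_le ((le_abs_self _).trans (hB z)) ((abs_nonneg _).trans (hB z))

/-! ### Part 13 -/


/-- Harnack chain constant -/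
def HC : ℝ := 8 ^ 512

lemma HC_one : 1 ≤ HC := one_le_pow₀ (by norm_num)

lemma PL.pos_of {l lp lm a T : ℝ} {V : ℝ → ℝ → ℝ} {U : ℂ → ℝ} (h : PL l lp lm V U) {z : ℂ}
    (hg : GoodDisc l 1 z a) (hT : ∀ r, 0 ≤ r → r < T → ∀ θ, 0 < V r θ) (hz : ‖z‖ + a < T) :
    ∀ w, ‖w - z‖ ≤ a → 0 < U w := by
  intro w hw
  have h1 := (hg w hw).2
  have hl0 := h.mini.l0
  rw [← pol_arg w, h.eq _ _ (norm_nonneg _) (by linarith)]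
  refine hT _ (norm_nonneg _) ?_ _
  have := norm_add_le (w - z) z
  rw [sub_add_cancel] at this
  linarith

lemma near_pt {l lp lm T : ℝ} {V : ℝ → ℝ → ℝ} {U : ℂ → ℝ} (h : PL l lp lm V U)
    (hD : Dir l V 1 ≤ 1) (hT : 0 < T) (hT2 : T ≤ 1 / 2)
    (hpos : ∀ r, 0 ≤ r → r < T → ∀ θ, 0 < V r θ) (hy : V T 0 ≤ 0) :
    V ((1 - l / 128) * T) 0 ≤ cM l lp lm * l * T := by
  have hl0 := h.mini.l0
  have hl2 := h.mini.l2
  have hpi := Real.pi_lt_d2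
  obtain ⟨B, hB, -⟩ := h.bd
  have hc : l / 128 ≤ 1 / 20 := by linarith
  have hlT : 0 < l * T := by positivity
  have hlT2 : l * T ≤ 128 / 20 * T := by nlinarith
  have e0 : (1 - l / 128) * T = T - l * T / 128 := by ring
  set r0 := (1 - l / 128) * T with hr0
  have hr0p : 0 < r0 := by linarith
  have hpr : ∀ r : ℝ, pol r 0 = (r : ℂ) := fun r => by simp [pol]
  have hUT : U (T : ℂ) ≤ 0 := by
    rw [← hpr, h.eq _ _ hT.le (by simp; positivity)]; exact hy
  have hz := zero_growth h hD hT hT2 (y := (T : ℂ)) (s := l / 64 * T) (by simp; positivity) hUT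
    (by positivity) le_rfl
  have ha : 0 < l / 512 * T := by positivity
  have hg : GoodDisc l 1 (r0 : ℂ) (l / 512 * T) :=
    goodDisc_real hl0 hl2 hr0p (by nlinarith) (by nlinarith)
  have hn : ‖(r0 : ℂ)‖ = r0 := by simp [abs_of_pos hr0p]
  have hp := h.pos_of hg hpos (by rw [hn]; linarith)
  have hmv := h.mv hg ha hp
  have hsub : Metric.ball (r0 : ℂ) (l / 512 * T) ⊆ Metric.ball (T : ℂ) (l / 64 * T) := by
    refine Metric.ball_subset_ball' ?_
    rw [Complex.dist_eq, ← Complex.ofReal_sub, Complex.norm_real, Real.norm_eq_abs,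
      abs_of_neg (by linarith)]
    linarith
  have hi : ∫ w in Metric.ball (r0 : ℂ) (l / 512 * T), max (U w) 0 ≤
      cM l lp lm * (l / 64 * T) ^ 3 := by
    refine le_trans (setIntegral_mono_set ?_ ?_ hsub.eventuallyLE) hz
    · exact intOn_cont (F := fun w => max (U w) 0) (C := B) (h.cont.max continuous_const)
        (fun w => by
          rw [abs_of_nonneg (le_max_right _ _)]
          exact max_le ((le_abs_self _).trans (hB w)) ((abs_nonneg _).trans (hB w))) _ _
    · exact Filter.Eventually.of_forall fun w => le_max_right _ _
  have := point_le h.cont hB ha hmv hi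
  rw [← hpr, h.eq _ _ hr0p.le (by simp; positivity)] at this
  refine this.trans (le_of_eq ?_)
  field_simp
  norm_num

lemma harnack_step {l lp lm T δ : ℝ} {V : ℝ → ℝ → ℝ} {U : ℂ → ℝ} (h : PL l lp lm V U)
    (hT : 0 < T) (hT2 : T ≤ 1 / 2)
    (hpos : ∀ r, 0 ≤ r → r < T → ∀ θ, 0 < V r θ) (hδ : |δ| ≤ l / 512) :
    V ((1 - l / 128) * T) δ ≤ 8 * V ((1 - l / 128) * T) 0 := by
  have hl0 := h.mini.l0
  have hl2 := h.mini.l2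
  have hpi := Real.pi_lt_d2
  obtain ⟨B, hB, -⟩ := h.bd
  have hlT : 0 < l * T := by positivity
  have hlT2 : l * T ≤ 128 / 20 * T := by nlinarith
  have e0 : (1 - l / 128) * T = T - l * T / 128 := by ring
  set r0 := (1 - l / 128) * T with hr0
  have hr0p : 0 < r0 := by linarith
  have hpr : ∀ r : ℝ, pol r 0 = (r : ℂ) := fun r => by simp [pol]
  have ha : 0 < l / 512 * T := by positivity
  have hg : GoodDisc l 1 (pol r0 0) (2 * (l / 512 * T)) := by
    rw [hpr]
    exact goodDisc_real hl0 hl2 hr0p (by nlinarith) (by nlinarith)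
  have hn : ‖pol r0 0‖ = r0 := by rw [norm_pol, abs_of_pos hr0p]
  have hp := h.pos_of hg hpos (by rw [hn]; linarith)
  have hmv := h.mv hg (by positivity) hp
  have hd : ‖pol r0 δ - pol r0 0‖ ≤ l / 512 * T := by
    refine (pol_lipt _ _ _).trans ?_
    rw [abs_of_pos hr0p, sub_zero, mul_comm]
    exact mul_le_mul hδ (by linarith) hr0p.le (by positivity)
  have hg' : GoodDisc l 1 (pol r0 δ) (l / 512 * T) := hg.sub (by linarith)
  have hmv' := h.mv hg' ha fun w hw => hp w (by
    have := norm_add_le (w - pol r0 δ) (pol r0 δ - pol r0 0)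
    rw [sub_add_sub_cancel] at this
    linarith)
  have := harnack h.cont hB ha hmv hmv' hd fun w hw => (hp w (by
    rw [Metric.mem_ball, Complex.dist_eq] at hw; exact hw.le)).le
  rwa [h.eq _ _ hr0p.le (by linarith), h.eq _ _ hr0p.le (by simp; positivity)] at this

lemma Dir_rot {l lp lm : ℝ} {V : ℝ → ℝ → ℝ} (h : Mini l 1 lp lm V) (θ0 : ℝ) :
    Dir l (rot θ0 V) 1 = Dir l V 1 := by
  obtain ⟨K, hK⟩ := h.slice
  rw [Dir_J, Dir_J, J_rot hK zero_le_one h.l0.le le_rfl le_rfl]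

lemma harnack_chain {l lp lm T : ℝ} {V : ℝ → ℝ → ℝ} (h : Mini l 1 lp lm V)
    (hT : 0 < T) (hT2 : T ≤ 1 / 2)
    (hpos : ∀ r, 0 ≤ r → r < T → ∀ θ, 0 < V r θ) (θ0 θ : ℝ) :
    V ((1 - l / 128) * T) θ ≤ HC * V ((1 - l / 128) * T) θ0 := by
  obtain ⟨K, hK⟩ := h.slice
  have hl0 := h.l0
  have step : ∀ θ1 δ : ℝ, |δ| ≤ l / 512 →
      V ((1 - l / 128) * T) (θ1 + δ) ≤ 8 * V ((1 - l / 128) * T) θ1 := by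
    intro θ1 δ hδ
    obtain ⟨U, hU⟩ := exists_PL h θ1
    have := harnack_step hU hT hT2 (fun r h1 h2 φ => hpos r h1 h2 _) hδ
    unfold rot at this
    rwa [add_zero] at this
  have hch : ∀ (δ : ℝ), |δ| ≤ l / 512 → ∀ n : ℕ,
      V ((1 - l / 128) * T) (θ0 + n * δ) ≤ 8 ^ n * V ((1 - l / 128) * T) θ0 := by
    intro δ hδ n
    induction n with
    | zero => simp
    | succ n ih =>
      have := step (θ0 + n * δ) δ hδ
      have e : θ0 + ((n + 1 : ℕ) : ℝ) * δ = θ0 + n * δ + δ := by push_cast; ring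
      rw [e, pow_succ]
      linarith
  have e2 : V ((1 - l / 128) * T) θ = V ((1 - l / 128) * T) (toIcoMod hl0 θ0 θ) := by
    have := toIcoMod_add_toIcoDiv_zsmul hl0 θ0 θ
    conv_lhs => rw [← this, zsmul_eq_mul]
    exact per_int (hK.per _) _ _
  have hm := toIcoMod_mem_Ico hl0 θ0 θ
  have := hch ((toIcoMod hl0 θ0 θ - θ0) / 512) (by
    rw [abs_of_nonneg (by linarith [hm.1])]; linarith [hm.2]) 512
  rw [e2]
  unfold HC
  convert this using 2
  push_cast
  ring

attribute [irreducible] HC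

/-- sup-constant -/
def cS (l lp lm : ℝ) : ℝ := HC * (cM l lp lm * l)

lemma key_sup {l lp lm T θy : ℝ} {V : ℝ → ℝ → ℝ} (h : Mini l 1 lp lm V)
    (hD : Dir l V 1 ≤ 1) (hT : 0 < T) (hT2 : T ≤ 1 / 2)
    (hpos : ∀ r, 0 ≤ r → r < T → ∀ θ, 0 < V r θ) (hy : V T θy ≤ 0) (θ : ℝ) :
    V ((1 - l / 128) * T) θ ≤ cS l lp lm * T := by
  obtain ⟨U, hU⟩ := exists_PL h θy
  have h1 := near_pt hU (by rw [Dir_rot h]; exact hD) hT hT2 (fun r h1 h2 φ => hpos r h1 h2 _)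
    (by unfold rot; rwa [add_zero])
  unfold rot at h1
  rw [add_zero] at h1
  have h2 := harnack_chain h hT hT2 hpos θy θ
  have := HC_one
  unfold cS
  nlinarith

lemma Slice.exists_T0 {l K : ℝ} {V : ℝ → ℝ → ℝ} (h : Slice l K V) (hl : 0 < l) {p : ℝ × ℝ}
    (hp : p.1 ∈ Icc (0:ℝ) (1/2)) (hV : V p.1 p.2 ≤ 0) :
    ∃ T θy, 0 ≤ T ∧ T ≤ 1 / 2 ∧ V T θy ≤ 0 ∧ ∀ r, 0 ≤ r → r < T → ∀ θ, 0 < V r θ := by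
  have hmod : ∀ r θ, ∃ φ ∈ Icc 0 l, V r θ = V r φ := fun r θ => by
    have hm := toIcoMod_mem_Ico hl 0 θ
    refine ⟨toIcoMod hl 0 θ, ⟨hm.1, by linarith [hm.2]⟩, ?_⟩
    have := toIcoMod_add_toIcoDiv_zsmul hl 0 θ
    conv_lhs => rw [← this, zsmul_eq_mul]
    exact per_int (h.per _) _ _
  have hcomp : IsCompact ((Icc (0:ℝ) (1/2) ×ˢ Icc 0 l) ∩ {p : ℝ × ℝ | V p.1 p.2 ≤ 0}) :=
    (isCompact_Icc.prod isCompact_Icc).inter_right (isClosed_le h.cont continuous_const)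
  obtain ⟨φ, hφ, e⟩ := hmod p.1 p.2
  obtain ⟨q, hq, hmin⟩ := hcomp.exists_isMinOn ⟨(p.1, φ), ⟨hp, hφ⟩, by
    show V p.1 φ ≤ 0; rwa [← e]⟩ continuous_fst.continuousOn
  refine ⟨q.1, q.2, hq.1.1.1, hq.1.1.2, hq.2, fun r h0 hr θ => ?_⟩
  by_contra hcon
  obtain ⟨φ, hφ, e⟩ := hmod r θ
  have := hmin (a := (r, φ)) ⟨⟨⟨h0, hr.le.trans hq.1.1.2⟩, hφ⟩, by
    show V r φ ≤ 0; rw [← e]; exact not_lt.mp hcon⟩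
  exact absurd this (not_le.mpr hr)

/-! ### Part 14 -/


/-- Data of the first non-positive radius. -/
structure TD (V : ℝ → ℝ → ℝ) (T : ℝ) : Prop where
  nn : 0 ≤ T
  half : T ≤ 1 / 2
  ex : ∃ θ, V T θ ≤ 0
  pos : ∀ r, 0 ≤ r → r < T → ∀ θ, 0 < V r θ

lemma TD.rot {V : ℝ → ℝ → ℝ} {T : ℝ} (h : TD V T) (θ0 : ℝ) : TD (rot θ0 V) T := by
  obtain ⟨θ, hθ⟩ := h.ex
  refine ⟨h.nn, h.half, ⟨θ - θ0, ?_⟩, fun r h1 h2 φ => h.pos r h1 h2 _⟩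
  unfold _root_.rot
  rwa [add_sub_cancel]

lemma cM_nonneg {l lp lm : ℝ} (hlp : 0 ≤ lp) (hlm : 0 ≤ lm) : 0 ≤ cM l lp lm := by
  have := Real.pi_pos
  unfold cM; positivity

lemma cS_nonneg {l lp lm : ℝ} (hl : 0 ≤ l) (hlp : 0 ≤ lp) (hlm : 0 ≤ lm) : 0 ≤ cS l lp lm := by
  have h1 := cM_nonneg (l := l) hlp hlm
  have h2 := HC_one
  unfold cS
  exact mul_nonneg (by linarith) (mul_nonneg h1 hl)

lemma Mc_mono {l K K' r : ℝ} {F G : ℝ → ℝ → ℝ} (hF : Slice l K F) (hG : Slice l K' G) (hl : 0 ≤ l)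
    (h : ∀ θ, F r θ ≤ G r θ) : Mc l F r ≤ Mc l G r := by
  unfold Mc
  exact intervalIntegral.integral_mono_on hl
    ((hF.lipT r).continuous.intervalIntegrable _ _) ((hG.lipT r).continuous.intervalIntegrable _ _)
    fun θ _ => h θ

lemma Mc_le_const {l K r C : ℝ} {F : ℝ → ℝ → ℝ} (hF : Slice l K F) (hl : 0 ≤ l)
    (h : ∀ θ, F r θ ≤ C) : Mc l F r ≤ l * C := by
  unfold Mc
  refine (intervalIntegral.integral_mono_on (g := fun _ => C) hl
    ((hF.lipT r).continuous.intervalIntegrable _ _) (by simp) fun θ _ => h θ).trans ?_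
  simp

section
variable {l lp lm T : ℝ} {V : ℝ → ℝ → ℝ}

lemma vertex_le (h : Mini l 1 lp lm V) (hD : Dir l V 1 ≤ 1) (ht : TD V T) (hT : 0 < T) :
    V 0 0 ≤ cS l lp lm * T := by
  obtain ⟨K, hK⟩ := h.slice
  obtain ⟨θy, hy⟩ := ht.ex
  have hl0 := h.l0
  have hpi := Real.pi_lt_d2
  have hl2 := h.l2
  have hlT : 0 < l * T := by positivity
  have e0 : (1 - l / 128) * T = T - l * T / 128 := by ring
  have h0 : 0 < (1 - l / 128) * T := mul_pos (by linarith) hT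
  have h1 := h.mean (T := (1 - l / 128) * T) (r := (1 - l / 128) * T) h0
    (by linarith [ht.half]) (fun r hr θ => ht.pos r hr.1 (by linarith [hr.2]) θ) ⟨h0.le, le_rfl⟩
  have h2 := Mc_le_const hK hl0.le (key_sup h hD hT ht.half ht.pos hy)
  rw [h1] at h2
  exact le_of_mul_le_mul_left h2 hl0

lemma vertex_pos_le (h : Mini l 1 lp lm V) (hD : Dir l V 1 ≤ 1) (ht : TD V T) :
    posP V 0 0 ≤ cS l lp lm * T := by
  obtain ⟨K, hK⟩ := h.slice
  have hc := cS_nonneg h.l0.le h.lp0 h.lm0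
  refine max_le ?_ (mul_nonneg hc ht.nn)
  rcases ht.nn.eq_or_lt with h0 | h0
  · obtain ⟨θ, hθ⟩ := ht.ex
    rw [← h0] at hθ ⊢
    rw [hK.zero_eq 0 θ]
    linarith
  · exact vertex_le h hD ht h0

lemma W_le (h : Mini l 1 lp lm V) (hD : Dir l V 1 ≤ 1) (ht : TD V T) {a : ℝ} (ha : 0 < a)
    (haT : a ≤ T / 2) :
    Mc l (sqf fun r θ => V r θ - V 0 0) a ≤ 4 * l * cS l lp lm ^ 2 * a ^ 2 := by
  obtain ⟨K, hK⟩ := h.slice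
  obtain ⟨B, hB⟩ := h.bd
  obtain ⟨θy, hy⟩ := ht.ex
  have hl0 := h.l0
  have hpi := Real.pi_lt_d2
  have hl2 := h.l2
  have hT : 0 < T := by linarith
  have hlT : 0 < l * T := by positivity
  have hlT2 : l * T ≤ 64 * T := by nlinarith
  have e0 : (1 - l / 128) * T = T - l * T / 128 := by ring
  have hs := key_sup h hD hT ht.half ht.pos hy
  set r0 := (1 - l / 128) * T with hr0
  have hv := vertex_le h hD ht hT
  have hv0 := ht.pos 0 le_rfl hT 0
  have hc := cS_nonneg h.l0.le h.lp0 h.lm0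
  have h1 := h.W2mono (T := r0) (a := a) (b := r0) (by linarith [ht.half])
    (fun r hr θ => ht.pos r hr.1 (by linarith [hr.2]) θ) ha (by linarith) le_rfl
  have hsq : ∀ θ, (sqf fun r θ => V r θ - V 0 0) r0 θ ≤ (cS l lp lm * T) ^ 2 := fun θ => by
    have h2 := hs θ
    have h3 := ht.pos r0 (by linarith) (by linarith) θ
    unfold sqf
    have : |V r0 θ - V 0 0| ≤ cS l lp lm * T := abs_le.mpr ⟨by linarith, by linarith⟩
    rw [← sq]
    exact sq_le_sq' (by linarith [abs_le.mp this]) (by linarith [abs_le.mp this])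
  have hle : Mc l (sqf fun r θ => V r θ - V 0 0) r0 ≤ l * (cS l lp lm * T) ^ 2 := by
    unfold Mc
    refine (intervalIntegral.integral_mono_on (g := fun _ => (cS l lp lm * T) ^ 2) hl0.le
      (Continuous.intervalIntegrable ?_ _ _) (by simp) fun θ _ => hsq θ).trans ?_
    · unfold sqf
      have := (hK.lipT r0).continuous
      fun_prop
    · simp
  have hr0p : 0 < r0 := by linarith
  have hTr : T ≤ 2 * r0 := by linarith
  have hT4 : T ^ 2 ≤ 4 * r0 ^ 2 := by nlinarith
  have h5 : Mc l (sqf fun r θ => V r θ - V 0 0) a * r0 ^ 2 ≤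
      4 * l * cS l lp lm ^ 2 * a ^ 2 * r0 ^ 2 := by
    refine h1.trans ?_
    calc _ ≤ l * (cS l lp lm * T) ^ 2 * a ^ 2 := mul_le_mul_of_nonneg_right hle (by positivity)
      _ = l * cS l lp lm ^ 2 * a ^ 2 * T ^ 2 := by ring
      _ ≤ l * cS l lp lm ^ 2 * a ^ 2 * (4 * r0 ^ 2) := mul_le_mul_of_nonneg_left hT4 (by positivity)
      _ = _ := by ring
  exact le_of_mul_le_mul_right h5 (by positivity)

lemma int_bound {F : ℝ → ℝ} {ρ D : ℝ} (hF : Continuous F) (hρ : 0 < ρ) (hD : 0 ≤ D)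
    (h : ∀ r, 0 < r → r ≤ 2 * ρ → F r ≤ D * ρ) :
    ∫ r in (0:ℝ)..(2 * ρ), F r * r ≤ 4 * D * ρ ^ 3 := by
  have : ∫ r in (0:ℝ)..(2 * ρ), F r * r ≤ ∫ r in (0:ℝ)..(2 * ρ), D * ρ * (2 * ρ) := by
    refine intervalIntegral.integral_mono_on_of_le_Ioo (by positivity)
      ((hF.mul continuous_id).intervalIntegrable _ _) (by simp) fun r hr => ?_
    exact mul_le_mul (h r hr.1 hr.2.le) hr.2.le hr.1.le (by positivity)
  refine this.trans (le_of_eq ?_)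
  simp
  ring

/-- constants for the gradient bound -/
def cB1 (l lp lm : ℝ) : ℝ := 2 * (2 * l + 4 * (lp + lm) * l + 2) + 4 * l * cS l lp lm
def cB2 (l lp lm : ℝ) : ℝ := l + 16 * l * cS l lp lm ^ 2
def cN (l lp lm : ℝ) : ℝ :=
  512 * cM l lp lm + 4 * cB1 l lp lm / (l / 256) ^ 3 + 4 * cB2 l lp lm / (l / 256) ^ 3

lemma Mc_pos_le (h : Mini l 1 lp lm V) (hD : Dir l V 1 ≤ 1) (ht : TD V T) {ρ r : ℝ}
    (hT : T ≤ 4 * ρ) (hr : 0 < r) (hr2 : r ≤ 2 * ρ) (hρ2 : ρ ≤ 1 / 2) :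
    Mc l (posP V) r ≤ cB1 l lp lm * ρ := by
  have hlp := h.lp0
  have hlm := h.lm0
  have hl0 := h.l0
  have h1 := h.G1 (κ := 1) (s := r) zero_le_one (by
    have := acf_vertex h hD zero_lt_one le_rfl
    simpa using this) hr (by linarith)
  have h2 := vertex_pos_le h hD ht
  have hc := cS_nonneg h.l0.le h.lp0 h.lm0
  have h3 : l * posP V 0 0 ≤ l * (cS l lp lm * (4 * ρ)) :=
    mul_le_mul_of_nonneg_left (h2.trans (mul_le_mul_of_nonneg_left hT hc)) hl0.le
  have h4 : (2 * l + 4 * (lp + lm) * l + 2 * 1) * r ≤ (2 * l + 4 * (lp + lm) * l + 2 * 1) * (2 * ρ) :=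
    mul_le_mul_of_nonneg_left hr2 (by positivity)
  have := (abs_le.mp h1).2
  unfold cB1
  linarith

lemma Slice.abs {K : ℝ} (h : Slice l K V) : Slice l K (fun r θ => |V r θ|) :=
  ⟨h.K0, fun r θ => by simp only [h.per],
    fun r s θ => (abs_abs_sub_abs_le_abs_sub _ _).trans (h.lipr r s θ),
    fun r θ φ => (abs_abs_sub_abs_le_abs_sub _ _).trans (h.lipt r θ φ)⟩

lemma Mc_abs_le (h : Mini l 1 lp lm V) (hD : Dir l V 1 ≤ 1) (ht : TD V T) {ρ r : ℝ}
    (hT : 4 * ρ < T) (hr : 0 < r) (hr2 : r ≤ 2 * ρ) :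
    Mc l (fun r θ => |V r θ - V 0 0|) r ≤ cB2 l lp lm * ρ := by
  obtain ⟨K, hK⟩ := h.slice
  have hl0 := h.l0
  have hρ : 0 < ρ := by linarith
  have hW := W_le h hD ht hr (by linarith)
  have hcV := (hK.lipT r).continuous
  have h1 : Mc l (fun r θ => |V r θ - V 0 0|) r ≤
      ∫ θ in (0:ℝ)..l, (ρ + (sqf fun r θ => V r θ - V 0 0) r θ * ρ⁻¹) := by
    unfold Mc
    refine intervalIntegral.integral_mono_on hl0.le (Continuous.intervalIntegrable (by fun_prop) _ _)
      (Continuous.intervalIntegrable (by unfold sqf; fun_prop) _ _) fun θ _ => ?_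
    unfold sqf
    set x := V r θ - V 0 0
    rw [← abs_mul_abs_self x]
    have : |x| * ρ ≤ (ρ + |x| * |x| * ρ⁻¹) * ρ := by
      have : (ρ + |x| * |x| * ρ⁻¹) * ρ = ρ ^ 2 + |x| ^ 2 := by field_simp
      rw [this]
      nlinarith [sq_nonneg (|x| - ρ), sq_nonneg (|x|), sq_nonneg ρ]
    exact le_of_mul_le_mul_right this hρ
  rw [intervalIntegral.integral_add (by simp)
    (Continuous.intervalIntegrable (by unfold sqf; fun_prop) _ _),
    intervalIntegral.integral_mul_const] at h1
  simp only [intervalIntegral.integral_const, sub_zero, smul_eq_mul] at h1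
  refine h1.trans ?_
  have h2 : (∫ θ in (0:ℝ)..l, (sqf fun r θ => V r θ - V 0 0) r θ) * ρ⁻¹ ≤
      4 * l * cS l lp lm ^ 2 * (2 * ρ) ^ 2 * ρ⁻¹ := by
    refine mul_le_mul_of_nonneg_right (le_trans hW ?_) (by positivity)
    refine mul_le_mul_of_nonneg_left ?_ (by positivity)
    exact pow_le_pow_left₀ hr.le hr2 2
  have e : 4 * l * cS l lp lm ^ 2 * (2 * ρ) ^ 2 * ρ⁻¹ = 16 * l * cS l lp lm ^ 2 * ρ := by
    field_simp; ring
  unfold cB2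
  linarith

lemma lip_near {U : ℂ → ℝ} (h : PL l lp lm V U) {z0 : ℂ} {a k n : ℝ} (ha : 0 < a)
    (hg : GoodDisc l 1 z0 (2 * a)) (hp : ∀ w, ‖w - z0‖ ≤ 2 * a → 0 < U w)
    (hI : ∫ w in Metric.ball z0 (2 * a), |U w - k| ≤ n * a ^ 3) :
    ∀ z z', ‖z - z0‖ ≤ a → ‖z' - z0‖ ≤ a → |U z - U z'| ≤ n * ‖z - z'‖ := by
  obtain ⟨B, hB, -⟩ := h.bd
  have hmv : ∀ z, ‖z - z0‖ ≤ a → MV U z a := fun z hz =>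
    h.mv (hg.sub (by linarith)) ha fun w hw => hp w (by
      have := norm_add_le (w - z) (z - z0)
      rw [sub_add_sub_cancel] at this
      linarith)
  intro z z' hz hz'
  have := lipG h.cont hB ha (hmv z hz) (hmv z' hz') hz hz' hI
  rwa [mul_div_assoc, div_self (by positivity), mul_one] at this

lemma grad_main {U : ℂ → ℝ} (h : PL l lp lm V U) (hD : Dir l V 1 ≤ 1) (ht : TD V T) {ρ : ℝ}
    (hρ : 0 < ρ) (hρ2 : ρ ≤ 1 / 2) (hU : 0 < U ρ) :
    ∃ ε > 0, ∀ z z' : ℂ, ‖z - ρ‖ ≤ ε → ‖z' - ρ‖ ≤ ε → |U z - U z'| ≤ cN l lp lm * ‖z - z'‖ := by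
  obtain ⟨K, hK⟩ := h.slice
  obtain ⟨B, hB, hVB⟩ := h.bd
  have hl0 := h.mini.l0
  have hl2 := h.mini.l2
  have hlp := h.mini.lp0
  have hlm := h.mini.lm0
  have hpi := Real.pi_lt_d2
  have hM := cM_nonneg (l := l) hlp hlm
  have hS := cS_nonneg hl0.le hlp hlm
  have hB1 : 0 ≤ cB1 l lp lm := by unfold cB1; positivity
  have hB2 : 0 ≤ cB2 l lp lm := by unfold cB2; positivity
  have hlρ : 0 < l * ρ := by positivity
  have hlρ2 : l * ρ ≤ 6.4 * ρ := by nlinarith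
  have hB0 : 0 ≤ B := (abs_nonneg _).trans (hB 0)
  have hmaxb : ∀ w, |max (U w) 0| ≤ B := fun w => by
    rw [abs_of_nonneg (le_max_right _ _)]
    exact max_le ((le_abs_self _).trans (hB w)) hB0
  have hN1 : 512 * cM l lp lm ≤ cN l lp lm := by
    unfold cN
    have : 0 ≤ 4 * cB1 l lp lm / (l / 256) ^ 3 := by positivity
    have : 0 ≤ 4 * cB2 l lp lm / (l / 256) ^ 3 := by positivity
    linarith
  have hN2 : 4 * cB1 l lp lm / (l / 256) ^ 3 ≤ cN l lp lm := by
    unfold cN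
    have : 0 ≤ 4 * cB2 l lp lm / (l / 256) ^ 3 := by positivity
    linarith
  have hN3 : 4 * cB2 l lp lm / (l / 256) ^ 3 ≤ cN l lp lm := by
    unfold cN
    have : 0 ≤ 4 * cB1 l lp lm / (l / 256) ^ 3 := by positivity
    linarith
  by_cases hA : ∃ y : ℂ, ‖y - ρ‖ ≤ l / 128 * ρ ∧ U y ≤ 0
  · -- near zero
    obtain ⟨y1, hy1, hUy1⟩ := hA
    have hcomp : IsCompact (Metric.closedBall (ρ : ℂ) (l / 128 * ρ) ∩ {y | U y ≤ 0}) :=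
      (isCompact_closedBall _ _).inter_right (isClosed_le h.cont continuous_const)
    obtain ⟨y, hy, hmin⟩ := hcomp.exists_isMinOn (f := fun y => ‖y - (ρ : ℂ)‖) ⟨y1, by
      rw [Metric.mem_closedBall, Complex.dist_eq]; exact hy1, hUy1⟩ (by fun_prop)
    have hyb := hy.1
    rw [Metric.mem_closedBall, Complex.dist_eq] at hyb
    have hUy : U y ≤ 0 := hy.2
    set d := ‖y - (ρ : ℂ)‖ with hd
    have hd0 : 0 < d := by
      rw [hd, norm_pos_iff, sub_ne_zero]
      rintro rfl
      linarith
    have hp : ∀ w : ℂ, ‖w - ρ‖ ≤ 2 * (d / 4) → 0 < U w := by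
      intro w hw
      by_contra hcon
      have := hmin (a := w) ⟨by rw [Metric.mem_closedBall, Complex.dist_eq]; linarith, not_lt.mp hcon⟩
      simp only [mem_setOf_eq] at this
      linarith
    have hz := zero_growth h hD hρ hρ2 (y := y) (s := 2 * d) (by linarith) hUy (by positivity)
      (by linarith)
    have hsub : Metric.ball (ρ : ℂ) (2 * (d / 4)) ⊆ Metric.ball y (2 * d) := by
      refine Metric.ball_subset_ball' ?_
      rw [dist_comm, Complex.dist_eq]
      linarith
    have hI : ∫ w in Metric.ball (ρ : ℂ) (2 * (d / 4)), |U w - 0| ≤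
        (512 * cM l lp lm) * (d / 4) ^ 3 := by
      have e : ∫ w in Metric.ball (ρ : ℂ) (2 * (d / 4)), |U w - 0| =
          ∫ w in Metric.ball (ρ : ℂ) (2 * (d / 4)), max (U w) 0 := by
        refine setIntegral_congr_fun measurableSet_ball fun w hw => ?_
        rw [Metric.mem_ball, Complex.dist_eq] at hw
        have := hp w hw.le
        simp only [sub_zero]
        rw [abs_of_pos this, max_eq_left this.le]
      rw [e]
      refine (setIntegral_mono_set (intOn_cont (F := fun w => max (U w) 0)
        (h.cont.max continuous_const) hmaxb _ _)
        (Filter.Eventually.of_forall fun w => le_max_right _ _) hsub.eventuallyLE).trans ?_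
      refine hz.trans (le_of_eq ?_)
      ring
    refine ⟨d / 4, by positivity, fun z z' h1 h2 => ?_⟩
    have hg : GoodDisc l 1 (ρ : ℂ) (2 * (d / 4)) :=
      goodDisc_real hl0 hl2 hρ (by linarith) (by linarith)
    exact (lip_near h (by positivity) hg hp hI z z' h1 h2).trans
      (mul_le_mul_of_nonneg_right hN1 (norm_nonneg _))
  · push Not at hA
    have hg : GoodDisc l 1 (ρ : ℂ) (2 * (l / 256 * ρ)) :=
      goodDisc_real hl0 hl2 hρ (by linarith) (by linarith)
    have hg2 : GoodDisc l (2 * ρ) (ρ : ℂ) (2 * (l / 256 * ρ)) :=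
      goodDisc_real hl0 hl2 hρ (by linarith) (by linarith)
    have hp : ∀ w : ℂ, ‖w - ρ‖ ≤ 2 * (l / 256 * ρ) → 0 < U w := fun w hw =>
      hA w (by linarith)
    have hsub := ball_sub_Sec hl0 hg2
    have ha : 0 < l / 256 * ρ := by positivity
    refine ⟨l / 256 * ρ, ha, fun z z' h1 h2 => ?_⟩
    have e3 : ∀ D : ℝ, 4 * D * ρ ^ 3 = 4 * D / (l / 256) ^ 3 * (l / 256 * ρ) ^ 3 := fun D => by
      field_simp
    rcases le_or_gt T (4 * ρ) with hT | hT
    · have hI : ∫ w in Metric.ball (ρ : ℂ) (2 * (l / 256 * ρ)), |U w - 0| ≤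
          4 * cB1 l lp lm / (l / 256) ^ 3 * (l / 256 * ρ) ^ 3 := by
        have e : ∫ w in Metric.ball (ρ : ℂ) (2 * (l / 256 * ρ)), |U w - 0| =
            ∫ w in Metric.ball (ρ : ℂ) (2 * (l / 256 * ρ)), max (U w) 0 := by
          refine setIntegral_congr_fun measurableSet_ball fun w hw => ?_
          rw [Metric.mem_ball, Complex.dist_eq] at hw
          have := hp w hw.le
          simp only [sub_zero]
          rw [abs_of_pos this, max_eq_left this.le]
        rw [e, ← e3]
        refine (ball_le_cone (F := fun w => max (U w) 0) (G := posP V) (R := 2 * ρ) hl0 hl2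
          (by positivity) (h.cont.max continuous_const) hmaxb (fun _ => le_max_right _ _) hK.pos
          (fun _ _ => le_max_right _ _) (posP_bd hVB)
          (fun r θ hr hθ => by simp only [h.eq r θ hr hθ, posP]) hsub).trans ?_
        exact int_bound (hK.pos.contMc hl0.le) hρ hB1 fun r hr hr2 =>
          Mc_pos_le h.mini hD ht hT hr hr2 hρ2
      exact (lip_near h ha hg hp hI z z' h1 h2).trans
        (mul_le_mul_of_nonneg_right hN2 (norm_nonneg _))
    · have hI : ∫ w in Metric.ball (ρ : ℂ) (2 * (l / 256 * ρ)), |U w - V 0 0| ≤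
          4 * cB2 l lp lm / (l / 256) ^ 3 * (l / 256 * ρ) ^ 3 := by
        rw [← e3]
        have hb : ∀ x, |x| ≤ B → |(|x - V 0 0|)| ≤ B + B := fun x hx => by
          rw [abs_abs]
          exact (abs_sub _ _).trans (add_le_add hx (hVB 0 0))
        refine (ball_le_cone (F := fun w => |U w - V 0 0|) (G := fun r θ => |V r θ - V 0 0|)
          (R := 2 * ρ) (C := B + B) hl0 hl2
          (by positivity) (h.cont.sub continuous_const).abs (fun w => hb _ (hB w))
          (fun _ => abs_nonneg _) (hK.addc (V 0 0)).abs
          (fun _ _ => abs_nonneg _) (fun r θ => hb _ (hVB r θ))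
          (fun r θ hr hθ => by simp only [h.eq r θ hr hθ]) hsub).trans ?_
        exact int_bound ((hK.addc (V 0 0)).abs.contMc hl0.le) hρ hB2 fun r hr hr2 =>
          Mc_abs_le h.mini hD ht hT hr hr2
      exact (lip_near h ha hg hp hI z z' h1 h2).trans
        (mul_le_mul_of_nonneg_right hN3 (norm_nonneg _))

end

/-! ### Part 15 -/


lemma cN_nonneg {l lp lm : ℝ} (hl : 0 ≤ l) (hlp : 0 ≤ lp) (hlm : 0 ≤ lm) : 0 ≤ cN l lp lm := by
  have hM := cM_nonneg (l := l) hlp hlm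
  have hS := cS_nonneg hl hlp hlm
  have hB1 : 0 ≤ cB1 l lp lm := by unfold cB1; positivity
  have hB2 : 0 ≤ cB2 l lp lm := by unfold cB2; positivity
  unfold cN
  positivity

section
variable {l lp lm T : ℝ} {V : ℝ → ℝ → ℝ}

lemma deriv_bounds (h : Mini l 1 lp lm V) (hD : Dir l V 1 ≤ 1) (ht : TD V T) {ρ θ : ℝ}
    (hρ : 0 < ρ) (hρ2 : ρ ≤ 1 / 2) (hV : 0 < V ρ θ) :
    |deriv (fun s => V s θ) ρ| ≤ cN l lp lm ∧ |deriv (fun φ => V ρ φ) θ| ≤ cN l lp lm * ρ := by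
  obtain ⟨U, hU⟩ := exists_PL h θ
  have hl0 := h.l0
  have hN := cN_nonneg hl0.le h.lp0 h.lm0
  have hpr : pol ρ 0 = (ρ : ℂ) := by simp [pol]
  have hUρ : U ρ = V ρ θ := by
    rw [← hpr, hU.eq ρ 0 hρ.le (by simp; positivity)]
    unfold rot; rw [add_zero]
  obtain ⟨ε, hε, hL⟩ := grad_main hU (by rw [Dir_rot h]; exact hD) (ht.rot θ) hρ hρ2
    (by rw [hUρ]; exact hV)
  constructor
  · rw [← Real.norm_eq_abs]
    refine norm_deriv_le_of_lip' hN ?_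
    filter_upwards [Metric.ball_mem_nhds ρ hε, Ioi_mem_nhds hρ] with s hs hs0
    have e1 : V s θ = U (pol s 0) := by
      rw [hU.eq s 0 (le_of_lt hs0) (by simp; positivity)]; unfold rot; rw [add_zero]
    have e2 : ‖pol s 0 - ρ‖ = |s - ρ| := by rw [← hpr, pol_lipr]
    rw [Metric.mem_ball, Real.dist_eq] at hs
    have := hL (pol s 0) ρ (by rw [e2]; exact hs.le) (by simpa using hε.le)
    rw [e2] at this
    rw [e1, ← hUρ]
    exact this
  · rw [← Real.norm_eq_abs]
    refine norm_deriv_le_of_lip' (mul_nonneg hN hρ.le) ?_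
    have hε' : 0 < min (ε / ρ) (l / 4) := by positivity
    filter_upwards [Metric.ball_mem_nhds θ hε'] with φ hφ
    rw [Metric.mem_ball, Real.dist_eq] at hφ
    have e1 : V ρ φ = U (pol ρ (φ - θ)) := by
      rw [hU.eq ρ (φ - θ) hρ.le ((hφ.trans_le (min_le_right _ _)).le)]
      unfold rot; rw [add_sub_cancel]
    have e2 : ‖pol ρ (φ - θ) - ρ‖ ≤ ρ * |φ - θ| := by
      have := pol_lipt ρ (φ - θ) 0
      rwa [hpr, abs_of_pos hρ, sub_zero] at this
    have h3 : ρ * |φ - θ| ≤ ε := by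
      have := hφ.le.trans (min_le_left _ _)
      rw [le_div_iff₀ hρ] at this
      linarith
    have := hL (pol ρ (φ - θ)) ρ (e2.trans h3) (by simpa using hε.le)
    rw [e1, ← hUρ, Real.norm_eq_abs, Real.norm_eq_abs, mul_assoc]
    exact this.trans (mul_le_mul_of_nonneg_left e2 hN)

lemma ftc_bound {f : ℝ → ℝ} {K : NNReal} (hf : LipschitzWith K f) {a b C : ℝ}
    (h : ∀ x ∈ uIoc a b, |deriv f x| ≤ C) : |f b - f a| ≤ C * |b - a| := by
  rw [← (lip_ac hf a b).integral_deriv_eq_sub]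
  exact intervalIntegral.norm_integral_le_of_norm_le_const (f := deriv f) h

lemma clamp_lip (R r s : ℝ) : |max 0 (min r R) - max 0 (min s R)| ≤ |r - s| := by
  refine (abs_max_sub_max_le_max _ _ _ _).trans ?_
  rw [sub_self, abs_zero, max_eq_right (abs_nonneg _)]
  refine (abs_min_sub_min_le_max _ _ _ _).trans ?_
  rw [sub_self, abs_zero, max_eq_left (abs_nonneg _)]

lemma clamp_abs {R : ℝ} (hR : 0 ≤ R) (r : ℝ) : max 0 (min r R) ≤ |r| :=
  max_le (abs_nonneg _) ((min_le_left _ _).trans (le_abs_self _))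

lemma posP_slice (h : Mini l 1 lp lm V) (hD : Dir l V 1 ≤ 1) (ht : TD V T) :
    Slice l (cN l lp lm) (clampFn (1 / 2) (posP V)) := by
  obtain ⟨K, hK⟩ := h.slice
  have hN := cN_nonneg h.l0.le h.lp0 h.lm0
  have hP := hK.pos
  refine ⟨hN, fun r θ => hP.per _ _, fun r s θ => ?_, fun r θ φ => ?_⟩
  · unfold clampFn
    have hr := clamp_mem (R := 1 / 2) (by norm_num) r
    have hs := clamp_mem (R := 1 / 2) (by norm_num) s
    refine le_trans ?_ (mul_le_mul_of_nonneg_left (clamp_lip (1 / 2) r s) hN)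
    refine ftc_bound (hP.lipR θ) fun x hx => ?_
    have hx0 : 0 < x := lt_of_le_of_lt (le_min hs.1 hr.1) hx.1
    have hx1 : x ≤ 1 / 2 := hx.2.trans (max_le hs.2 hr.2)
    have e : deriv (fun s => posP V s θ) x = if 0 < V x θ then deriv (fun s => V s θ) x else 0 :=
      deriv_pos_part (hK.lipR θ).continuous x
    rw [e]
    split_ifs with hp
    · exact (deriv_bounds h hD ht hx0 hx1 hp).1
    · simpa using hN
  · unfold clampFn
    have hr := clamp_mem (R := 1 / 2) (by norm_num) r
    have hra := clamp_abs (R := 1 / 2) (by norm_num) r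
    set a := max 0 (min r (1 / 2)) with ha
    refine le_trans ?_ (mul_le_mul_of_nonneg_right (mul_le_mul_of_nonneg_left hra hN)
      (abs_nonneg _))
    rcases hr.1.eq_or_lt with h0 | h0
    · rw [← h0, hP.zero_eq θ φ]; simp
    · refine ftc_bound (hP.lipT a) fun x hx => ?_
      have e : deriv (fun s => posP V a s) x = if 0 < V a x then deriv (fun s => V a s) x else 0 :=
        deriv_pos_part (hK.lipT a).continuous x
      rw [e]
      split_ifs with hp
      · exact (deriv_bounds h hD ht h0 hr.2 hp).2
      · rw [abs_zero]; positivity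

end

lemma coneDist_rad {l : ℝ} (hl : 0 < l) (hl2 : l ≤ 2 * Real.pi) (r s θ : ℝ) :
    coneDist l (r, θ) (s, θ) = |r - s| := by
  rw [coneDist_near hl hl2 (by rw [sub_self, abs_zero]; positivity), pol_lipr]

lemma exists_FB {l K : ℝ} {u : ℝ → ℝ → ℝ} (hl : 0 < l) (hl2 : l ≤ 2 * Real.pi)
    (hK : Slice l K (clampFn 1 u)) {r1 r2 θ : ℝ} (h1 : r1 ∈ Icc (0:ℝ) (1/2))
    (h2 : r2 ∈ Icc (0:ℝ) (1/2)) (hp : 0 < clampFn 1 u r1 θ) (hn : clampFn 1 u r2 θ ≤ 0) :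
    ∃ q : ℝ × ℝ, InFreeBoundaryPos l u q ∧ q.1 ∈ Icc (0:ℝ) (1/2) := by
  have hpre : IsPreconnected (Icc (0:ℝ) (1/2)) := isPreconnected_Icc
  have hfr : (Icc (0:ℝ) (1/2) ∩ frontier {r | 0 < clampFn 1 u r θ}).Nonempty := by
    by_contra hcon
    rw [not_nonempty_iff_eq_empty, ← disjoint_iff_inter_eq_empty] at hcon
    have := (isPreconnected_iff_subset_of_disjoint.mp hpre) (interior {r | 0 < clampFn 1 u r θ})
      (interior {r | 0 < clampFn 1 u r θ}ᶜ) isOpen_interior isOpen_interior (fun r hr => by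
        by_contra hc
        refine disjoint_left.mp hcon hr ?_
        rw [frontier_eq_closure_inter_closure, closure_eq_compl_interior_compl,
          closure_eq_compl_interior_compl, compl_compl]
        simp only [mem_union, not_or] at hc
        exact ⟨hc.2, hc.1⟩) (by
        ext r
        simp only [mem_inter_iff, mem_empty_iff_false, iff_false, not_and]
        intro _ ha hb
        exact (interior_subset hb) (interior_subset ha))
    rcases this with h | h
    · exact absurd (interior_subset (h h2)) (not_lt.mpr hn)
    · exact (interior_subset (h h1)) hp
  obtain ⟨r, hr, hf⟩ := hfr
  rw [frontier_eq_closure_inter_closure] at hf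
  have hcl : ∀ r' : ℝ, coneDist l (r, θ) (max 0 (min r' 1), θ) ≤ |r' - r| := fun r' => by
    rw [coneDist_rad hl hl2, abs_sub_comm r' r]
    have := clamp_lip 1 r r'
    rwa [clamp_eq ⟨hr.1, by linarith [hr.2]⟩] at this
  refine ⟨(r, θ), ⟨⟨hr.1, by linarith [hr.2]⟩, fun δ hδ => ⟨?_, ?_⟩⟩, hr⟩
  · obtain ⟨r', hr', hd⟩ := Metric.mem_closure_iff.mp hf.1 δ hδ
    rw [dist_comm, Real.dist_eq] at hd
    exact ⟨(max 0 (min r' 1), θ), clamp_mem zero_le_one _, (hcl r').trans_lt hd, hr'⟩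
  · obtain ⟨r', hr', hd⟩ := Metric.mem_closure_iff.mp hf.2 δ hδ
    rw [dist_comm, Real.dist_eq] at hd
    exact ⟨(max 0 (min r' 1), θ), clamp_mem zero_le_one _, (hcl r').trans_lt hd, not_lt.mp hr'⟩

lemma FB_nonpos {l K : ℝ} {u : ℝ → ℝ → ℝ} (hl : 0 < l) (hl2 : l ≤ 2 * Real.pi)
    (hK : Slice l K (clampFn 1 u)) {q : ℝ × ℝ} (hq : InFreeBoundaryPos l u q) :
    clampFn 1 u q.1 q.2 ≤ 0 := by
  by_contra hcon
  have hcon := not_le.mp hcon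
  have hK0 := hK.K0
  obtain ⟨q', hq1, hd, hn⟩ := (hq.2 (clampFn 1 u q.1 q.2 / (3 * K + 1)) (by positivity)).2
  have h1 := hK.lipDist hl hl2 hq.1.1 hq1.1 q.2 q'.2
  rw [clampFn_eq hq1] at h1
  have h2 := (abs_le.mp h1).2
  have h3 : 3 * K * coneDist l (q.1, q.2) (q'.1, q'.2) ≤
      3 * K * (clampFn 1 u q.1 q.2 / (3 * K + 1)) := mul_le_mul_of_nonneg_left hd.le (by positivity)
  have h4 : (3 * K + 1) * (clampFn 1 u q.1 q.2 / (3 * K + 1)) = clampFn 1 u q.1 q.2 := by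
    field_simp
  have h5 : 0 < clampFn 1 u q.1 q.2 / (3 * K + 1) := by positivity
  linarith

theorem optimal_regularity (l lp lm : ℝ) (hl0 : 0 < l) (hl : l ≤ 2 * Real.pi)
    (hlp : 0 ≤ lp) (hlm : 0 ≤ lm) (hne : lp ≠ lm) :
    ∃ C > (0:ℝ), ∀ u : ℝ → ℝ → ℝ, IsMinimizerJ l lp lm 1 u → Dir l u 1 ≤ 1 →
      (∃ p : ℝ × ℝ, p.1 ∈ Set.Icc (0:ℝ) (1/2) ∧ u p.1 p.2 = 0) →
      ∀ x : ℝ × ℝ, x.1 ∈ Set.Icc (0:ℝ) (1/4) → 0 < u x.1 x.2 →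
        u x.1 x.2 ≤ C * distToFreeBoundary l u x ∧
        (0 < x.1 → Real.sqrt (gradSq u x) ≤ C) := by
  have hN := cN_nonneg hl0.le hlp hlm
  refine ⟨3 * cN l lp lm + 1, by positivity, ?_⟩
  rintro u hu hDu ⟨p, hp, hup⟩ x hx hux
  have h := hu.mini hl0 hl one_pos hlp hlm
  obtain ⟨K, hK⟩ := h.slice
  have hV : ∀ r ∈ Icc (0:ℝ) 1, ∀ θ, clampFn 1 u r θ = u r θ := fun r hr θ => clampFn_eq hr u θ
  have hD : Dir l (clampFn 1 u) 1 ≤ 1 := by rw [Dir_congr hV]; exact hDu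
  have hp1 : p.1 ∈ Icc (0:ℝ) 1 := ⟨hp.1, by linarith [hp.2]⟩
  have hx1 : x.1 ∈ Icc (0:ℝ) 1 := ⟨hx.1, by linarith [hx.2]⟩
  have hx2 : x.1 ∈ Icc (0:ℝ) (1/2) := ⟨hx.1, by linarith [hx.2]⟩
  have hVp : clampFn 1 u p.1 p.2 ≤ 0 := by rw [hV _ hp1, hup]
  have hVx : 0 < clampFn 1 u x.1 x.2 := by rwa [hV _ hx1]
  obtain ⟨T, θy, hT0, hT2, hy, hpos⟩ := hK.exists_T0 hl0 hp hVp
  have ht : TD (clampFn 1 u) T := ⟨hT0, hT2, ⟨θy, hy⟩, hpos⟩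
  constructor
  · have hFB : ∃ q : ℝ × ℝ, InFreeBoundaryPos l u q ∧ q.1 ∈ Icc (0:ℝ) (1/2) := by
      rcases le_or_gt (clampFn 1 u 0 0) 0 with h0 | h0
      · exact exists_FB hl0 hl hK hx2 ⟨le_rfl, by norm_num⟩ hVx (by rwa [hK.zero_eq x.2 0])
      · exact exists_FB hl0 hl hK ⟨le_rfl, by norm_num⟩ hp (by rwa [hK.zero_eq p.2 0]) hVp
    obtain ⟨q0, hq0, hq0'⟩ := hFB
    rw [mul_comm, ← div_le_iff₀ (by positivity)]
    refine le_csInf ⟨_, q0, hq0, hq0', rfl⟩ ?_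
    rintro d ⟨q, hq, hq', rfl⟩
    rw [div_le_iff₀ (by positivity)]
    have h1 := (posP_slice h hD ht).lipDist hl0 hl hx.1 hq'.1 x.2 q.2
    rw [clampFn_eq hx2, clampFn_eq hq'] at h1
    have h2 : posP (clampFn 1 u) q.1 q.2 = 0 := max_eq_right (FB_nonpos hl0 hl hK hq)
    have h3 : posP (clampFn 1 u) x.1 x.2 = u x.1 x.2 := by
      rw [← hV _ hx1]; exact max_eq_left hVx.le
    rw [h2, h3, sub_zero] at h1
    have h4 : 0 ≤ coneDist l (x.1, x.2) (q.1, q.2) := Real.sqrt_nonneg _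
    have h5 := le_abs_self (u x.1 x.2)
    have : coneDist l x q = coneDist l (x.1, x.2) (q.1, q.2) := rfl
    rw [this]
    linarith
  · intro hx0
    have e : gradSq u x = gradSq (clampFn 1 u) x :=
      gradSq_congr_open (S := Ioo (0:ℝ) 1 ×ˢ univ) (isOpen_Ioo.prod isOpen_univ)
        (fun p hp => (hV p.1 ⟨hp.1.1.le, hp.1.2.le⟩ p.2).symm) ⟨⟨hx0, by linarith [hx.2]⟩, mem_univ _⟩
    obtain ⟨h1, h2⟩ := deriv_bounds h hD ht hx0 hx2.2 hVx
    rw [e]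
    refine Real.sqrt_le_iff.mpr ⟨by positivity, ?_⟩
    have h3 : (deriv (fun s => clampFn 1 u s x.2) x.1) ^ 2 ≤ cN l lp lm ^ 2 :=
      sq_le_sq' (by linarith [abs_le.mp h1]) (abs_le.mp h1).2
    have h4 : (deriv (fun φ => clampFn 1 u x.1 φ) x.2) ^ 2 / x.1 ^ 2 ≤ cN l lp lm ^ 2 := by
      rw [div_le_iff₀ (by positivity), ← mul_pow]
      exact sq_le_sq' (by linarith [abs_le.mp h2]) (abs_le.mp h2).2
    unfold gradSq
    nlinarith
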